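/- Assume μ± ∈ C¹(ℝ²) are nonnegative and satisfy |μ±| + |∂_e μ±| + |∂_p μ±| ≤ C_μ/(1+|e|^γ) for some C_μ and some γ > 3. Suppose φ⁰, A_φ⁰ : Ω̄ → ℝ are continuous, toroidally symmetric, vanish on ∂Ω, and satisfy in the sense of distributions on Ω: −Δφ⁰ = ∫_{ℝ³} ( μ⁺(e⁺,p⁺) − μ⁻(e⁻,p⁻) ) dv and −ΔA_φ⁰ + A_φ⁰/ρ² = ∫_{ℝ³} v̂_φ ( μ⁺(e⁺,p⁺) − μ⁻(e⁻,p⁻) ) dv. Then φ⁰ and A_φ⁰ are twice continuously differentiable on Ω̄ with second derivatives α-Hölder continuous on Ω̄ for every α ∈ (0,1); consequently E⁰ = −∇φ⁰ and B⁰ = ∇×(A_φ⁰ e_φ) are C¹ on Ω̄ with α-Hölder first derivatives for every α ∈ (0,1). -/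

import Mathlib

open MeasureTheory Real Set Filter
open scoped ENNReal NNReal

noncomputable section

abbrev R3 : Type := Fin 3 → ℝ

/-- The open solid torus with major radius `a` and minor radius `1`. -/
def torus (a : ℝ) : Set R3 :=
  {x | (a - Real.sqrt ((x 0) ^ 2 + (x 1) ^ 2)) ^ 2 + (x 2) ^ 2 < 1}

/-- Distance to the `x₃`-axis, `ρ(x) = √(x₁² + x₂²)`. -/
def rad (x : R3) : ℝ := Real.sqrt ((x 0) ^ 2 + (x 1) ^ 2)

/-- The toroidal unit vector `e_φ(x) = (-x₂, x₁, 0)/ρ(x)`. -/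
def ephi (x : R3) : R3 := ![-(x 1) / rad x, x 0 / rad x, 0]

/-- Euclidean dot product on `ℝ³`. -/
def dot (u v : R3) : ℝ := ∑ i, u i * v i

/-- Cross product on `ℝ³`. -/
def cross (u v : R3) : R3 :=
  ![u 1 * v 2 - u 2 * v 1, u 2 * v 0 - u 0 * v 2, u 0 * v 1 - u 1 * v 0]

/-- Squared Euclidean norm. -/
def nsq (v : R3) : ℝ := ∑ i, (v i) ^ 2

/-- The relativistic energy `⟨v⟩ = √(1 + |v|²)`. -/
def vb (v : R3) : ℝ := Real.sqrt (1 + nsq v)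

/-- The relativistic velocity `v̂ = v/⟨v⟩`. -/
def vhat (v : R3) : R3 := fun i => v i / vb v

/-- `i`-th partial derivative. -/
def pd (f : R3 → ℝ) (i : Fin 3) (x : R3) : ℝ := fderiv ℝ f x (Pi.single i 1)

/-- Gradient. -/
def grad (f : R3 → ℝ) (x : R3) : R3 := fun i => pd f i x

/-- Curl of a vector field on `ℝ³`. -/
def curl (F : R3 → R3) (x : R3) : R3 :=
  ![pd (fun y => F y 2) 1 x - pd (fun y => F y 1) 2 x,
    pd (fun y => F y 0) 2 x - pd (fun y => F y 2) 0 x,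
    pd (fun y => F y 1) 0 x - pd (fun y => F y 0) 1 x]

/-- Laplacian. -/
def lap (f : R3 → ℝ) (x : R3) : ℝ := ∑ i, pd (pd f i) i x

/-- Rotation by angle `β` about the `x₃`-axis. -/
def rotZ (β : ℝ) (x : R3) : R3 :=
  ![Real.cos β * x 0 - Real.sin β * x 1, Real.sin β * x 0 + Real.cos β * x 1, x 2]

/-- Toroidal symmetry of a scalar function of `x`. -/
def torSym (f : R3 → ℝ) : Prop := ∀ β x, f (rotZ β x) = f x

/-- Toroidal symmetry (equivariance) of a vector field. -/
def torSymV (F : R3 → R3) : Prop := ∀ β x, F (rotZ β x) = rotZ β (F x)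

/-- Toroidal symmetry of a function of `(x, v)`. -/
def torSym2 (g : R3 → R3 → ℝ) : Prop := ∀ β x v, g (rotZ β x) (rotZ β v) = g x v

/-- Outward unit normal at a point of `∂Ω`. -/
def nvec (a : ℝ) (x : R3) : R3 :=
  ![(rad x - a) * x 0 / rad x, (rad x - a) * x 1 / rad x, x 2]

/-- Specular reflection of the velocity `v` at the boundary point `x`. -/
def specRefl (a : ℝ) (x v : R3) : R3 := fun i => v i - 2 * dot v (nvec a x) * nvec a x i

/-- `g(x, v)` is specular on `∂Ω`. -/
def specular (a : ℝ) (g : R3 → R3 → ℝ) : Prop :=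
  ∀ x ∈ frontier (torus a), ∀ v : R3, g x v = g x (specRefl a x v)

/-- The transport (Vlasov) operator `D g = v̂·∇ₓ g + σ (E⁰ + v̂×B⁰)·∇_v g`,
with sign `σ = ±1` according to the species. -/
def DopS (σ : ℝ) (E0 B0 : R3 → R3) (g : R3 → R3 → ℝ) (x v : R3) : ℝ :=
  dot (vhat v) (grad (fun y => g y v) x)
    + σ * dot (fun i => E0 x i + cross (vhat v) (B0 x) i) (grad (fun w => g x w) v)

/-- Sign of a species: `+1` for ions (`true`), `-1` for electrons (`false`). -/
def sg (b : Bool) : ℝ := if b then 1 else -1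

/-- Partial derivative `∂_e` of a function `μ(e, p)`. -/
def d1 (F : ℝ × ℝ → ℝ) (q : ℝ × ℝ) : ℝ := fderiv ℝ F q (1, 0)

/-- Partial derivative `∂_p` of a function `μ(e, p)`. -/
def d2 (F : ℝ × ℝ → ℝ) (q : ℝ × ℝ) : ℝ := fderiv ℝ F q (0, 1)

/-- The equilibrium electric field `E⁰ = -∇φ⁰`. -/
def Efield (φ0 : R3 → ℝ) (x : R3) : R3 := fun i => -(grad φ0 x i)

/-- The equilibrium magnetic field `B⁰ = ∇×(A_φ⁰ e_φ)`. -/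
def Bfield (A : R3 → ℝ) (x : R3) : R3 := curl (fun y => fun i => A y * ephi y i) x

/-- The particle energy `e±(x,v) = ⟨v⟩ ± φ⁰(x)`. -/
def epm (σ : ℝ) (φ0 : R3 → ℝ) (x v : R3) : ℝ := vb v + σ * φ0 x

/-- The particle angular momentum `p±(x,v) = ρ(x)(v_φ ± A_φ⁰(x))`. -/
def ppm (σ : ℝ) (A : R3 → ℝ) (x v : R3) : ℝ := rad x * (dot v (ephi x) + σ * A x)


/-- `i`-th partial derivative within a set. -/
def pdW (s : Set R3) (f : R3 → ℝ) (i : Fin 3) (x : R3) : ℝ :=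
  fderivWithin ℝ f s x (Pi.single i 1)

/-- Gradient within a set. -/
def gradW (s : Set R3) (f : R3 → ℝ) (x : R3) : R3 := fun i => pdW s f i x

/-- Curl within a set. -/
def curlW (s : Set R3) (F : R3 → R3) (x : R3) : R3 :=
  ![pdW s (fun y => F y 2) 1 x - pdW s (fun y => F y 1) 2 x,
    pdW s (fun y => F y 0) 2 x - pdW s (fun y => F y 2) 0 x,
    pdW s (fun y => F y 1) 0 x - pdW s (fun y => F y 0) 1 x]

open MeasureTheory Real Set Filter
open scoped ENNReal NNReal ComplexConjugate
noncomputable section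

lemma int_pow_disk (s : ℝ) (hs : s < 2) : ∃ C : ℝ, 0 ≤ C ∧ ∀ z : ℂ, ‖z‖ ≤ 1 →
    IntegrableOn (fun ζ : ℂ => ‖z - ζ‖ ^ (-s)) (Metric.ball 0 1) ∧
    ∫ ζ in Metric.ball (0:ℂ) 1, ‖z - ζ‖ ^ (-s) ≤ C := by
  have hI : IntegrableOn (fun w : ℂ => ‖w‖ ^ (-s)) (Metric.ball 0 2) := by
    refine integrableOn_ball_of_norm_le_rpow (C := 1) (α := s) (by simp) (by simpa using hs) ?_
      (measurable_norm.pow_const _).aestronglyMeasurable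
    filter_upwards with x
    rw [Real.norm_of_nonneg (by positivity), one_mul]
  refine ⟨∫ w in Metric.ball (0:ℂ) 2, ‖w‖ ^ (-s), integral_nonneg fun _ => by positivity, ?_⟩
  intro z hz
  have hmp : MeasurePreserving (fun ζ : ℂ => z - ζ) volume volume :=
    Measure.measurePreserving_sub_left volume z
  have hemb : MeasurableEmbedding (fun ζ : ℂ => z - ζ) :=
    (MeasurableEquiv.subLeft z).measurableEmbedding
  have hsub : Metric.ball (0:ℂ) 1 ⊆ (fun ζ : ℂ => z - ζ) ⁻¹' (Metric.ball 0 2) := by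
    intro ζ hζ
    simp only [mem_preimage, mem_ball_zero_iff] at *
    linarith [norm_sub_le z ζ]
  have h1 : IntegrableOn (fun ζ : ℂ => ‖z - ζ‖ ^ (-s)) ((fun ζ : ℂ => z - ζ) ⁻¹' (Metric.ball 0 2)) :=
    (hmp.integrableOn_comp_preimage hemb).2 hI
  refine ⟨h1.mono_set hsub, ?_⟩
  rw [← hmp.setIntegral_preimage_emb hemb (fun w : ℂ => ‖w‖ ^ (-s))]
  exact setIntegral_mono_set h1 (by filter_upwards with x; positivity) hsub.eventuallyLE

def Kn (z ζ : ℂ) : ℂ := (z - ζ)⁻¹ + conj ζ * (1 - z * conj ζ)⁻¹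

lemma norm_one_sub_ge {z ζ : ℂ} (hz : ‖z‖ ≤ 1) (hζ : ‖ζ‖ ≤ 1) :
    ‖z - ζ‖ ≤ ‖1 - z * conj ζ‖ := by
  apply le_of_sq_le_sq _ (norm_nonneg _)
  have e1 : ‖z‖ ^ 2 ≤ 1 := by nlinarith [norm_nonneg z]
  have e2 : ‖ζ‖ ^ 2 ≤ 1 := by nlinarith [norm_nonneg ζ]
  rw [Complex.sq_norm, Complex.normSq_apply] at *
  rw [Complex.sq_norm, Complex.normSq_apply] at *
  simp at *
  nlinarith [mul_nonneg (sub_nonneg.2 e1) (sub_nonneg.2 e2)]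

lemma Kn_bound {z ζ : ℂ} (hz : ‖z‖ ≤ 1) (hζ : ‖ζ‖ ≤ 1) (h : z ≠ ζ) :
    ‖Kn z ζ‖ ≤ 2 * ‖z - ζ‖ ^ (-1 : ℝ) := by
  have hp : 0 < ‖z - ζ‖ := norm_pos_iff.2 (sub_ne_zero.2 h)
  have h1 := norm_one_sub_ge hz hζ
  rw [Real.rpow_neg_one]
  unfold Kn
  refine (norm_add_le _ _).trans ?_
  rw [norm_mul, norm_inv, norm_inv, RCLike.norm_conj]
  have : ‖1 - z * conj ζ‖⁻¹ ≤ ‖z - ζ‖⁻¹ := inv_anti₀ hp h1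
  have : ‖ζ‖ * ‖1 - z * conj ζ‖⁻¹ ≤ 1 * ‖z - ζ‖⁻¹ :=
    mul_le_mul hζ this (by positivity) (by norm_num)
  linarith

lemma aux_mn {t m M β : ℝ} (hm : 0 < m) (hmM : m ≤ M) (ht : t ≤ m + M) (ht0 : 0 < t)
    (hβ0 : 0 < β) (hβ1 : β < 1) : t / (m * M) ≤ 2 * t ^ β * m ^ (-(1 + β)) := by
  have hM : 0 < M := hm.trans_le hmM
  have h1 : t = t ^ β * t ^ (1 - β) := by rw [← Real.rpow_add ht0]; simp
  have h2 : t ^ (1 - β) ≤ 2 * M ^ (1 - β) := by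
    calc t ^ (1 - β) ≤ (2 * M) ^ (1 - β) :=
          Real.rpow_le_rpow ht0.le (by linarith) (by linarith)
      _ = 2 ^ (1 - β) * M ^ (1 - β) := Real.mul_rpow (by norm_num) hM.le
      _ ≤ 2 * M ^ (1 - β) := by
          gcongr
          calc (2:ℝ) ^ (1 - β) ≤ 2 ^ (1:ℝ) := Real.rpow_le_rpow_of_exponent_le (by norm_num) (by linarith)
            _ = 2 := by norm_num
  have h3 : M ^ (1 - β) / M = M ^ (-β) := by
    rw [← Real.rpow_sub_one hM.ne']; ring_nf
  have h4 : M ^ (-β) ≤ m ^ (-β) := by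
    rw [Real.rpow_neg hM.le, Real.rpow_neg hm.le]
    exact inv_anti₀ (by positivity) (Real.rpow_le_rpow hm.le hmM hβ0.le)
  have h5 : m ^ (-(1 + β)) = m⁻¹ * m ^ (-β) := by
    rw [neg_add, Real.rpow_add hm, Real.rpow_neg_one]
  calc t / (m * M) = t ^ β * t ^ (1 - β) / (m * M) := by rw [← h1]
    _ ≤ t ^ β * (2 * M ^ (1 - β)) / (m * M) := by gcongr
    _ = 2 * t ^ β * (m⁻¹ * (M ^ (1 - β) / M)) := by field_simp
    _ = 2 * t ^ β * (m⁻¹ * M ^ (-β)) := by rw [h3]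
    _ ≤ 2 * t ^ β * (m⁻¹ * m ^ (-β)) := by gcongr
    _ = _ := by rw [h5]

lemma Kn_diff {z z' ζ : ℂ} {β : ℝ} (hz : ‖z‖ ≤ 1) (hz' : ‖z'‖ ≤ 1) (hζ : ‖ζ‖ < 1)
    (h : z ≠ ζ) (h' : z' ≠ ζ) (hzz : z ≠ z') (hβ0 : 0 < β) (hβ1 : β < 1) :
    ‖Kn z ζ - Kn z' ζ‖ ≤ 4 * ‖z - z'‖ ^ β *
      (‖z - ζ‖ ^ (-(1 + β)) + ‖z' - ζ‖ ^ (-(1 + β))) := by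
  have hp : 0 < ‖z - ζ‖ := norm_pos_iff.2 (sub_ne_zero.2 h)
  have hp' : 0 < ‖z' - ζ‖ := norm_pos_iff.2 (sub_ne_zero.2 h')
  have ht : 0 < ‖z - z'‖ := norm_pos_iff.2 (sub_ne_zero.2 hzz)
  have h1 := norm_one_sub_ge hz hζ.le
  have h1' := norm_one_sub_ge hz' hζ.le
  have n1 : z - ζ ≠ 0 := sub_ne_zero.2 h
  have n1' : z' - ζ ≠ 0 := sub_ne_zero.2 h'
  have n2 : 1 - z * conj ζ ≠ 0 := norm_pos_iff.1 (hp.trans_le h1)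
  have n2' : 1 - z' * conj ζ ≠ 0 := norm_pos_iff.1 (hp'.trans_le h1')
  have e : Kn z ζ - Kn z' ζ = (z' - z) / ((z - ζ) * (z' - ζ)) +
      conj ζ * conj ζ * (z - z') / ((1 - z * conj ζ) * (1 - z' * conj ζ)) := by
    unfold Kn
    generalize conj ζ = w at *
    rw [div_add_div _ _ (mul_ne_zero n1 n1') (mul_ne_zero n2 n2'), eq_div_iff
      (mul_ne_zero (mul_ne_zero n1 n1') (mul_ne_zero n2 n2'))]
    have i1 := mul_inv_cancel₀ n1
    have i1' := mul_inv_cancel₀ n1'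
    have i2 := mul_inv_cancel₀ n2
    have i2' := mul_inv_cancel₀ n2'
    linear_combination (z' - ζ) * (1 - z * w) * (1 - z' * w) * i1 
      - (z - ζ) * (1 - z * w) * (1 - z' * w) * i1'
      + w * (z - ζ) * (z' - ζ) * (1 - z' * w) * i2 - w * (z - ζ) * (z' - ζ) * (1 - z * w) * i2'
  have key : ‖Kn z ζ - Kn z' ζ‖ ≤ 2 * (‖z - z'‖ / (‖z - ζ‖ * ‖z' - ζ‖)) := by
    rw [e]
    refine (norm_add_le _ _).trans ?_
    have a1 : ‖(z' - z) / ((z - ζ) * (z' - ζ))‖ = ‖z - z'‖ / (‖z - ζ‖ * ‖z' - ζ‖) := by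
      rw [norm_div, norm_mul, norm_sub_rev z' z]
    have a2 : ‖conj ζ * conj ζ * (z - z') / ((1 - z * conj ζ) * (1 - z' * conj ζ))‖ ≤
        ‖z - z'‖ / (‖z - ζ‖ * ‖z' - ζ‖) := by
      rw [norm_div, norm_mul, norm_mul, norm_mul, RCLike.norm_conj]
      apply div_le_div₀ (norm_nonneg _) _ (by positivity) (by gcongr)
      have : ‖ζ‖ * ‖ζ‖ ≤ 1 := by nlinarith [norm_nonneg ζ]
      nlinarith [norm_nonneg (z - z')]
    linarith
  have tri : ‖z - z'‖ ≤ ‖z - ζ‖ + ‖z' - ζ‖ := by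
    have := norm_sub_le (z - ζ) (z' - ζ); simpa using this
  have p1 : 0 ≤ ‖z - ζ‖ ^ (-(1 + β)) := by positivity
  have p2 : 0 ≤ ‖z' - ζ‖ ^ (-(1 + β)) := by positivity
  have p3 : 0 ≤ ‖z - z'‖ ^ β := by positivity
  rcases le_total ‖z - ζ‖ ‖z' - ζ‖ with hc | hc
  · have := aux_mn hp hc tri ht hβ0 hβ1
    nlinarith [mul_nonneg p3 p2]
  · have := aux_mn hp' hc (by linarith) ht hβ0 hβ1
    rw [mul_comm ‖z - ζ‖] at key
    nlinarith [mul_nonneg p3 p1]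

lemma ae_ne_disk (z : ℂ) : ∀ᵐ ζ ∂(volume.restrict (Metric.ball (0:ℂ) 1)), z ≠ ζ := by
  apply ae_restrict_of_ae
  have : ∀ᵐ ζ : ℂ, ζ ≠ z := by simp [ae_iff]
  filter_upwards [this] with ζ h using h.symm

lemma ae_mem_disk : ∀ᵐ ζ ∂(volume.restrict (Metric.ball (0:ℂ) 1)), ‖ζ‖ < 1 := by
  filter_upwards [ae_restrict_mem Metric.isOpen_ball.measurableSet] with ζ h
  simpa using h

lemma Kn_meas (z : ℂ) : Measurable (Kn z) := by
  unfold Kn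
  have : Measurable (fun ζ : ℂ => conj ζ) := Complex.continuous_conj.measurable
  fun_prop

lemma pot_integrable {F : ℂ → ℂ} (hF : Continuous F) {z : ℂ} (hz : ‖z‖ ≤ 1) :
    IntegrableOn (fun ζ => F ζ * Kn z ζ) (Metric.ball 0 1) := by
  obtain ⟨C, hC, h⟩ := int_pow_disk 1 (by norm_num)
  obtain ⟨M, hM⟩ := (isCompact_closedBall (0:ℂ) 1).exists_bound_of_continuousOn hF.continuousOn
  apply Integrable.mono' ((h z hz).1.const_mul (M * 2))
  · exact (hF.measurable.mul (Kn_meas z)).aestronglyMeasurable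
  · filter_upwards [ae_ne_disk z, ae_mem_disk] with ζ h1 h2
    rw [norm_mul, mul_assoc]
    exact mul_le_mul (hM ζ (by simpa using h2.le)) (Kn_bound hz h2.le h1) (norm_nonneg _)
      ((norm_nonneg _).trans (hM 0 (by simp)))

lemma pot_bound (β : ℝ) (hβ0 : 0 < β) (hβ1 : β < 1) : ∃ C : ℝ, 0 ≤ C ∧ ∀ (F : ℂ → ℂ) (M : ℝ),
    Continuous F → (∀ ζ, ‖ζ‖ ≤ 1 → ‖F ζ‖ ≤ M) → 
    (∀ z : ℂ, ‖z‖ ≤ 1 → ‖∫ ζ in Metric.ball (0:ℂ) 1, F ζ * Kn z ζ‖ ≤ C * M) ∧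
    (∀ z z' : ℂ, ‖z‖ ≤ 1 → ‖z'‖ ≤ 1 → 
      ‖(∫ ζ in Metric.ball (0:ℂ) 1, F ζ * Kn z ζ) - ∫ ζ in Metric.ball (0:ℂ) 1, F ζ * Kn z' ζ‖
        ≤ C * M * ‖z - z'‖ ^ β) := by
  obtain ⟨C1, hC1, h1⟩ := int_pow_disk 1 (by norm_num)
  obtain ⟨C2, hC2, h2⟩ := int_pow_disk (1 + β) (by linarith)
  refine ⟨2 * C1 + 8 * C2, by positivity, ?_⟩
  intro F M hF hM
  have hM0 : 0 ≤ M := (norm_nonneg _).trans (hM 0 (by simp))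
  constructor
  · intro z hz
    have : ‖∫ ζ in Metric.ball (0:ℂ) 1, F ζ * Kn z ζ‖ ≤
        ∫ ζ in Metric.ball (0:ℂ) 1, (M * 2) * ‖z - ζ‖ ^ (-1:ℝ) := by
      apply norm_integral_le_of_norm_le ((h1 z hz).1.const_mul (M * 2))
      filter_upwards [ae_ne_disk z, ae_mem_disk] with ζ h1 h2
      rw [norm_mul, mul_assoc]
      exact mul_le_mul (hM ζ h2.le) (Kn_bound hz h2.le h1) (norm_nonneg _) hM0
    rw [integral_const_mul] at this
    have := (h1 z hz).2
    nlinarith [mul_nonneg hM0 hC2]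
  · intro z z' hz hz'
    by_cases hzz : z = z'
    · subst hzz; simp; positivity
    rw [← integral_sub (pot_integrable hF hz) (pot_integrable hF hz')]
    have : ‖∫ ζ in Metric.ball (0:ℂ) 1, (F ζ * Kn z ζ - F ζ * Kn z' ζ)‖ ≤
        ∫ ζ in Metric.ball (0:ℂ) 1, (M * (4 * ‖z - z'‖ ^ β)) * 
          (‖z - ζ‖ ^ (-(1 + β)) + ‖z' - ζ‖ ^ (-(1 + β))) := by
      apply norm_integral_le_of_norm_le (((h2 z hz).1.add (h2 z' hz').1).const_mul _)
      filter_upwards [ae_ne_disk z, ae_ne_disk z', ae_mem_disk] with ζ h1 h1' h2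
      rw [← mul_sub, norm_mul, mul_assoc]
      exact mul_le_mul (hM ζ h2.le) (Kn_diff hz hz' h2 h1 h1' hzz hβ0 hβ1) (norm_nonneg _) hM0
    rw [integral_const_mul, integral_add (h2 z hz).1 (h2 z' hz').1] at this
    refine this.trans ?_
    have a1 := (h2 z hz).2
    have a2 := (h2 z' hz').2
    have p3 : 0 ≤ ‖z - z'‖ ^ β := by positivity
    calc _ ≤ (M * (4 * ‖z - z'‖ ^ β)) * (C2 + C2) := by gcongr
      _ ≤ _ := by nlinarith [mul_nonneg (mul_nonneg hM0 hC1) p3]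
end

open MeasureTheory Real Set Filter
open scoped ENNReal NNReal ComplexConjugate
noncomputable section

def Jc (n : ℤ) (w : ℂ) (r : ℝ) : ℂ := ∮ ζ in C(0, r), ζ ^ n * (w - ζ)⁻¹

lemma Jc_cont (n : ℤ) {w : ℂ} {r : ℝ} (hr : 0 < r) (hw : ‖w‖ ≠ r) :
    ContinuousOn (fun ζ : ℂ => ζ ^ n * (w - ζ)⁻¹) (Metric.sphere 0 r) := by
  intro ζ hζ
  have h : ‖ζ‖ = r := by simpa using hζ
  have h0 : ζ ≠ 0 := by rintro rfl; simp at h; linarith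
  have h1 : w - ζ ≠ 0 := by
    intro hh; rw [sub_eq_zero] at hh; subst hh; exact hw h
  exact ((continuousAt_zpow₀ ζ n (Or.inl h0)).mul
    ((continuousAt_const.sub continuousAt_id).inv₀ h1)).continuousWithinAt

lemma Jc_rec (n : ℤ) {w : ℂ} {r : ℝ} (hr : 0 < r) (hw : ‖w‖ ≠ r) :
    w * Jc n w r - Jc (n + 1) w r = if n = -1 then 2 * π * Complex.I else 0 := by
  have h1 : (∮ ζ in C(0, r), ζ ^ n) = if n = -1 then 2 * π * Complex.I else 0 := by
    split_ifs with h
    · subst h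
      have := circleIntegral.integral_sub_center_inv 0 hr.ne'
      simpa using this
    · have := circleIntegral.integral_sub_zpow_of_ne h 0 0 r
      simpa using this
  rw [← h1]
  unfold Jc
  rw [← circleIntegral.integral_const_mul, ← circleIntegral.integral_sub]
  · apply circleIntegral.integral_congr hr.le
    intro ζ hζ
    have h : ‖ζ‖ = r := by simpa using hζ
    have h0 : ζ ≠ 0 := by rintro rfl; simp at h; linarith
    have h1 : w - ζ ≠ 0 := by
      intro hh; rw [sub_eq_zero] at hh; subst hh; exact hw h
    simp only
    rw [zpow_add_one₀ h0]
    field_simp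
  · exact ((Jc_cont n hr hw).const_mul w).circleIntegrable hr.le
  · exact (Jc_cont (n+1) hr hw).circleIntegrable hr.le

lemma Jc_zero_in {w : ℂ} {r : ℝ} (hw : ‖w‖ < r) : Jc 0 w r = -(2 * π * Complex.I) := by
  have := circleIntegral.integral_sub_inv_of_mem_ball (c := 0) (w := w) (R := r) (by simpa using hw)
  rw [← this]
  unfold Jc
  rw [← neg_one_mul, ← circleIntegral.integral_const_mul]
  congr 1; ext ζ; simp [← inv_neg]

lemma Jc_zero_out {w : ℂ} {r : ℝ} (hr : 0 < r) (hw : r < ‖w‖) : Jc 0 w r = 0 := by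
  unfold Jc
  apply DiffContOnCl.circleIntegral_eq_zero hr.le
  apply DifferentiableOn.diffContOnCl
  intro ζ hζ
  have h : ‖ζ‖ ≤ r := by
    have := Metric.closure_ball_subset_closedBall hζ; simpa using this
  have h1 : w - ζ ≠ 0 := by
    intro hh; rw [sub_eq_zero] at hh; subst hh; linarith
  simp only [zpow_zero, one_mul]
  fun_prop (disch := exact h1)

lemma Jc_in {w : ℂ} {r : ℝ} (hw0 : w ≠ 0) (hw : ‖w‖ < r) (n : ℤ) :
    Jc n w r = if 0 ≤ n then -(2 * π * Complex.I) * w ^ n else 0 := by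
  have hr : 0 < r := (norm_nonneg _).trans_lt hw
  induction n using Int.induction_on with
  | zero => simp [Jc_zero_in hw]
  | succ i ih =>
    have := Jc_rec (i:ℤ) hr hw.ne
    rw [if_neg (by lia), ih, if_pos (by lia)] at this
    rw [if_pos (by lia), zpow_add_one₀ hw0]
    linear_combination -this
  | pred i ih =>
    have := Jc_rec (-(i:ℤ) - 1) hr hw.ne
    rw [sub_add_cancel, ih] at this
    rw [if_neg (by lia)]
    apply mul_left_cancel₀ hw0
    rcases Nat.eq_zero_or_pos i with h | h
    · subst h; simp at this; simp
      exact this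
    · rw [if_neg (by lia), if_neg (by lia)] at this
      simpa using this

lemma Jc_out {w : ℂ} {r : ℝ} (hr : 0 < r) (hw : r < ‖w‖) (n : ℤ) :
    Jc n w r = if 0 ≤ n then 0 else (2 * π * Complex.I) * w ^ n := by
  have hw0 : w ≠ 0 := by rintro rfl; simp at hw; linarith
  induction n using Int.induction_on with
  | zero => simp [Jc_zero_out hr hw]
  | succ i ih =>
    have := Jc_rec (i:ℤ) hr hw.ne'
    rw [if_neg (by lia), ih, if_pos (by lia)] at this
    rw [if_pos (by lia)]
    linear_combination -this
  | pred i ih =>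
    have := Jc_rec (-(i:ℤ) - 1) hr hw.ne'
    rw [sub_add_cancel, ih] at this
    rw [if_neg (by lia)]
    apply mul_left_cancel₀ hw0
    rw [zpow_sub_one₀ hw0]
    have e : w * (2 * π * Complex.I * (w ^ (-(i:ℤ)) * w⁻¹)) = 2 * π * Complex.I * w ^ (-(i:ℤ)) := by
      field_simp
    rw [e]
    rcases Nat.eq_zero_or_pos i with h | h
    · subst h; simpa using this
    · rw [if_neg (by lia), if_neg (by lia)] at this
      linear_combination this

lemma polar_disk {g : ℂ → ℂ} (hgm : Measurable g) (hg : IntegrableOn g (Metric.ball 0 1)) :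
    ∫ ζ in Metric.ball (0:ℂ) 1, g ζ =
      ∫ r in Ioo (0:ℝ) 1, (r:ℂ) * ∫ θ in (0:ℝ)..(2 * π), g (circleMap 0 r θ) := by
  have hB : MeasurableSet (Metric.ball (0:ℂ) 1) := Metric.isOpen_ball.measurableSet
  rw [← integral_indicator hB, ← Complex.integral_comp_polarCoord_symm]
  rw [show polarCoord.target = Ioi (0:ℝ) ×ˢ Ioo (-π) π from rfl]
  have hintg : IntegrableOn (fun p : ℝ × ℝ => p.1 • (Metric.ball (0:ℂ) 1).indicator g 
      (Complex.polarCoord.symm p)) (Ioi (0:ℝ) ×ˢ Ioo (-π) π) (volume.prod volume) := by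
    have hm : Measurable (fun p : ℝ × ℝ => p.1 • (Metric.ball (0:ℂ) 1).indicator g 
        (Complex.polarCoord.symm p)) := by
      apply Measurable.smul measurable_fst
      apply (hgm.indicator hB).comp
      have : (fun p : ℝ × ℝ => Complex.polarCoord.symm p) = 
          fun p : ℝ × ℝ => (p.1 : ℂ) * (Real.cos p.2 + Real.sin p.2 * Complex.I) := by
        ext p; exact Complex.polarCoord_symm_apply p
      show Measurable (fun p : ℝ × ℝ => Complex.polarCoord.symm p)
      rw [this]
      fun_prop
    refine ⟨hm.aestronglyMeasurable, ?_⟩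
    have h2 := (hg.integrable_indicator hB).2
    rw [hasFiniteIntegral_iff_enorm] at h2 ⊢
    rw [← Complex.lintegral_comp_polarCoord_symm] at h2
    refine lt_of_le_of_lt (le_of_eq ?_) h2
    rw [show polarCoord.target = Ioi (0:ℝ) ×ˢ Ioo (-π) π from rfl, ← Measure.volume_eq_prod]
    apply setLIntegral_congr_fun (measurableSet_Ioi.prod measurableSet_Ioo)
    rintro p ⟨hp, -⟩
    simp only
    rw [enorm_smul, smul_eq_mul]
    congr 1
    rw [Real.enorm_eq_ofReal (le_of_lt hp)]
  rw [Measure.volume_eq_prod, setIntegral_prod _ hintg]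
  have e1 : ∀ r ∈ Ioi (0:ℝ), (∫ θ in Ioo (-π) π, r • (Metric.ball (0:ℂ) 1).indicator g 
        (Complex.polarCoord.symm (r, θ))) = (Ioo (0:ℝ) 1).indicator
        (fun r : ℝ => (r:ℂ) * ∫ θ in (0:ℝ)..(2 * π), g (circleMap 0 r θ)) r := by
    intro r hr
    have hr' : (0:ℝ) < r := hr
    rw [integral_smul]
    have e2 : ∀ θ : ℝ, Complex.polarCoord.symm (r, θ) = circleMap 0 r θ := by
      intro θ; simp [circleMap, Complex.exp_mul_I]
    by_cases h1 : r < 1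
    · rw [indicator_of_mem (show r ∈ Ioo (0:ℝ) 1 from ⟨hr, h1⟩)]
      rw [Complex.real_smul]
      congr 1
      have : ∀ θ : ℝ, (Metric.ball (0:ℂ) 1).indicator g (Complex.polarCoord.symm (r, θ)) =
          g (circleMap 0 r θ) := by
        intro θ
        rw [e2, indicator_of_mem]
        simp [abs_of_pos hr', h1]
      simp_rw [this]
      rw [← integral_Ioc_eq_integral_Ioo, ← intervalIntegral.integral_of_le (by linarith [pi_pos])]
      have hper : Function.Periodic (fun θ : ℝ => g (circleMap 0 r θ)) (2 * π) := by
        intro θ; simp only; rw [periodic_circleMap 0 r θ]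
      have := hper.intervalIntegral_add_eq (-π) 0
      rw [show -π + 2 * π = π by ring, zero_add] at this
      exact this
    · rw [indicator_of_notMem (by simp [h1])]
      have : ∀ θ : ℝ, (Metric.ball (0:ℂ) 1).indicator g (Complex.polarCoord.symm (r, θ)) = 0 := by
        intro θ
        rw [e2, indicator_of_notMem]
        simp [abs_of_pos hr']; linarith
      simp_rw [this]; simp
  rw [setIntegral_congr_fun measurableSet_Ioi e1, setIntegral_indicator measurableSet_Ioo]
  congr 2
  ext r; simp
end

open MeasureTheory Real Set Filter
open scoped ENNReal NNReal ComplexConjugate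
noncomputable section

lemma theta_int (j k : ℕ) {z : ℂ} {r : ℝ} (hr : 0 < r) (hr1 : r < 1) (hz : ‖z‖ < 1) (hzr : ‖z‖ ≠ r) :
    (∫ θ in (0:ℝ)..(2 * π), (circleMap 0 r θ) ^ j * (conj (circleMap 0 r θ)) ^ k * Kn z (circleMap 0 r θ))
      = Complex.I⁻¹ * ((r:ℂ) ^ (2 * k) * Jc ((j:ℤ) - k - 1) z r
        - (r:ℂ) ^ (2 * k + 2) * Jc ((j:ℤ) - k - 1) (z * r ^ 2) r) := by
  have hw : ‖z * (r:ℂ) ^ 2‖ < r := by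
    rw [norm_mul, norm_pow, Complex.norm_real, Real.norm_of_nonneg hr.le]
    nlinarith [norm_nonneg z, mul_pos hr hr]
  unfold Jc
  rw [← circleIntegral.integral_const_mul, ← circleIntegral.integral_const_mul,
    ← circleIntegral.integral_sub ((((Jc_cont _ hr hzr)).const_mul _).circleIntegrable hr.le)
      ((((Jc_cont _ hr hw.ne)).const_mul _).circleIntegrable hr.le),
    ← circleIntegral.integral_const_mul]
  unfold circleIntegral
  apply intervalIntegral.integral_congr
  intro θ _
  simp only [deriv_circleMap, smul_eq_mul]
  have hn : ‖circleMap 0 r θ‖ = r := by simp [abs_of_pos hr]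
  generalize circleMap 0 r θ = ζ at *
  have h0 : ζ ≠ 0 := by rintro rfl; simp at hn; linarith
  have hc : conj ζ = r ^ 2 * ζ⁻¹ := by
    field_simp
    rw [mul_comm, Complex.mul_conj, Complex.normSq_eq_norm_sq, hn]; simp
  have h1 : z - ζ ≠ 0 := by
    intro hh; rw [sub_eq_zero] at hh; subst hh; exact hzr hn
  have h2 : z * r ^ 2 - ζ ≠ 0 := by
    intro hh; rw [sub_eq_zero] at hh; rw [hh] at hw; linarith
  have h3 : 1 - z * conj ζ = - (z * r ^ 2 - ζ) * ζ⁻¹ := by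
    rw [hc]; field_simp; ring
  unfold Kn
  rw [h3, hc, zpow_sub_one₀ h0, zpow_sub₀ h0]
  simp only [zpow_natCast, mul_pow, inv_pow, mul_inv, inv_inv]
  rw [neg_inv.symm]
  field_simp
  ring

lemma mono_pot (j k : ℕ) {z : ℂ} (hz0 : z ≠ 0) (hz : ‖z‖ < 1) :
    ∫ ζ in Metric.ball (0:ℂ) 1, (ζ ^ j * (conj ζ) ^ k) * Kn z ζ =
      π * (z ^ j * (conj z) ^ (k + 1) / (k + 1) -
        if k < j then z ^ (j - k - 1) * (1 / (k + 1) - 1 / (j + 1)) else 0) := by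
  have hc : Continuous (fun ζ : ℂ => ζ ^ j * (conj ζ) ^ k) := by
    have := Complex.continuous_conj
    fun_prop
  have hzp : 0 < ‖z‖ := norm_pos_iff.2 hz0
  rw [polar_disk (g := fun ζ => (ζ ^ j * (conj ζ) ^ k) * Kn z ζ) (hc.measurable.mul (Kn_meas z)) (pot_integrable hc hz.le)]
  have hne : ∀ᵐ r : ℝ ∂(volume.restrict (Ioo (0:ℝ) 1)), ‖z‖ ≠ r := by
    apply ae_restrict_of_ae
    have : ∀ᵐ r : ℝ, r ≠ ‖z‖ := by simp [ae_iff]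
    filter_upwards [this] with r h using h.symm
  have hmem : ∀ᵐ r : ℝ ∂(volume.restrict (Ioo (0:ℝ) 1)), r ∈ Ioo (0:ℝ) 1 :=
    ae_restrict_mem measurableSet_Ioo
  have hii : ∀ (a b : ℝ) (n : ℕ) (c : ℂ), a ≤ b →
      ∫ r in Ioo a b, c * (r:ℂ) ^ n = c * ((b:ℂ) ^ (n+1) - (a:ℂ) ^ (n+1)) / (n + 1) := by
    intro a b n c hab
    rw [integral_const_mul, ← integral_Ioc_eq_integral_Ioo, ← intervalIntegral.integral_of_le hab]
    have := integral_pow (a := a) (b := b) n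
    have h2 : ∫ r in a..b, (r:ℂ) ^ n = ((∫ r in a..b, r ^ n : ℝ) : ℂ) := by
      rw [← intervalIntegral.integral_ofReal]; simp
    rw [h2, this]; push_cast; ring
  have hIint : ∀ (a b : ℝ) (n : ℕ) (c : ℂ), IntegrableOn (fun r : ℝ => c * (r:ℂ) ^ n) (Ioo a b) := by
    intro a b n c
    have : Continuous (fun r : ℝ => c * (r:ℂ) ^ n) := by fun_prop
    exact (this.integrableOn_Icc).mono_set Ioo_subset_Icc_self
  have hzz : (‖z‖ : ℂ) ^ 2 = z * conj z := by
    rw [Complex.mul_conj, Complex.normSq_eq_norm_sq]; simp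
  have hk1 : (k:ℂ) + 1 ≠ 0 := by exact_mod_cast Nat.succ_ne_zero k
  have hj1 : (j:ℂ) + 1 ≠ 0 := by exact_mod_cast Nat.succ_ne_zero j
  by_cases hkj : k < j
  · rw [if_pos hkj]
    obtain ⟨n, rfl⟩ := Nat.exists_eq_add_of_lt hkj
    have hn : ((k + n + 1 : ℕ):ℤ) - k - 1 = n := by push_cast; ring
    have e : ∀ᵐ r : ℝ ∂(volume.restrict (Ioo (0:ℝ) 1)), 
        (r:ℂ) * ∫ θ in (0:ℝ)..(2 * π), (circleMap 0 r θ) ^ (k + n + 1) * (conj (circleMap 0 r θ)) ^ k * Kn z (circleMap 0 r θ)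
        = (Ioo ‖z‖ 1).indicator (fun r : ℝ => (-(2 * π) * z ^ n : ℂ) * (r:ℂ) ^ (2 * k + 1)) r 
          + (2 * π * z ^ n : ℂ) * (r:ℂ) ^ (2 * (k + n + 1) + 1) := by
      filter_upwards [hne, hmem] with r hr1 hr2
      have hr0 : (r:ℂ) ≠ 0 := by exact_mod_cast hr2.1.ne'
      have hw : ‖z * (r:ℂ) ^ 2‖ < r := by
        rw [norm_mul, norm_pow, Complex.norm_real, Real.norm_of_nonneg hr2.1.le]
        nlinarith [norm_nonneg z, mul_pos hr2.1 hr2.1, hr2.1, hr2.2]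
      rw [theta_int _ _ hr2.1 hr2.2 hz hr1, hn, Jc_in (mul_ne_zero hz0 (pow_ne_zero _ hr0)) hw]
      simp only [Int.natCast_nonneg, if_true, zpow_natCast]
      have hI : Complex.I⁻¹ * Complex.I = 1 := inv_mul_cancel₀ Complex.I_ne_zero
      by_cases h : ‖z‖ < r
      · rw [Jc_in hz0 h, indicator_of_mem (show r ∈ Ioo ‖z‖ 1 from ⟨h, hr2.2⟩)]
        simp only [Int.natCast_nonneg, if_true, zpow_natCast]
        linear_combination (2 * π * z ^ n * (r:ℂ) ^ (2 * (k + n + 1) + 1) - 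
          2 * π * z ^ n * (r:ℂ) ^ (2 * k + 1)) * hI
      · rw [Jc_out hr2.1 (lt_of_le_of_ne (not_lt.1 h) hr1.symm), indicator_of_notMem (by simp [h])]
        simp only [Int.natCast_nonneg, if_true]
        linear_combination (2 * π * z ^ n * (r:ℂ) ^ (2 * (k + n + 1) + 1)) * hI
    rw [integral_congr_ae e, integral_add]
    · rw [setIntegral_indicator measurableSet_Ioo, hii _ _ _ _ zero_le_one]
      rw [show Ioo (0:ℝ) 1 ∩ Ioo ‖z‖ 1 = Ioo ‖z‖ 1 by
        ext r; simp only [mem_inter_iff, mem_Ioo]; constructor <;> rintro h <;> grind]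
      rw [hii _ _ _ _ hz.le]
      have : k + n + 1 - k - 1 = n := by omega
      rw [this]
      have e3 : (‖z‖:ℂ) ^ (2 * k + 1 + 1) = (z * conj z) ^ (k + 1) := by
        rw [show 2 * k + 1 + 1 = 2 * (k + 1) by ring, pow_mul, hzz]
      rw [e3]
      push_cast
      push_cast at hj1
      have h2 : (2 * (k:ℂ) + 1 + 1) ≠ 0 := by
        have : (2 * (k:ℂ) + 1 + 1) = 2 * (k + 1) := by ring
        rw [this]; exact mul_ne_zero two_ne_zero hk1
      have h3 : (2 * ((k:ℂ) + n + 1) + 1 + 1) ≠ 0 := by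
        have : (2 * ((k:ℂ) + n + 1) + 1 + 1) = 2 * (k + n + 1 + 1) := by ring
        rw [this]; exact mul_ne_zero two_ne_zero hj1
      rw [show (2 * (k:ℂ) + 1 + 1) = 2 * (k + 1) by ring,
        show (2 * ((k:ℂ) + n + 1) + 1 + 1) = 2 * (k + n + 1 + 1) by ring]
      simp only [one_pow, zero_pow (Nat.succ_ne_zero _), Complex.ofReal_one, Complex.ofReal_zero]
      field_simp
      ring
    · apply Integrable.integrableOn
      exact (hIint _ _ _ _).integrable_indicator measurableSet_Ioo
    · exact hIint _ _ _ _
  · rw [if_neg hkj]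
    have hn : ¬ (0 ≤ (j:ℤ) - k - 1) := by omega
    have e : ∀ᵐ r : ℝ ∂(volume.restrict (Ioo (0:ℝ) 1)), 
        (r:ℂ) * ∫ θ in (0:ℝ)..(2 * π), (circleMap 0 r θ) ^ j * (conj (circleMap 0 r θ)) ^ k * Kn z (circleMap 0 r θ)
        = (Ioo 0 ‖z‖).indicator (fun r : ℝ => ((2 * π) * z ^ ((j:ℤ) - k - 1) : ℂ) * (r:ℂ) ^ (2 * k + 1)) r := by
      filter_upwards [hne, hmem] with r hr1 hr2
      have hr0 : (r:ℂ) ≠ 0 := by exact_mod_cast hr2.1.ne'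
      have hw : ‖z * (r:ℂ) ^ 2‖ < r := by
        rw [norm_mul, norm_pow, Complex.norm_real, Real.norm_of_nonneg hr2.1.le]
        nlinarith [norm_nonneg z, mul_pos hr2.1 hr2.1, hr2.1, hr2.2]
      rw [theta_int _ _ hr2.1 hr2.2 hz hr1, Jc_in (mul_ne_zero hz0 (pow_ne_zero _ hr0)) hw, if_neg hn]
      have hI : Complex.I⁻¹ * Complex.I = 1 := inv_mul_cancel₀ Complex.I_ne_zero
      by_cases h : ‖z‖ < r
      · rw [Jc_in hz0 h, indicator_of_notMem (by simp; intro _; linarith), if_neg hn]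
        simp
      · have h' := lt_of_le_of_ne (not_lt.1 h) hr1.symm
        rw [Jc_out hr2.1 h', indicator_of_mem (show r ∈ Ioo 0 ‖z‖ from ⟨hr2.1, h'⟩), if_neg hn]
        linear_combination (2 * π * z ^ ((j:ℤ) - k - 1) * (r:ℂ) ^ (2 * k + 1)) * hI
    rw [integral_congr_ae e, setIntegral_indicator measurableSet_Ioo]
    rw [show Ioo (0:ℝ) 1 ∩ Ioo 0 ‖z‖ = Ioo 0 ‖z‖ by
        ext r; simp only [mem_inter_iff, mem_Ioo]; constructor <;> rintro h <;> grind]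
    rw [hii _ _ _ _ hzp.le]
    have e3 : (‖z‖:ℂ) ^ (2 * k + 1 + 1) = (z * conj z) ^ (k + 1) := by
        rw [show 2 * k + 1 + 1 = 2 * (k + 1) by ring, pow_mul, hzz]
    rw [e3, zpow_sub_one₀ hz0, zpow_sub₀ hz0]
    push_cast
    rw [show (2 * (k:ℂ) + 1 + 1) = 2 * (k + 1) by ring]
    simp only [zpow_natCast, Complex.ofReal_zero, zero_pow (Nat.succ_ne_zero _), mul_pow]
    field_simp
    ring
end

open MeasureTheory Real Set Filter
open scoped ENNReal NNReal ComplexConjugate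
noncomputable section

abbrev P2 := MvPolynomial (Fin 2) ℂ
abbrev pX : P2 := MvPolynomial.X 0
abbrev pY : P2 := MvPolynomial.X 1
abbrev pd0 (P : P2) : P2 := MvPolynomial.pderiv 0 P
abbrev pd1 (P : P2) : P2 := MvPolynomial.pderiv 1 P

def ev (P : P2) (z : ℂ) : ℂ := MvPolynomial.eval ![z, conj z] P

@[simp] lemma ev_add (P Q : P2) (z : ℂ) : ev (P + Q) z = ev P z + ev Q z := by simp [ev]
@[simp] lemma ev_sub (P Q : P2) (z : ℂ) : ev (P - Q) z = ev P z - ev Q z := by simp [ev]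
@[simp] lemma ev_mul (P Q : P2) (z : ℂ) : ev (P * Q) z = ev P z * ev Q z := by simp [ev]
@[simp] lemma ev_neg (P : P2) (z : ℂ) : ev (-P) z = - ev P z := by simp [ev]
@[simp] lemma ev_pow (P : P2) (n : ℕ) (z : ℂ) : ev (P ^ n) z = ev P z ^ n := by simp [ev]
@[simp] lemma ev_C (c : ℂ) (z : ℂ) : ev (MvPolynomial.C c) z = c := by simp [ev]
@[simp] lemma ev_one (z : ℂ) : ev 1 z = 1 := by simp [ev]
@[simp] lemma ev_zero (z : ℂ) : ev 0 z = 0 := by simp [ev]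
@[simp] lemma ev_natCast (n : ℕ) (z : ℂ) : ev (n : P2) z = n := by simp [ev]
@[simp] lemma ev_ofNat (n : ℕ) [n.AtLeastTwo] (z : ℂ) : ev (OfNat.ofNat n : P2) z = OfNat.ofNat n := by simp [ev]
@[simp] lemma ev_X (z : ℂ) : ev pX z = z := by simp [ev]
@[simp] lemma ev_Y (z : ℂ) : ev pY z = conj z := by simp [ev]

def wcl (p q : ℂ) : ℂ →L[ℝ] ℂ :=
  p • (ContinuousLinearMap.id ℝ ℂ) + q • (Complex.conjCLE : ℂ →L[ℝ] ℂ)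

@[simp] lemma wcl_apply (p q v : ℂ) : wcl p q v = p * v + q * conj v := by simp [wcl]

lemma pd_comm (P : P2) : pd1 (pd0 P) = pd0 (pd1 P) := by
  have : ⁅(MvPolynomial.pderiv 1 : Derivation ℂ P2 P2), (MvPolynomial.pderiv 0 : Derivation ℂ P2 P2)⁆ = 0 := by
    apply MvPolynomial.derivation_ext
    intro i
    fin_cases i <;> simp [Derivation.commutator_apply, MvPolynomial.pderiv_X]
  have h2 := congrArg (fun D => D P) this
  simpa [Derivation.commutator_apply, sub_eq_zero] using h2

@[simp] lemma pd0_X : pd0 pX = 1 := by simp [pd0]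
@[simp] lemma pd1_X : pd1 pX = 0 := by simp [pd1, MvPolynomial.pderiv_X]
@[simp] lemma pd0_Y : pd0 pY = 0 := by simp [pd0, MvPolynomial.pderiv_X]
@[simp] lemma pd1_Y : pd1 pY = 1 := by simp [pd1]

lemma ev_hasFDerivAt (P : P2) (z : ℂ) :
    HasFDerivAt (𝕜 := ℝ) (ev P) (wcl (ev (pd0 P) z) (ev (pd1 P) z)) z := by
  induction P using MvPolynomial.induction_on with
  | C c =>
    have : ev (MvPolynomial.C c) = fun _ => c := by ext z; simp
    rw [this]
    convert hasFDerivAt_const c z using 1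
    ext <;> simp [pd0, pd1]
  | add p q hp hq =>
    have : ev (p + q) = fun z => ev p z + ev q z := by ext z; simp
    rw [this]
    refine (hp.add hq).congr_fderiv ?_
    ext <;> simp [pd0, pd1] <;> ring
  | mul_X p i hp =>
    fin_cases i
    · have : ev (p * MvPolynomial.X 0) = fun z => ev p z * z := by ext z; simp
      show HasFDerivAt (𝕜 := ℝ) (ev (p * MvPolynomial.X 0)) _ z
      rw [this]
      refine (hp.mul (hasFDerivAt_id z)).congr_fderiv ?_
      ext <;> simp [pd0, pd1, MvPolynomial.pderiv_X] <;> ring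
    · have : ev (p * MvPolynomial.X 1) = fun z => ev p z * conj z := by ext z; simp
      show HasFDerivAt (𝕜 := ℝ) (ev (p * MvPolynomial.X 1)) _ z
      rw [this]
      refine (hp.mul (Complex.conjCLE.hasFDerivAt)).congr_fderiv ?_
      ext <;> simp [pd0, pd1, MvPolynomial.pderiv_X] <;> ring

lemma ev_continuous (P : P2) : Continuous (ev P) :=
  continuous_iff_continuousAt.2 fun z => (ev_hasFDerivAt P z).continuousAt

/-- conjugate-swap -/
def pst (P : P2) : P2 := MvPolynomial.rename (Equiv.swap 0 1) (MvPolynomial.map (starRingEnd ℂ) P)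

lemma ev_pst (P : P2) (z : ℂ) : ev (pst P) z = conj (ev P z) := by
  unfold ev pst
  rw [MvPolynomial.eval_rename, MvPolynomial.eval_map]
  have : (![z, conj z] ∘ (Equiv.swap 0 1 : Fin 2 → Fin 2)) = fun i => conj (![z, conj z] i) := by
    ext i; fin_cases i <;> simp
  rw [this]
  show _ = (starRingEnd ℂ) (MvPolynomial.eval₂ (RingHom.id ℂ) _ P)
  rw [MvPolynomial.eval₂_comp_left]
  rfl

lemma pd0_pst (P : P2) : pd0 (pst P) = pst (pd1 P) := by
  unfold pd0 pd1 pst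
  have := MvPolynomial.pderiv_rename (R := ℂ) (Equiv.swap (0: Fin 2) 1).injective 1 (MvPolynomial.map (starRingEnd ℂ) P)
  rw [Equiv.swap_apply_right] at this
  rw [this, MvPolynomial.pderiv_map]

lemma pd1_pst (P : P2) : pd1 (pst P) = pst (pd0 P) := by
  unfold pd0 pd1 pst
  have := MvPolynomial.pderiv_rename (R := ℂ) (Equiv.swap (0: Fin 2) 1).injective 0 (MvPolynomial.map (starRingEnd ℂ) P)
  rw [Equiv.swap_apply_left] at this
  rw [this, MvPolynomial.pderiv_map]

/-- multiples of `1 - XY` -/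
def Idl (U : P2) : Prop := ∃ Q : P2, U = (1 - pX * pY) * Q

lemma Idl_pst {U : P2} (h : Idl U) : Idl (pst U) := by
  obtain ⟨Q, rfl⟩ := h
  refine ⟨pst Q, ?_⟩
  unfold pst
  simp
  left; ring

lemma Idl_bd {U : P2} (h : Idl U) {z : ℂ} (hz : ‖z‖ = 1) : ev U z = 0 := by
  obtain ⟨Q, rfl⟩ := h
  simp [Complex.mul_conj, Complex.normSq_eq_norm_sq, hz]

lemma monom_eq (s : Fin 2 →₀ ℕ) (c : ℂ) : 
    (MvPolynomial.monomial s c : P2) = MvPolynomial.C c * (pX ^ (s 0) * pY ^ (s 1)) := by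
  rw [MvPolynomial.monomial_eq, Finsupp.prod_fintype _ _ (by simp)]
  simp

lemma pd01_mono (j k : ℕ) : pd0 (pd1 ((1 - pX * pY) * (pX ^ j * pY ^ k))) = 
   (j * k : P2) * (pX ^ (j-1) * pY ^ (k-1)) - ((j + 1) * (k + 1) : P2) * (pX ^ j * pY ^ k) := by
  rcases j with _ | j <;> rcases k with _ | k <;>
   simp [pd0, pd1, MvPolynomial.pderiv_mul, MvPolynomial.pderiv_pow, MvPolynomial.pderiv_X] <;> ring

lemma pd0_mono (j k : ℕ) : pd0 (((1 - pX * pY) * (pX ^ j * pY ^ k))) = 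
   (j : P2) * (pX ^ (j-1) * pY ^ k) - ((j + 1) : P2) * (pX ^ j * pY ^ (k+1)) := by
  rcases j with _ | j  <;>
   simp [pd0, pd1, MvPolynomial.pderiv_mul, MvPolynomial.pderiv_pow, MvPolynomial.pderiv_X] <;> ring

lemma solve_poly (F : P2) : ∃ U, Idl U ∧ pd0 (pd1 U) = F := by
  have hm : ∀ j k : ℕ, ∀ c : ℂ, ∃ U, Idl U ∧ pd0 (pd1 U) = MvPolynomial.C c * (pX ^ j * pY ^ k) := by
    intro j
    induction j using Nat.strong_induction_on with
    | _ j ih =>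
    intro k c
    have hj1 : (j:ℂ) + 1 ≠ 0 := by exact_mod_cast Nat.succ_ne_zero j
    have hk1 : (k:ℂ) + 1 ≠ 0 := by exact_mod_cast Nat.succ_ne_zero k
    set d : ℂ := -c / ((j+1) * (k+1))
    have key : ∃ V, Idl V ∧ pd0 (pd1 V) = MvPolynomial.C (d * j * k) * (pX ^ (j-1) * pY ^ (k-1)) := by
      rcases j with _ | j
      · exact ⟨0, ⟨0, by simp⟩, by simp [pd0, pd1]⟩
      · exact ih j (by omega) (k-1) _
    obtain ⟨V, ⟨Q, hQ⟩, hV⟩ := key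
    refine ⟨MvPolynomial.C d * ((1 - pX * pY) * (pX ^ j * pY ^ k)) - V, ?_, ?_⟩
    · exact ⟨MvPolynomial.C d * (pX ^ j * pY ^ k) - Q, by rw [hQ]; ring⟩
    · have : pd0 (pd1 (MvPolynomial.C d * ((1 - pX * pY) * (pX ^ j * pY ^ k)) - V)) = 
        MvPolynomial.C d * pd0 (pd1 ((1 - pX * pY) * (pX ^ j * pY ^ k))) - pd0 (pd1 V) := by
        simp only [pd0, pd1, map_sub, MvPolynomial.pderiv_C_mul]
      rw [this, hV, pd01_mono]
      have e : (MvPolynomial.C c : P2) = - ((MvPolynomial.C d : P2) * (((j:P2) + 1) * ((k:P2) + 1))) := by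
        have : c = -(d * ((j+1) * (k+1))) := by simp only [d]; field_simp
        rw [this]; simp
      rw [e]
      simp only [map_mul, map_natCast]
      ring
  induction F using MvPolynomial.induction_on' with
  | monomial s c => rw [monom_eq]; exact hm _ _ _
  | add p q hp hq =>
    obtain ⟨U, ⟨Q, rfl⟩, h⟩ := hp
    obtain ⟨U', ⟨Q', rfl⟩, h'⟩ := hq
    refine ⟨_, ⟨Q + Q', rfl⟩, ?_⟩
    rw [← h, ← h', mul_add]; simp only [pd0, pd1, map_add]

lemma rep0 {U : P2} (hU : Idl U) {z : ℂ} (hz0 : z ≠ 0) (hz : ‖z‖ < 1) :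
    ∫ ζ in Metric.ball (0:ℂ) 1, ev (pd0 (pd1 U)) ζ * Kn z ζ = π * ev (pd0 U) z := by
  obtain ⟨Q, rfl⟩ := hU
  induction Q using MvPolynomial.induction_on' with
  | monomial s c =>
    rw [monom_eq]
    generalize s 0 = j
    generalize s 1 = k
    have e1 : pd0 (pd1 ((1 - pX * pY) * (MvPolynomial.C c * (pX ^ j * pY ^ k)))) = 
      MvPolynomial.C c * ((j * k : P2) * (pX ^ (j-1) * pY ^ (k-1)) - ((j + 1) * (k + 1) : P2) * (pX ^ j * pY ^ k)) := by
      rw [← pd01_mono, mul_left_comm]; simp only [pd0, pd1, MvPolynomial.pderiv_C_mul]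
    have e2 : pd0 (((1 - pX * pY) * (MvPolynomial.C c * (pX ^ j * pY ^ k)))) = 
      MvPolynomial.C c * ((j : P2) * (pX ^ (j-1) * pY ^ k) - ((j + 1) : P2) * (pX ^ j * pY ^ (k+1))) := by
      rw [← pd0_mono, mul_left_comm]; simp only [pd0, MvPolynomial.pderiv_C_mul]
    rw [e1, e2]
    have e3 : ∀ ζ : ℂ, ev (MvPolynomial.C c * ((j * k : P2) * (pX ^ (j-1) * pY ^ (k-1)) - ((j + 1) * (k + 1) : P2) * (pX ^ j * pY ^ k))) ζ * Kn z ζ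
       = (c * (j * k)) * ((ζ ^ (j-1) * (conj ζ) ^ (k-1)) * Kn z ζ) - (c * ((j+1) * (k+1))) * ((ζ ^ j * (conj ζ) ^ k) * Kn z ζ) := by
      intro ζ; simp; ring
    simp_rw [e3]
    have hc : ∀ j k : ℕ, Continuous (fun ζ : ℂ => ζ ^ j * (conj ζ) ^ k) := by
      intro j k
      have := Complex.continuous_conj
      fun_prop
    rw [integral_sub ((pot_integrable (hc _ _) hz.le).const_mul _) ((pot_integrable (hc _ _) hz.le).const_mul _),
      integral_const_mul, integral_const_mul, mono_pot _ _ hz0 hz, mono_pot _ _ hz0 hz]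
    have hj1 : (j:ℂ) + 1 ≠ 0 := by exact_mod_cast Nat.succ_ne_zero j
    have hk1 : (k:ℂ) + 1 ≠ 0 := by exact_mod_cast Nat.succ_ne_zero k
    rcases j with _ | j
    · simp; field_simp
    rcases k with _ | k
    · simp; push_cast at hj1; field_simp; ring
    · simp only [Nat.add_sub_cancel, Nat.add_lt_add_iff_right]
      push_cast at hj1 hk1 ⊢
      have hj0 : (j:ℂ) + 1 ≠ 0 := by exact_mod_cast Nat.succ_ne_zero j
      have hk0 : (k:ℂ) + 1 ≠ 0 := by exact_mod_cast Nat.succ_ne_zero k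
      split_ifs with h
      · simp; field_simp; ring
      · simp; field_simp
  | add p q hp hq =>
    have e1 : ∀ ζ, ev (pd0 (pd1 ((1 - pX * pY) * (p + q)))) ζ * Kn z ζ = 
      ev (pd0 (pd1 ((1 - pX * pY) * p))) ζ * Kn z ζ + ev (pd0 (pd1 ((1 - pX * pY) * q))) ζ * Kn z ζ := by
      intro ζ; rw [← add_mul, ← ev_add, mul_add]; simp only [pd0, pd1, map_add]
    simp_rw [e1]
    rw [integral_add (pot_integrable (ev_continuous _) hz.le) (pot_integrable (ev_continuous _) hz.le), hp, hq,
     ← mul_add, ← ev_add, mul_add]; simp only [pd0, map_add]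
end

open MeasureTheory Real Set Filter
open scoped ENNReal NNReal ComplexConjugate
noncomputable section

lemma ev_two (z : ℂ) : ev (2 : P2) z = 2 := by
  rw [show (2:P2) = 1 + 1 by norm_num]; simp; norm_num

lemma pderiv_two (i : Fin 2) : MvPolynomial.pderiv i (2 : P2) = 0 := by
  rw [show (2:P2) = 1 + 1 by norm_num]; simp

def HB (β K : ℝ) (g : ℂ → ℂ) : Prop :=
  (∀ z, ‖z‖ ≤ 1 → ‖g z‖ ≤ K) ∧ ∀ z z', ‖z‖ ≤ 1 → ‖z'‖ ≤ 1 → ‖g z - g z'‖ ≤ K * ‖z - z'‖ ^ β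

lemma HB.nonneg {β K : ℝ} {g : ℂ → ℂ} (h : HB β K g) : 0 ≤ K :=
  (norm_nonneg _).trans (h.1 0 (by simp))

lemma HB.mono {β K K' : ℝ} {g : ℂ → ℂ} (h : HB β K g) (hK : K ≤ K') : HB β K' g :=
  ⟨fun z hz => (h.1 z hz).trans hK, fun z z' hz hz' => (h.2 z z' hz hz').trans (by gcongr)⟩

lemma HB.add {β K K' : ℝ} {f g : ℂ → ℂ} (h : HB β K f) (h' : HB β K' g) :
    HB β (K + K') (fun z => f z + g z) := by
  refine ⟨fun z hz => (norm_add_le _ _).trans (add_le_add (h.1 z hz) (h'.1 z hz)), ?_⟩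
  intro z z' hz hz'
  rw [show f z + g z - (f z' + g z') = (f z - f z') + (g z - g z') by ring, add_mul]
  exact (norm_add_le _ _).trans (add_le_add (h.2 z z' hz hz') (h'.2 z z' hz hz'))

lemma HB.mul {β K K' : ℝ} {f g : ℂ → ℂ} (h : HB β K f) (h' : HB β K' g) :
    HB β (2 * K * K') (fun z => f z * g z) := by
  have hK := h.nonneg
  have hK' := h'.nonneg
  refine ⟨fun z hz => ?_, ?_⟩
  · rw [norm_mul]
    calc _ ≤ K * K' := mul_le_mul (h.1 z hz) (h'.1 z hz) (norm_nonneg _) hK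
      _ ≤ _ := by nlinarith [mul_nonneg hK hK']
  intro z z' hz hz'
  rw [show f z * g z - (f z' * g z') = f z * (g z - g z') + (f z - f z') * g z' by ring]
  refine (norm_add_le _ _).trans ?_
  rw [norm_mul, norm_mul]
  have h1 := mul_le_mul (h.1 z hz) (h'.2 z z' hz hz') (norm_nonneg _) hK
  have h2 := mul_le_mul (h.2 z z' hz hz') (h'.1 z' hz') (norm_nonneg _) (by positivity)
  calc _ ≤ _ := add_le_add h1 h2
    _ = _ := by ring

lemma HB.conj_iff {β K : ℝ} {g : ℂ → ℂ} (h : HB β K (fun z => conj (g z))) : HB β K g := by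
  refine ⟨fun z hz => by simpa using h.1 z hz, fun z z' hz hz' => ?_⟩
  have := h.2 z z' hz hz'
  rwa [← map_sub, Complex.norm_conj] at this

lemma pow_beta {β t : ℝ} (hβ0 : 0 < β) (hβ1 : β < 1) (h0 : 0 ≤ t) (h2 : t ≤ 2) : t ≤ 2 * t ^ β := by
  rcases h0.eq_or_lt with h | h
  · rw [← h]; positivity
  have e : t = t ^ (1 - β) * t ^ β := by rw [← rpow_add h]; simp
  have : t ^ (1 - β) ≤ 2 := by
    calc t ^ (1 - β) ≤ 2 ^ (1 - β) := rpow_le_rpow h0 h2 (by linarith)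
      _ ≤ 2 ^ (1:ℝ) := rpow_le_rpow_of_exponent_le (by norm_num) (by linarith)
      _ = 2 := by simp
  calc t = t ^ (1 - β) * t ^ β := e
    _ ≤ _ := by gcongr

lemma HB_of_lip {β L M : ℝ} (hβ0 : 0 < β) (hβ1 : β < 1) {g : ℂ → ℂ} (h1 : ∀ z, ‖z‖ ≤ 1 → ‖g z‖ ≤ M)
    (hL : 0 ≤ L) (h2 : ∀ z z', ‖z‖ ≤ 1 → ‖z'‖ ≤ 1 → ‖g z - g z'‖ ≤ L * ‖z - z'‖) :
    HB β (M + 2 * L) g := by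
  have hM : 0 ≤ M := (norm_nonneg _).trans (h1 0 (by simp))
  refine ⟨fun z hz => (h1 z hz).trans (by linarith), fun z z' hz hz' => ?_⟩
  have h3 : ‖z - z'‖ ≤ 2 := (norm_sub_le _ _).trans (by linarith)
  have h4 := pow_beta hβ0 hβ1 (norm_nonneg (z - z')) h3
  have h5 : 0 ≤ ‖z - z'‖ ^ β := by positivity
  nlinarith [h2 z z' hz hz']

lemma wcl_norm (p q : ℂ) : ‖wcl p q‖ ≤ ‖p‖ + ‖q‖ := by
  apply ContinuousLinearMap.opNorm_le_bound _ (by positivity)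
  intro v
  rw [wcl_apply, add_mul]
  refine (norm_add_le _ _).trans ?_
  simp

lemma ev_lip {P : P2} {M : ℝ} (h0 : ∀ z, ‖z‖ ≤ 1 → ‖ev (pd0 P) z‖ ≤ M)
    (h1 : ∀ z, ‖z‖ ≤ 1 → ‖ev (pd1 P) z‖ ≤ M) (z z' : ℂ) (hz : ‖z‖ ≤ 1) (hz' : ‖z'‖ ≤ 1) :
    ‖ev P z - ev P z'‖ ≤ 2 * M * ‖z - z'‖ := by
  apply (convex_closedBall (0:ℂ) 1).norm_image_sub_le_of_norm_hasFDerivWithin_le (𝕜 := ℝ)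
    (f' := fun z => wcl (ev (pd0 P) z) (ev (pd1 P) z))
  · intro x hx; exact (ev_hasFDerivAt P x).hasFDerivWithinAt
  · intro x hx
    have hx : ‖x‖ ≤ 1 := by simpa using hx
    exact (wcl_norm _ _).trans (by linarith [h0 x hx, h1 x hx])
  · simpa using hz'
  · simpa using hz

lemma HB_of_bounds {β M : ℝ} (hβ0 : 0 < β) (hβ1 : β < 1) {P : P2} (h : ∀ z, ‖z‖ ≤ 1 → ‖ev P z‖ ≤ M)
    (h0 : ∀ z, ‖z‖ ≤ 1 → ‖ev (pd0 P) z‖ ≤ M)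
    (h1 : ∀ z, ‖z‖ ≤ 1 → ‖ev (pd1 P) z‖ ≤ M) : HB β (5 * M) (ev P) := by
  have hM : 0 ≤ M := (norm_nonneg _).trans (h 0 (by simp))
  refine (HB_of_lip hβ0 hβ1 h (L := 2 * M) (by positivity) (ev_lip h0 h1)).mono (by linarith)

lemma ev_bdd (P : P2) : ∃ M, ∀ z, ‖z‖ ≤ 1 → ‖ev P z‖ ≤ M := by
  obtain ⟨M, hM⟩ := (isCompact_closedBall (0:ℂ) 1).exists_bound_of_continuousOn (ev_continuous P).continuousOn
  exact ⟨M, fun z hz => hM z (by simpa using hz)⟩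

lemma HB_poly {β : ℝ} (hβ0 : 0 < β) (hβ1 : β < 1) (P : P2) : ∃ K, HB β K (ev P) := by
  obtain ⟨M, hM⟩ := ev_bdd P
  obtain ⟨M0, hM0⟩ := ev_bdd (pd0 P)
  obtain ⟨M1, hM1⟩ := ev_bdd (pd1 P)
  exact ⟨_, HB_of_bounds hβ0 hβ1 (M := max M (max M0 M1)) (fun z hz => (hM z hz).trans (by simp))
    (fun z hz => (hM0 z hz).trans (by simp)) (fun z hz => (hM1 z hz).trans (by simp))⟩

lemma est1_0 {β : ℝ} (hβ0 : 0 < β) (hβ1 : β < 1) : ∃ C : ℝ, 0 ≤ C ∧ ∀ (U : P2) (M : ℝ), Idl U →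
    (∀ z, ‖z‖ ≤ 1 → ‖ev (pd0 (pd1 U)) z‖ ≤ M) → HB β (C * M) (ev (pd0 U)) := by
  obtain ⟨C, hC, h⟩ := pot_bound β hβ0 hβ1
  refine ⟨C, hC, fun U M hU hM => ?_⟩
  obtain ⟨h1, h2⟩ := h (ev (pd0 (pd1 U))) M (ev_continuous _) hM
  have hM0 : 0 ≤ M := (norm_nonneg _).trans (hM 0 (by simp))
  set I : ℂ → ℂ := fun z => ∫ ζ in Metric.ball (0:ℂ) 1, ev (pd0 (pd1 U)) ζ * Kn z ζ with hI
  have hIc : ContinuousOn I (Metric.closedBall 0 1) := by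
    have : HolderOnWith (C * M).toNNReal β.toNNReal I (Metric.closedBall 0 1) := by
      intro z hz z' hz'
      have := h2 z z' (by simpa using hz) (by simpa using hz')
      rw [edist_dist, edist_dist, dist_eq_norm, dist_eq_norm, ENNReal.ofReal_rpow_of_nonneg (norm_nonneg _) (by simp),
        ← ENNReal.ofReal_coe_nnreal, ← ENNReal.ofReal_mul (by simp)]
      apply ENNReal.ofReal_le_ofReal
      simpa [hβ0.le, mul_nonneg hC hM0] using this
    exact this.continuousOn (by simpa using hβ0)
  have hE : EqOn I (fun z => π * ev (pd0 U) z) (Metric.closedBall 0 1) := by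
    apply Set.EqOn.of_subset_closure (s := Metric.ball 0 1 ∩ {0}ᶜ)
    · rintro z ⟨hz, hz0⟩
      exact rep0 hU hz0 (by simpa using hz)
    · exact hIc
    · exact (continuous_const.mul (ev_continuous _)).continuousOn
    · exact inter_subset_left.trans Metric.ball_subset_closedBall
    · rw [← closure_ball (0:ℂ) one_ne_zero]
      exact closure_minimal ((dense_compl_singleton (0:ℂ)).open_subset_closure_inter Metric.isOpen_ball) isClosed_closure
  have hpi : (1:ℝ) ≤ π := by linarith [pi_gt_three]
  have hE' : ∀ z, ‖z‖ ≤ 1 → I z = π * ev (pd0 U) z := fun z hz => hE (by simpa using hz)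
  constructor
  · intro z hz
    have := h1 z hz
    change ‖I z‖ ≤ _ at this
    rw [hE' z hz, norm_mul, Complex.norm_real, Real.norm_of_nonneg pi_pos.le] at this
    nlinarith [norm_nonneg (ev (pd0 U) z)]
  · intro z z' hz hz'
    have := h2 z z' hz hz'
    change ‖I z - I z'‖ ≤ _ at this
    rw [hE' z hz, hE' z' hz', ← mul_sub, norm_mul, Complex.norm_real, Real.norm_of_nonneg pi_pos.le] at this
    nlinarith [norm_nonneg (ev (pd0 U) z - ev (pd0 U) z')]

lemma L_pst (U : P2) : pd0 (pd1 (pst U)) = pst (pd0 (pd1 U)) := by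
  rw [pd1_pst, pd0_pst, pd_comm]

lemma est1 {β : ℝ} (hβ0 : 0 < β) (hβ1 : β < 1) : ∃ C : ℝ, 0 ≤ C ∧ ∀ (U : P2) (M : ℝ), Idl U →
    (∀ z, ‖z‖ ≤ 1 → ‖ev (pd0 (pd1 U)) z‖ ≤ M) → HB β (C * M) (ev (pd0 U)) ∧ HB β (C * M) (ev (pd1 U)) := by
  obtain ⟨C, hC, h⟩ := est1_0 hβ0 hβ1
  refine ⟨C, hC, fun U M hU hM => ⟨h U M hU hM, ?_⟩⟩
  have := h (pst U) M (Idl_pst hU) (fun z hz => by rw [L_pst, ev_pst, Complex.norm_conj]; exact hM z hz)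
  rw [pd0_pst] at this
  apply HB.conj_iff
  convert this using 2 with z
  rw [ev_pst]

def sS : P2 := pX * pY + (1 - pX ^ 2) * (1 - pY ^ 2)

lemma sS_lower {z : ℂ} (hz : ‖z‖ ≤ 1) : 3 / 4 ≤ ‖ev sS z‖ := by
  have e : ev sS z = ((‖z‖ ^ 2 + ‖1 - z ^ 2‖ ^ 2 : ℝ) : ℂ) := by
    have : ∀ w : ℂ, ((‖w‖ ^ 2 : ℝ) : ℂ) = w * conj w := by
      intro w; rw [Complex.mul_conj, Complex.normSq_eq_norm_sq]
    rw [Complex.ofReal_add, this, this]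
    simp [sS]
  rw [e, Complex.norm_real, Real.norm_of_nonneg (by positivity)]
  have h1 : 1 - ‖z‖ ^ 2 ≤ ‖1 - z ^ 2‖ := by
    have := norm_sub_norm_le (1:ℂ) (z^2)
    simpa using this
  have h2 : 0 ≤ 1 - ‖z‖ ^ 2 := by nlinarith [norm_nonneg z]
  nlinarith [sq_nonneg (‖z‖^2 - 1/2)]

lemma HB_inv_sS {β : ℝ} (hβ0 : 0 < β) (hβ1 : β < 1) : ∃ K, HB β K (fun z => (ev sS z)⁻¹) := by
  obtain ⟨M0, hM0⟩ := ev_bdd (pd0 sS)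
  obtain ⟨M1, hM1⟩ := ev_bdd (pd1 sS)
  have hl := ev_lip (P := sS) (M := max M0 M1) (fun z hz => (hM0 z hz).trans (by simp)) (fun z hz => (hM1 z hz).trans (by simp))
  have hM : 0 ≤ max M0 M1 := ((norm_nonneg _).trans (hM0 0 (by simp))).trans (le_max_left _ _)
  have hb : ∀ z : ℂ, ‖z‖ ≤ 1 → ‖(ev sS z)⁻¹‖ ≤ 4 / 3 := by
    intro z hz
    rw [norm_inv, show (4/3:ℝ) = (3/4)⁻¹ by norm_num]
    exact inv_anti₀ (by norm_num) (sS_lower hz)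
  refine ⟨_, HB_of_lip hβ0 hβ1 (M := 4/3) (L := 16/9 * (2 * max M0 M1)) hb (by positivity) ?_⟩
  intro z z' hz hz'
  have n1 : ev sS z ≠ 0 := by intro h; have := sS_lower hz; rw [h] at this; norm_num at this
  have n2 : ev sS z' ≠ 0 := by intro h; have := sS_lower hz'; rw [h] at this; norm_num at this
  have e : (ev sS z)⁻¹ - (ev sS z')⁻¹ = - ((ev sS z)⁻¹ * (ev sS z')⁻¹ * (ev sS z - ev sS z')) := by
    field_simp; ring
  rw [e, norm_neg, norm_mul, norm_mul]
  calc _ ≤ (4/3 * (4/3)) * (2 * max M0 M1 * ‖z - z'‖) := by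
        gcongr
        · exact hb z hz
        · exact hb z' hz'
        · exact hl z z' hz hz'
    _ = _ := by ring

lemma est2_0 {β : ℝ} (hβ0 : 0 < β) (hβ1 : β < 1) : ∃ C : ℝ, 0 ≤ C ∧ ∀ (U : P2) (M : ℝ), Idl U →
    (∀ z, ‖z‖ ≤ 1 → ‖ev (pd0 (pd1 U)) z‖ ≤ M) → 
    (∀ z, ‖z‖ ≤ 1 → ‖ev (pd0 (pd0 (pd1 U))) z‖ ≤ M) → 
    (∀ z, ‖z‖ ≤ 1 → ‖ev (pd1 (pd0 (pd1 U))) z‖ ≤ M) → 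
    HB β (C * M) (ev (pd0 (pd0 U))) := by
  obtain ⟨C, hC, h⟩ := est1 hβ0 hβ1
  obtain ⟨K0, hK0⟩ := HB_inv_sS hβ0 hβ1
  have cI : ∃ K, 0 ≤ K ∧ ∀ P ∈ ({-(MvPolynomial.C Complex.I * pY), -(MvPolynomial.C Complex.I), MvPolynomial.C Complex.I * pY, (1 - pY ^ 2), 2 * pX, -(1 - pY ^ 2)} : Finset P2), HB β K (ev P) := by
    choose K hK using fun P => HB_poly hβ0 hβ1 P
    set S := ({-(MvPolynomial.C Complex.I * pY), -(MvPolynomial.C Complex.I), MvPolynomial.C Complex.I * pY, (1 - pY ^ 2), 2 * pX, -(1 - pY ^ 2)} : Finset P2)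
    refine ⟨∑ P ∈ S, K P, Finset.sum_nonneg fun P _ => (hK P).nonneg, fun P hP => (hK P).mono ?_⟩
    exact Finset.single_le_sum (fun P _ => (hK P).nonneg) hP
  obtain ⟨K, hKn, hK⟩ := cI
  have hK0n := hK0.nonneg
  refine ⟨2 * K0 * (2 * K * (C * 2 + 2 * K * C + 2 * K * 5) + 2 * K * (C * 8 + 2 * K * C + 2 * K * 5)), by positivity, fun U M hU hM hM0 hM1 => ?_⟩
  set W1 : P2 := MvPolynomial.C Complex.I * (pX * pd0 U - pY * pd1 U) with hW1
  set W2 : P2 := (1 - pX ^ 2) * pd0 U + (1 - pY ^ 2) * pd1 U with hW2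
  have hMn : 0 ≤ M := (norm_nonneg _).trans (hM 0 (by simp))
  have iW1 : Idl W1 := by
    obtain ⟨Q, rfl⟩ := hU
    refine ⟨MvPolynomial.C Complex.I * (pX * pd0 Q - pY * pd1 Q), ?_⟩
    simp [hW1, pd0, pd1, MvPolynomial.pderiv_mul, MvPolynomial.pderiv_X]; ring
  have iW2 : Idl W2 := by
    obtain ⟨Q, rfl⟩ := hU
    refine ⟨-(pX + pY) * Q + (1 - pX ^ 2) * pd0 Q + (1 - pY ^ 2) * pd1 Q, ?_⟩
    simp [hW2, pd0, pd1, MvPolynomial.pderiv_mul, MvPolynomial.pderiv_X]; ring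
  have c1 : pd1 (pd0 U) = pd0 (pd1 U) := pd_comm U
  have c2 : pd0 (pd1 (pd1 U)) = pd1 (pd0 (pd1 U)) := by rw [← pd_comm]
  have LW1 : pd0 (pd1 W1) = MvPolynomial.C Complex.I * (pX * pd0 (pd0 (pd1 U)) - pY * pd1 (pd0 (pd1 U))) := by
    rw [← c2, hW1]
    simp only [pd0, pd1] at c1 ⊢
    simp [MvPolynomial.pderiv_mul, MvPolynomial.pderiv_X, c1]
  have LW2 : pd0 (pd1 W2) = -2 * (pX + pY) * pd0 (pd1 U) + ((1 - pX ^ 2) * pd0 (pd0 (pd1 U)) + (1 - pY ^ 2) * pd1 (pd0 (pd1 U))) := by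
    rw [← c2, hW2]
    simp only [pd0, pd1] at c1 ⊢
    simp [MvPolynomial.pderiv_mul, MvPolynomial.pderiv_X, c1, MvPolynomial.pderiv_pow, pderiv_two]; ring
  have n1z : ∀ w : ℂ, ‖w‖ ≤ 1 → ‖1 - w ^ 2‖ ≤ 2 := by
    intro w hw
    refine (norm_sub_le _ _).trans ?_
    rw [norm_one, norm_pow]; nlinarith [norm_nonneg w]
  have b1 := (h W1 (2 * M) iW1 (by
    intro z hz
    rw [LW1]
    simp only [ev_mul, ev_sub, ev_C, ev_X, ev_Y, norm_mul, Complex.norm_I, one_mul]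
    refine (norm_sub_le _ _).trans ?_
    rw [norm_mul, norm_mul, Complex.norm_conj]
    nlinarith [hM0 z hz, hM1 z hz, norm_nonneg z, norm_nonneg (ev (pd0 (pd0 (pd1 U))) z), norm_nonneg (ev (pd1 (pd0 (pd1 U))) z)])).1
  have b2 := (h W2 (8 * M) iW2 (by
    intro z hz
    have hz' : ‖conj z‖ ≤ 1 := by simpa using hz
    rw [LW2]
    simp only [ev_mul, ev_add, ev_sub, ev_C, ev_X, ev_Y, ev_one, ev_pow, ev_neg, ev_two]
    refine (norm_add_le _ _).trans ?_
    refine (add_le_add_right (norm_add_le _ _) _).trans ?_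
    rw [norm_mul, norm_mul, norm_mul, norm_mul]
    have i1 : ‖(-2:ℂ)‖ * ‖z + conj z‖ ≤ 4 := by
      have : ‖z + conj z‖ ≤ 2 := (norm_add_le _ _).trans (by linarith)
      simp; linarith
    have j1 := mul_le_mul i1 (hM z hz) (norm_nonneg _) (by norm_num)
    have j2 := mul_le_mul (n1z z hz) (hM0 z hz) (norm_nonneg _) (by norm_num)
    have j3 := mul_le_mul (n1z _ hz') (hM1 z hz) (norm_nonneg _) (by norm_num)
    linarith)).1
  have b3 := (h U M hU hM).1
  have b4 : HB β (5 * M) (ev (pd0 (pd1 U))) := HB_of_bounds hβ0 hβ1 hM hM0 hM1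
  have d1 : pd0 W1 = MvPolynomial.C Complex.I * (pd0 U + pX * pd0 (pd0 U) - pY * pd0 (pd1 U)) := by
    rw [hW1]
    simp only [pd0, pd1]
    simp [MvPolynomial.pderiv_mul, MvPolynomial.pderiv_X]; try ring
  have d2 : pd0 W2 = -2 * pX * pd0 U + (1 - pX ^ 2) * pd0 (pd0 U) + (1 - pY ^ 2) * pd0 (pd1 U) := by
    rw [hW2]
    simp only [pd0, pd1]
    simp [MvPolynomial.pderiv_mul, MvPolynomial.pderiv_X, MvPolynomial.pderiv_pow]; try ring
  have hI2 : (MvPolynomial.C Complex.I : P2) * MvPolynomial.C Complex.I = -1 := by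
    rw [← map_mul, Complex.I_mul_I]; simp
  have key : sS * pd0 (pd0 U) = 
    -(MvPolynomial.C Complex.I * pY) * (pd0 W1 + (-(MvPolynomial.C Complex.I)) * pd0 U + (MvPolynomial.C Complex.I * pY) * pd0 (pd1 U))
     + (1 - pY ^ 2) * (pd0 W2 + (2 * pX) * pd0 U + (-(1 - pY ^ 2)) * pd0 (pd1 U)) := by
    rw [d1, d2, sS]
    linear_combination (pY * pX * pd0 (pd0 U)) * hI2
  have hbig : HB β ((2 * K * (C * 2 + 2 * K * C + 2 * K * 5) + 2 * K * (C * 8 + 2 * K * C + 2 * K * 5)) * M) (ev (sS * pd0 (pd0 U))) := by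
    rw [key]
    have q := (((hK (-(MvPolynomial.C Complex.I * pY)) (by simp)).mul ((b1.add ((hK (-(MvPolynomial.C Complex.I)) (by simp)).mul b3)).add 
      ((hK (MvPolynomial.C Complex.I * pY) (by simp)).mul b4))).add ((hK (1 - pY ^ 2) (by simp)).mul
       ((b2.add ((hK (2 * pX) (by simp)).mul b3)).add 
      ((hK (-(1 - pY ^ 2)) (by simp)).mul b4))))
    convert q using 1
    · ring
    · ext z; simp only [ev_add, ev_mul]
  have := hK0.mul hbig
  have e : (fun z => (ev sS z)⁻¹ * ev (sS * pd0 (pd0 U)) z) = fun z => (ev sS z)⁻¹ * ev (sS * pd0 (pd0 U)) z := rfl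
  have hfin : ∀ z, ‖z‖ ≤ 1 → (ev sS z)⁻¹ * ev (sS * pd0 (pd0 U)) z = ev (pd0 (pd0 U)) z := by
    intro z hz
    have n1 : ev sS z ≠ 0 := by intro h; have := sS_lower hz; rw [h] at this; norm_num at this
    rw [ev_mul]; field_simp
  have t := this.mono (K' := (2 * K0 * (2 * K * (C * 2 + 2 * K * C + 2 * K * 5) + 2 * K * (C * 8 + 2 * K * C + 2 * K * 5))) * M) (le_of_eq (by ring))
  refine ⟨fun z hz => ?_, fun z z' hz hz' => ?_⟩
  · rw [← hfin z hz]; exact t.1 z hz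
  · rw [← hfin z hz, ← hfin z' hz']; exact t.2 z z' hz hz'

lemma est2 {β : ℝ} (hβ0 : 0 < β) (hβ1 : β < 1) : ∃ C : ℝ, 0 ≤ C ∧ ∀ (U : P2) (M : ℝ), Idl U →
    (∀ z, ‖z‖ ≤ 1 → ‖ev (pd0 (pd1 U)) z‖ ≤ M) → 
    (∀ z, ‖z‖ ≤ 1 → ‖ev (pd0 (pd0 (pd1 U))) z‖ ≤ M) → 
    (∀ z, ‖z‖ ≤ 1 → ‖ev (pd1 (pd0 (pd1 U))) z‖ ≤ M) → 
    HB β (C * M) (ev (pd0 U)) ∧ HB β (C * M) (ev (pd1 U)) ∧ 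
    HB β (C * M) (ev (pd0 (pd0 U))) ∧ HB β (C * M) (ev (pd0 (pd1 U))) ∧ HB β (C * M) (ev (pd1 (pd0 U))) ∧
     HB β (C * M) (ev (pd1 (pd1 U))) := by
  obtain ⟨C1, hC1, h1⟩ := est1 hβ0 hβ1
  obtain ⟨C2, hC2, h2⟩ := est2_0 hβ0 hβ1
  refine ⟨C1 + C2 + 5, by positivity, fun U M hU hM hM0 hM1 => ?_⟩
  have hMn : 0 ≤ M := (norm_nonneg _).trans (hM 0 (by simp))
  have b4 : HB β (5 * M) (ev (pd0 (pd1 U))) := HB_of_bounds hβ0 hβ1 hM hM0 hM1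
  have i1 : C1 * M ≤ (C1 + C2 + 5) * M := by nlinarith
  have i2 : C2 * M ≤ (C1 + C2 + 5) * M := by nlinarith
  have i3 : 5 * M ≤ (C1 + C2 + 5) * M := by nlinarith
  refine ⟨(h1 U M hU hM).1.mono i1, (h1 U M hU hM).2.mono i1, (h2 U M hU hM hM0 hM1).mono i2, b4.mono i3, ?_, ?_⟩
  · rw [pd_comm]; exact b4.mono i3
  · have := h2 (pst U) M (Idl_pst hU) (fun z hz => by rw [L_pst, ev_pst, Complex.norm_conj]; exact hM z hz)
      (fun z hz => by rw [L_pst, pd0_pst, ev_pst, Complex.norm_conj]; exact hM1 z hz)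
      (fun z hz => by rw [L_pst, pd1_pst, ev_pst, Complex.norm_conj]; exact hM0 z hz)
    rw [pd0_pst, pd0_pst] at this
    apply HB.conj_iff
    convert this.mono i2 using 2 with z
    rw [ev_pst]
end

open MeasureTheory Real Set Filter
open scoped ENNReal NNReal ComplexConjugate
noncomputable section

lemma cont_approx {f : ℂ → ℝ} (hf : ContinuousOn f (Metric.closedBall 0 1)) {ε : ℝ} (hε : 0 < ε) :
    ∃ F : P2, ∀ z, ‖z‖ ≤ 1 → ‖ev F z - f z‖ ≤ ε := by
  haveI : CompactSpace (Metric.closedBall (0:ℂ) 1) := isCompact_iff_compactSpace.1 (isCompact_closedBall 0 1)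
  set g : C(Metric.closedBall (0:ℂ) 1, ℂ) := ⟨fun z => (f z : ℂ), by
    exact Complex.continuous_ofReal.comp (continuousOn_iff_continuous_domRestrict.1 hf)⟩ with hg
  have hmem : g ∈ StarAlgebra.elemental ℂ (ContinuousMap.restrict (Metric.closedBall (0:ℂ) 1) (.id ℂ)) := by
    rw [ContinuousMap.elemental_id_eq_top]; trivial
  have hcl : g ∈ closure (StarAlgebra.adjoin ℂ {ContinuousMap.restrict (Metric.closedBall (0:ℂ) 1) (.id ℂ)} : Set C(Metric.closedBall (0:ℂ) 1, ℂ)) := hmem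
  obtain ⟨h, hh, hd⟩ := Metric.mem_closure_iff.1 hcl ε hε
  have hex : ∃ F : P2, ∀ z : Metric.closedBall (0:ℂ) 1, h z = ev F z := by
    clear hd
    induction hh using StarAlgebra.adjoin_induction with
    | mem x hx => 
      rw [mem_singleton_iff] at hx
      subst hx
      exact ⟨pX, fun z => by simp⟩
    | algebraMap r => exact ⟨MvPolynomial.C r, fun z => by simp⟩
    | add x y _ _ hx hy =>
      obtain ⟨F, hF⟩ := hx
      obtain ⟨G, hG⟩ := hy
      exact ⟨F + G, fun z => by simp [hF, hG]⟩
    | mul x y _ _ hx hy =>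
      obtain ⟨F, hF⟩ := hx
      obtain ⟨G, hG⟩ := hy
      exact ⟨F * G, fun z => by simp [hF, hG]⟩
    | star x _ hx =>
      obtain ⟨F, hF⟩ := hx
      exact ⟨pst F, fun z => by rw [ev_pst, ← hF]; simp⟩
  obtain ⟨F, hF⟩ := hex
  refine ⟨F, fun z hz => ?_⟩
  have hz' : z ∈ Metric.closedBall (0:ℂ) 1 := by simpa using hz
  have := (ContinuousMap.dist_apply_le_dist (f := g) (g := h) ⟨z, hz'⟩).trans hd.le
  rw [hF, dist_comm, dist_eq_norm] at this
  simpa [hg] using this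

def bb (n i : ℕ) (s : ℝ) : ℝ := (bernsteinPolynomial ℝ n i).eval s
def bb' (n i : ℕ) (s : ℝ) : ℝ := (Polynomial.derivative (bernsteinPolynomial ℝ n i)).eval s

lemma bb_nonneg (n i : ℕ) {s : ℝ} (h0 : 0 ≤ s) (h1 : s ≤ 1) : 0 ≤ bb n i s := by
  have : 0 ≤ 1 - s := by linarith
  simp only [bb, bernsteinPolynomial, Polynomial.eval_mul, Polynomial.eval_natCast, Polynomial.eval_pow,
    Polynomial.eval_X, Polynomial.eval_sub, Polynomial.eval_one]
  positivity

lemma bb_sum (n : ℕ) (s : ℝ) : ∑ i ∈ Finset.range (n+1), bb n i s = 1 := by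
  have := congrArg (Polynomial.eval s) (bernsteinPolynomial.sum ℝ n)
  simpa [Polynomial.eval_finsetSum, bb] using this

lemma bb_var (n : ℕ) (s : ℝ) : ∑ i ∈ Finset.range (n+1), (n * s - i) ^ 2 * bb n i s = n * s * (1 - s) := by
  have := congrArg (Polynomial.eval s) (bernsteinPolynomial.variance ℝ n)
  simpa [Polynomial.eval_finsetSum, bb] using this

lemma bb_sbp (n : ℕ) (s : ℝ) (c : ℕ → ℝ) : ∑ i ∈ Finset.range (n+1+1), c i * bb' (n+1) i s =
    (n+1) * ∑ i ∈ Finset.range (n+1), (c (i+1) - c i) * bb n i s := by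
  rw [Finset.sum_range_succ']
  have e1 : ∀ i, bb' (n+1) (i+1) s = (n+1) * (bb n i s - bb n (i+1) s) := by
    intro i
    simp [bb', bb, bernsteinPolynomial.derivative_succ]
  have e0 : bb' (n+1) 0 s = - (n+1) * bb n 0 s := by
    simp [bb', bb, bernsteinPolynomial.derivative_zero]
  simp_rw [e1, e0]
  have e2 : ∑ i ∈ Finset.range (n+1), c (i+1) * bb n (i+1) s + c 0 * bb n 0 s = ∑ i ∈ Finset.range (n+1), c i * bb n i s := by
    rw [← Finset.sum_range_succ' (fun i => c i * bb n i s), Finset.sum_range_succ]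
    simp [bb, bernsteinPolynomial.eq_zero_of_lt]
  rw [Finset.mul_sum]
  have e3 : ∑ i ∈ Finset.range (n+1), c (i+1) * ((n+1) * (bb n i s - bb n (i+1) s)) = 
    (n+1) * (∑ i ∈ Finset.range (n+1), c (i+1) * bb n i s - ∑ i ∈ Finset.range (n+1), c (i+1) * bb n (i+1) s) := by
    rw [← Finset.sum_sub_distrib, Finset.mul_sum]
    apply Finset.sum_congr rfl; intros; ring
  have e4 : ∑ i ∈ Finset.range (n+1), ((n:ℝ)+1) * ((c (i+1) - c i) * bb n i s) = 
    (n+1) * (∑ i ∈ Finset.range (n+1), c (i+1) * bb n i s - ∑ i ∈ Finset.range (n+1), c i * bb n i s) := by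
    rw [← Finset.sum_sub_distrib, Finset.mul_sum]
    apply Finset.sum_congr rfl; intros; ring
  rw [e3, e4]
  linear_combination -(n+1) * e2

lemma bb_abs (n : ℕ) (hn : 0 < n) {s δ : ℝ} (h0 : 0 ≤ s) (h1 : s ≤ 1) (hδ : 0 < δ) : 
    ∑ i ∈ Finset.range (n+1), |s - i / n| * bb n i s ≤ δ + 1 / (n * δ) := by
  have hn' : (0:ℝ) < n := by exact_mod_cast hn
  calc _ ≤ ∑ i ∈ Finset.range (n+1), (δ + (n * s - i) ^ 2 / (n ^ 2 * δ)) * bb n i s := by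
        apply Finset.sum_le_sum
        intro i _
        gcongr
        · exact bb_nonneg n i h0 h1
        have e : (n * s - i) ^ 2 / (n ^ 2 * δ) = |s - i / n| ^ 2 / δ := by
          rw [sq_abs]; field_simp
        rw [e]
        generalize |s - i / n| = d
        rw [← sub_nonneg]
        have : δ + d ^ 2 / δ - d = ((d - δ/2)^2 + 3/4 * δ^2) / δ := by field_simp; ring
        rw [this]; positivity
    _ = δ * (∑ i ∈ Finset.range (n+1), bb n i s) + (∑ i ∈ Finset.range (n+1), (n * s - i) ^ 2 * bb n i s) / (n ^ 2 * δ) := by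
        rw [Finset.mul_sum, Finset.sum_div, ← Finset.sum_add_distrib]
        apply Finset.sum_congr rfl; intros; ring
    _ = δ + s * (1 - s) / (n * δ) := by
        rw [bb_sum, bb_var]; field_simp
    _ ≤ _ := by gcongr; nlinarith

def xp : P2 := MvPolynomial.C (1/4) * (pX + pY) + MvPolynomial.C (1/2)
def yp : P2 := MvPolynomial.C (-Complex.I/4) * (pX - pY) + MvPolynomial.C (1/2)

lemma ev_xp (z : ℂ) : ev xp z = (((1 + z.re)/2 : ℝ) : ℂ) := by
  simp only [xp, ev_add, ev_mul, ev_C, ev_X, ev_Y, Complex.add_conj]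
  push_cast; ring
lemma ev_yp (z : ℂ) : ev yp z = (((1 + z.im)/2 : ℝ) : ℂ) := by
  simp only [yp, ev_add, ev_mul, ev_sub, ev_C, ev_X, ev_Y, Complex.sub_conj]
  push_cast; linear_combination (-(z.im:ℂ)/2) * Complex.I_mul_I

lemma ev_aeval {Q : P2} {z : ℂ} {s : ℝ} (h : ev Q z = s) (p : Polynomial ℝ) :
    ev (Polynomial.aeval Q p) z = ((p.eval s : ℝ) : ℂ) := by
  induction p using Polynomial.induction_on' with
  | add p q hp hq => simp [hp, hq]
  | monomial n c =>
    simp [Polynomial.aeval_monomial, h, MvPolynomial.algebraMap_eq, IsScalarTower.algebraMap_apply ℝ ℂ P2]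

lemma pd_aeval (i : Fin 2) (Q : P2) (p : Polynomial ℝ) :
    MvPolynomial.pderiv i (Polynomial.aeval Q p) = Polynomial.aeval Q (Polynomial.derivative p) * MvPolynomial.pderiv i Q := by
  induction p using Polynomial.induction_on' with
  | add p q hp hq => simp [hp, hq, add_mul]
  | monomial n c =>
    simp [Polynomial.aeval_monomial, MvPolynomial.algebraMap_eq, IsScalarTower.algebraMap_apply ℝ ℂ P2,
      MvPolynomial.pderiv_mul, MvPolynomial.pderiv_pow, Polynomial.derivative_monomial]
    ring

lemma dbl_abs (n m : ℕ) {s t K : ℝ} (hs0 : 0 ≤ s) (hs1 : s ≤ 1) (ht0 : 0 ≤ t) (ht1 : t ≤ 1) (c : ℕ → ℕ → ℝ)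
    (hc : ∀ i j, |c i j| ≤ K) :
    |∑ i ∈ Finset.range (n+1), ∑ j ∈ Finset.range (m+1), c i j * bb n i s * bb m j t| ≤ K := by
  calc _ ≤ ∑ i ∈ Finset.range (n+1), ∑ j ∈ Finset.range (m+1), K * bb n i s * bb m j t := by
        refine (Finset.abs_sum_le_sum_abs _ _).trans (Finset.sum_le_sum fun i _ => ?_)
        refine (Finset.abs_sum_le_sum_abs _ _).trans (Finset.sum_le_sum fun j _ => ?_)
        rw [abs_mul, abs_mul, abs_of_nonneg (bb_nonneg n i hs0 hs1), abs_of_nonneg (bb_nonneg m j ht0 ht1)]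
        have := bb_nonneg n i hs0 hs1
        have := bb_nonneg m j ht0 ht1
        have := hc i j
        gcongr
    _ = K := by
        simp_rw [← Finset.mul_sum, bb_sum, mul_one, ← Finset.mul_sum, bb_sum, mul_one]

lemma lip_approx {f : ℂ → ℝ} {L : ℝ} (hL : 0 ≤ L) (hf : ∀ z w, |f z - f w| ≤ L * ‖z - w‖) {ε : ℝ} (hε : 0 < ε) :
    ∃ F : P2, (∀ z, ‖z‖ ≤ 1 → ‖ev F z - f z‖ ≤ ε) ∧ (∀ z, ‖z‖ ≤ 1 → ‖ev (pd0 F) z‖ ≤ L) ∧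
      (∀ z, ‖z‖ ≤ 1 → ‖ev (pd1 F) z‖ ≤ L) := by
  set δ : ℝ := ε / (8 * (L + 1)) with hδ
  have hδ0 : 0 < δ := by positivity
  obtain ⟨n, hn⟩ := exists_nat_gt (1 / δ ^ 2)
  set w : ℕ → ℕ → ℂ := fun i j => ((2 * (i / (n+1)) - 1 : ℝ) : ℂ) + ((2 * (j / (n+1)) - 1 : ℝ) : ℂ) * Complex.I with hw
  set c : ℕ → ℕ → ℝ := fun i j => f (w i j) with hc
  have hn1 : (0:ℝ) < n + 1 := by positivity
  have hc1 : ∀ i j, |(n+1) * (c (i+1) j - c i j)| ≤ 2 * L := by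
    intro i j
    rw [abs_mul, abs_of_pos hn1]
    have := hf (w (i+1) j) (w i j)
    have e : w (i+1) j - w i j = ((2 / (n+1) : ℝ) : ℂ) := by simp only [hw]; push_cast; ring
    rw [e, Complex.norm_real, Real.norm_of_nonneg (by positivity)] at this
    calc _ ≤ ((n:ℝ)+1) * (L * (2 / (n+1))) := by gcongr
      _ = 2 * L := by field_simp
  have hc2 : ∀ i j, |(n+1) * (c i (j+1) - c i j)| ≤ 2 * L := by
    intro i j
    rw [abs_mul, abs_of_pos hn1]
    have := hf (w i (j+1)) (w i j)
    have e : w i (j+1) - w i j = ((2 / (n+1) : ℝ) : ℂ) * Complex.I := by simp only [hw]; push_cast; ring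
    rw [e, norm_mul, Complex.norm_I, mul_one, Complex.norm_real, Real.norm_of_nonneg (by positivity)] at this
    calc _ ≤ ((n:ℝ)+1) * (L * (2 / (n+1))) := by gcongr
      _ = 2 * L := by field_simp
  set B : ℕ → Polynomial ℝ := fun i => bernsteinPolynomial ℝ (n+1) i with hB
  set F : P2 := ∑ i ∈ Finset.range (n+1+1), ∑ j ∈ Finset.range (n+1+1), 
    MvPolynomial.C (c i j : ℂ) * (Polynomial.aeval xp (B i) * Polynomial.aeval yp (B j)) with hF
  have ev_sum : ∀ (S : Finset ℕ) (G : ℕ → P2) (z : ℂ), ev (∑ i ∈ S, G i) z = ∑ i ∈ S, ev (G i) z := by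
    intro S G z; simp [ev, map_sum]
  have hst : ∀ x : ℝ, |x| ≤ 1 → 0 ≤ (1+x)/2 ∧ (1+x)/2 ≤ 1 := by
    intro x hx; rw [abs_le] at hx; constructor <;> linarith [hx.1, hx.2]
  have evF : ∀ z, ev F z = ((∑ i ∈ Finset.range (n+1+1), ∑ j ∈ Finset.range (n+1+1), c i j * bb (n+1) i ((1+z.re)/2) * bb (n+1) j ((1+z.im)/2) : ℝ) : ℂ) := by
    intro z
    rw [hF]
    push_cast
    simp_rw [ev_sum, ev_mul, ev_C, ev_aeval (ev_xp z), ev_aeval (ev_yp z)]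
    apply Finset.sum_congr rfl; intro i _
    apply Finset.sum_congr rfl; intro j _
    simp only [bb, hB]; push_cast; ring
  have evdF : ∀ k z, ev (MvPolynomial.pderiv k F) z = 
     ((∑ i ∈ Finset.range (n+1), ∑ j ∈ Finset.range (n+1+1), ((n+1) * (c (i+1) j - c i j)) * bb n i ((1+z.re)/2) * bb (n+1) j ((1+z.im)/2) : ℝ) : ℂ) * ev (MvPolynomial.pderiv k xp) z
    + ((∑ i ∈ Finset.range (n+1+1), ∑ j ∈ Finset.range (n+1), ((n+1) * (c i (j+1) - c i j)) * bb (n+1) i ((1+z.re)/2) * bb n j ((1+z.im)/2) : ℝ) : ℂ) * ev (MvPolynomial.pderiv k yp) z := by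
    intro k z
    have e1 : ∑ i ∈ Finset.range (n+1), ∑ j ∈ Finset.range (n+1+1), ((n+1) * (c (i+1) j - c i j)) * bb n i ((1+z.re)/2) * bb (n+1) j ((1+z.im)/2)
      = ∑ i ∈ Finset.range (n+1+1), ∑ j ∈ Finset.range (n+1+1), c i j * bb' (n+1) i ((1+z.re)/2) * bb (n+1) j ((1+z.im)/2) := by
      refine (Finset.sum_comm).trans (Eq.trans ?_ Finset.sum_comm)
      apply Finset.sum_congr rfl; intro j _
      rw [← Finset.sum_mul, ← Finset.sum_mul, bb_sbp _ _ (fun i => c i j), Finset.mul_sum]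
      congr 1
      apply Finset.sum_congr rfl; intros; ring
    have e2 : ∑ i ∈ Finset.range (n+1+1), ∑ j ∈ Finset.range (n+1), ((n+1) * (c i (j+1) - c i j)) * bb (n+1) i ((1+z.re)/2) * bb n j ((1+z.im)/2)
      = ∑ i ∈ Finset.range (n+1+1), ∑ j ∈ Finset.range (n+1+1), c i j * bb (n+1) i ((1+z.re)/2) * bb' (n+1) j ((1+z.im)/2) := by
      apply Finset.sum_congr rfl; intro i _
      have := bb_sbp n ((1+z.im)/2) (fun j => c i j)
      calc _ = bb (n+1) i ((1+z.re)/2) * (((n:ℝ)+1) * ∑ j ∈ Finset.range (n+1), (c i (j+1) - c i j) * bb n j ((1+z.im)/2)) := by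
            rw [Finset.mul_sum, Finset.mul_sum]; apply Finset.sum_congr rfl; intros; ring
        _ = _ := by
            rw [← this, Finset.mul_sum]; apply Finset.sum_congr rfl; intros; ring
    rw [e1, e2, hF, map_sum, ev_sum]
    push_cast
    rw [Finset.sum_mul, Finset.sum_mul, ← Finset.sum_add_distrib]
    apply Finset.sum_congr rfl; intro i _
    rw [map_sum, ev_sum, Finset.sum_mul, Finset.sum_mul, ← Finset.sum_add_distrib]
    apply Finset.sum_congr rfl; intro j _
    rw [MvPolynomial.pderiv_C_mul, MvPolynomial.pderiv_mul, pd_aeval, pd_aeval]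
    simp only [ev_mul, ev_add, ev_C, ev_aeval (ev_xp z), ev_aeval (ev_yp z)]
    simp only [bb, bb', hB]; ring
  have hre : ∀ z : ℂ, ‖z‖ ≤ 1 → |z.re| ≤ 1 := fun z hz => (Complex.abs_re_le_norm z).trans hz
  have him : ∀ z : ℂ, ‖z‖ ≤ 1 → |z.im| ≤ 1 := fun z hz => (Complex.abs_im_le_norm z).trans hz
  have hd : ∀ k, (∀ z, ‖ev (MvPolynomial.pderiv k xp) z‖ ≤ 1/4) → (∀ z, ‖ev (MvPolynomial.pderiv k yp) z‖ ≤ 1/4) →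
     ∀ z, ‖z‖ ≤ 1 → ‖ev (MvPolynomial.pderiv k F) z‖ ≤ L := by
    intro k hx hy z hz
    obtain ⟨s0, s1⟩ := hst _ (hre z hz)
    obtain ⟨t0, t1⟩ := hst _ (him z hz)
    rw [evdF]
    refine (norm_add_le _ _).trans ?_
    rw [norm_mul, norm_mul, Complex.norm_real, Complex.norm_real]
    have a1 := dbl_abs n (n+1) s0 s1 t0 t1 (fun i j => ((n+1) * (c (i+1) j - c i j))) hc1
    have a2 := dbl_abs (n+1) n s0 s1 t0 t1 (fun i j => ((n+1) * (c i (j+1) - c i j))) hc2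
    have b1 := mul_le_mul a1 (hx z) (norm_nonneg _) (by positivity)
    have b2 := mul_le_mul a2 (hy z) (norm_nonneg _) (by positivity)
    simp only [Real.norm_eq_abs]
    linarith
  refine ⟨F, ?_, hd 0 ?_ ?_, hd 1 ?_ ?_⟩
  · intro z hz
    obtain ⟨s0, s1⟩ := hst _ (hre z hz)
    obtain ⟨t0, t1⟩ := hst _ (him z hz)
    rw [evF, ← Complex.ofReal_sub, Complex.norm_real, Real.norm_eq_abs]
    set s := (1 + z.re)/2 with hs
    set t := (1 + z.im)/2 with ht
    have e0 : f z = ∑ i ∈ Finset.range (n+1+1), ∑ j ∈ Finset.range (n+1+1), f z * bb (n+1) i s * bb (n+1) j t := by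
      simp_rw [← Finset.mul_sum, bb_sum, mul_one, ← Finset.mul_sum, bb_sum, mul_one]
    have hcf : ∀ i j : ℕ, |c i j - f z| ≤ 2 * L * |s - i / (n+1)| + 2 * L * |t - j / (n+1)| := by
      intro i j
      refine (hf (w i j) z).trans ?_
      have e : w i j - z = ((-2 * (s - i/(n+1)) : ℝ) : ℂ) + ((-2 * (t - j/(n+1)) : ℝ) : ℂ) * Complex.I := by
        simp only [hw, hs, ht]
        apply Complex.ext <;> simp <;> ring
      rw [e]
      have : ‖((-2 * (s - i/(n+1)) : ℝ) : ℂ) + ((-2 * (t - j/(n+1)) : ℝ) : ℂ) * Complex.I‖ ≤ 2 * |s - i/(n+1)| + 2 * |t - j/(n+1)| := by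
        refine (norm_add_le _ _).trans (le_of_eq ?_)
        rw [norm_mul, Complex.norm_I, mul_one, Complex.norm_real, Complex.norm_real, Real.norm_eq_abs, Real.norm_eq_abs, abs_mul, abs_mul]
        norm_num
      nlinarith
    have hbs := bb_abs (n+1) (Nat.succ_pos n) s0 s1 hδ0
    have hbt := bb_abs (n+1) (Nat.succ_pos n) t0 t1 hδ0
    have hsm : 1 / (((n+1 : ℕ) : ℝ) * δ) ≤ δ := by
      rw [div_le_iff₀ (by positivity)]
      rw [div_lt_iff₀ (by positivity)] at hn
      push_cast
      nlinarith [sq_nonneg δ]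
    calc _ = |∑ i ∈ Finset.range (n+1+1), ∑ j ∈ Finset.range (n+1+1), (c i j - f z) * bb (n+1) i s * bb (n+1) j t| := by
          conv_lhs => rw [e0]
          rw [← Finset.sum_sub_distrib]
          congr 1
          apply Finset.sum_congr rfl; intro i _
          rw [← Finset.sum_sub_distrib]
          apply Finset.sum_congr rfl; intros; ring
      _ ≤ ∑ i ∈ Finset.range (n+1+1), ∑ j ∈ Finset.range (n+1+1), (2 * L * |s - i / (n+1)| + 2 * L * |t - j / (n+1)|) * bb (n+1) i s * bb (n+1) j t := by
          refine (Finset.abs_sum_le_sum_abs _ _).trans (Finset.sum_le_sum fun i _ => ?_)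
          refine (Finset.abs_sum_le_sum_abs _ _).trans (Finset.sum_le_sum fun j _ => ?_)
          have p1 := bb_nonneg (n+1) i s0 s1
          have p2 := bb_nonneg (n+1) j t0 t1
          rw [abs_mul, abs_mul, abs_of_nonneg p1, abs_of_nonneg p2]
          have := hcf i j
          gcongr
      _ = 2 * L * (∑ i ∈ Finset.range (n+1+1), |s - i / (n+1)| * bb (n+1) i s) * (∑ j ∈ Finset.range (n+1+1), bb (n+1) j t)
        + 2 * L * (∑ i ∈ Finset.range (n+1+1), bb (n+1) i s) * (∑ j ∈ Finset.range (n+1+1), |t - j / (n+1)| * bb (n+1) j t) := by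
          rw [mul_assoc (2 * L), mul_assoc (2 * L), Finset.sum_mul_sum, Finset.sum_mul_sum, ← mul_add, ← Finset.sum_add_distrib, Finset.mul_sum]
          apply Finset.sum_congr rfl; intro i _
          rw [← Finset.sum_add_distrib, Finset.mul_sum]
          apply Finset.sum_congr rfl; intros; ring
      _ ≤ ε := by
          rw [bb_sum, bb_sum, mul_one, mul_one]
          push_cast at hbs hbt hsm
          have q1 : ∑ i ∈ Finset.range (n+1+1), |s - i / ((n:ℝ)+1)| * bb (n+1) i s ≤ 2 * δ := by linarith
          have q2 : ∑ i ∈ Finset.range (n+1+1), |t - i / ((n:ℝ)+1)| * bb (n+1) i t ≤ 2 * δ := by linarith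
          have e8 : δ * (8 * (L + 1)) = ε := by rw [hδ]; field_simp
          nlinarith
  all_goals
    intro z
    simp [xp, yp, MvPolynomial.pderiv_mul, MvPolynomial.pderiv_X]
end

open MeasureTheory Real Set Filter
open scoped ENNReal NNReal ComplexConjugate
noncomputable section

section classes
variable {E F G W : Type} [NormedAddCommGroup E] [NormedSpace ℝ E]
  [NormedAddCommGroup F] [NormedSpace ℝ F] [NormedAddCommGroup G] [NormedSpace ℝ G]
  [NormedAddCommGroup W] [NormedSpace ℝ W]

/-- bounded and Hölder on a set -/
def Hb (β : ℝ) (s : Set E) (f : E → F) : Prop :=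
  ∃ K : ℝ, 0 ≤ K ∧ (∀ x ∈ s, ‖f x‖ ≤ K) ∧ ∀ x ∈ s, ∀ y ∈ s, ‖f x - f y‖ ≤ K * ‖x - y‖ ^ β

def C1b (β : ℝ) (s : Set E) (f : E → F) : Prop :=
  Hb β s f ∧ ∃ f' : E → E →L[ℝ] F, (∀ x ∈ s, HasFDerivWithinAt f (f' x) s x) ∧ Hb β s f'

def C2b (β : ℝ) (s : Set E) (f : E → F) : Prop :=
  Hb β s f ∧ ∃ f' : E → E →L[ℝ] F, (∀ x ∈ s, HasFDerivWithinAt f (f' x) s x) ∧ C1b β s f'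

lemma Hb.congr {β : ℝ} {s : Set E} {f g : E → F} (h : Hb β s f) (e : ∀ x ∈ s, g x = f x) :
    Hb β s g := by
  obtain ⟨K, h0, h1, h2⟩ := h
  refine ⟨K, h0, fun x hx => by rw [e x hx]; exact h1 x hx, fun x hx y hy => ?_⟩
  rw [e x hx, e y hy]; exact h2 x hx y hy

lemma C1b.congr {β : ℝ} {s : Set E} {f g : E → F} (h : C1b β s f) (e : ∀ x ∈ s, g x = f x) :
    C1b β s g := by
  obtain ⟨h1, f', h2, h3⟩ := h
  exact ⟨h1.congr e, f', fun x hx => (h2 x hx).congr e (e x hx), h3⟩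

lemma C2b.congr {β : ℝ} {s : Set E} {f g : E → F} (h : C2b β s f) (e : ∀ x ∈ s, g x = f x) :
    C2b β s g := by
  obtain ⟨h1, f', h2, h3⟩ := h
  exact ⟨h1.congr e, f', fun x hx => (h2 x hx).congr e (e x hx), h3⟩

lemma C2b.toC1 {β : ℝ} {s : Set E} {f : E → F} (h : C2b β s f) : C1b β s f := by
  obtain ⟨h1, f', h2, h3⟩ := h
  exact ⟨h1, f', h2, h3.1⟩

lemma Hb.add {β : ℝ} {s : Set E} {f g : E → F} (hf : Hb β s f) (hg : Hb β s g) :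
    Hb β s (fun x => f x + g x) := by
  obtain ⟨K, h0, h1, h2⟩ := hf
  obtain ⟨K', h0', h1', h2'⟩ := hg
  refine ⟨K + K', by positivity, fun x hx => (norm_add_le _ _).trans (add_le_add (h1 x hx) (h1' x hx)),
    fun x hx y hy => ?_⟩
  rw [add_sub_add_comm, add_mul]
  exact (norm_add_le _ _).trans (add_le_add (h2 x hx y hy) (h2' x hx y hy))

lemma C1b.add {β : ℝ} {s : Set E} {f g : E → F} (hf : C1b β s f) (hg : C1b β s g) :
    C1b β s (fun x => f x + g x) := by
  obtain ⟨h1, f', h2, h3⟩ := hf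
  obtain ⟨h1', g', h2', h3'⟩ := hg
  exact ⟨h1.add h1', _, fun x hx => (h2 x hx).add (h2' x hx), h3.add h3'⟩

lemma C2b.add {β : ℝ} {s : Set E} {f g : E → F} (hf : C2b β s f) (hg : C2b β s g) :
    C2b β s (fun x => f x + g x) := by
  obtain ⟨h1, f', h2, h3⟩ := hf
  obtain ⟨h1', g', h2', h3'⟩ := hg
  exact ⟨h1.add h1', _, fun x hx => (h2 x hx).add (h2' x hx), h3.add h3'⟩

lemma Hb.clm {β : ℝ} {s : Set E} {f : E → F} (L : F →L[ℝ] G) (hf : Hb β s f) :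
    Hb β s (fun x => L (f x)) := by
  obtain ⟨K, h0, h1, h2⟩ := hf
  refine ⟨‖L‖ * K, by positivity, fun x hx => (L.le_opNorm _).trans (by gcongr; exact h1 x hx),
    fun x hx y hy => ?_⟩
  rw [← map_sub, mul_assoc]
  exact (L.le_opNorm _).trans (by gcongr; exact h2 x hx y hy)

lemma C1b.clm {β : ℝ} {s : Set E} {f : E → F} (L : F →L[ℝ] G) (hf : C1b β s f) :
    C1b β s (fun x => L (f x)) := by
  obtain ⟨h1, f', h2, h3⟩ := hf
  exact ⟨h1.clm L, fun x => L.comp (f' x), fun x hx => L.hasFDerivAt.comp_hasFDerivWithinAt x (h2 x hx),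
    h3.clm (ContinuousLinearMap.compL ℝ E F G L)⟩

lemma C2b.clm {β : ℝ} {s : Set E} {f : E → F} (L : F →L[ℝ] G) (hf : C2b β s f) :
    C2b β s (fun x => L (f x)) := by
  obtain ⟨h1, f', h2, h3⟩ := hf
  exact ⟨h1.clm L, fun x => L.comp (f' x), fun x hx => L.hasFDerivAt.comp_hasFDerivWithinAt x (h2 x hx),
    h3.clm (ContinuousLinearMap.compL ℝ E F G L)⟩

lemma Hb.bil {β : ℝ} {s : Set E} {f : E → F} {g : E → G} (B : F →L[ℝ] G →L[ℝ] W) (hf : Hb β s f)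
    (hg : Hb β s g) : Hb β s (fun x => B (f x) (g x)) := by
  obtain ⟨K, h0, h1, h2⟩ := hf
  obtain ⟨K', h0', h1', h2'⟩ := hg
  refine ⟨2 * (‖B‖ * K * K'), by positivity, fun x hx => ?_, fun x hx y hy => ?_⟩
  · calc _ ≤ ‖B‖ * ‖f x‖ * ‖g x‖ := B.le_opNorm₂ _ _
      _ ≤ ‖B‖ * K * K' := by gcongr; exact h1 x hx; exact h1' x hx
      _ ≤ _ := by nlinarith [show 0 ≤ ‖B‖ * K * K' by positivity]
  · have e : B (f x) (g x) - B (f y) (g y) = B (f x - f y) (g x) + B (f y) (g x - g y) := by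
      simp
    rw [e]
    calc _ ≤ ‖B‖ * ‖f x - f y‖ * ‖g x‖ + ‖B‖ * ‖f y‖ * ‖g x - g y‖ :=
          (norm_add_le _ _).trans (add_le_add (B.le_opNorm₂ _ _) (B.le_opNorm₂ _ _))
      _ ≤ ‖B‖ * (K * ‖x - y‖ ^ β) * K' + ‖B‖ * K * (K' * ‖x - y‖ ^ β) := by
          gcongr
          exacts [h2 x hx y hy, h1' x hx, h1 y hy, h2' x hx y hy]
      _ = _ := by ring

lemma C1b.bil {β : ℝ} {s : Set E} {f : E → F} {g : E → G} (B : F →L[ℝ] G →L[ℝ] W) (hf : C1b β s f)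
    (hg : C1b β s g) : C1b β s (fun x => B (f x) (g x)) := by
  obtain ⟨h1, f', h2, h3⟩ := hf
  obtain ⟨h1', g', h2', h3'⟩ := hg
  exact ⟨h1.bil B h1', _, fun x hx => B.hasFDerivWithinAt_of_bilinear (h2 x hx) (h2' x hx),
    (h1.bil (B.precompR E) h3').add (h3.bil (B.precompL E) h1')⟩

lemma C2b.bil {β : ℝ} {s : Set E} {f : E → F} {g : E → G} (B : F →L[ℝ] G →L[ℝ] W) (hf : C2b β s f)
    (hg : C2b β s g) : C2b β s (fun x => B (f x) (g x)) := by
  have hf1 := hf.toC1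
  have hg1 := hg.toC1
  obtain ⟨h1, f', h2, h3⟩ := hf
  obtain ⟨h1', g', h2', h3'⟩ := hg
  exact ⟨h1.bil B h1', _, fun x hx => B.hasFDerivWithinAt_of_bilinear (h2 x hx) (h2' x hx),
    (hf1.bil (B.precompR E) h3').add (h3.bil (B.precompL E) hg1)⟩

lemma Hb.comp {β : ℝ} (hβ : 0 < β) {s : Set E} {t : Set F} {ζ : E → F} {g : F → G} (hg : Hb β t g)
    (hm : ∀ x ∈ s, ζ x ∈ t) {L : ℝ} (hL : ∀ x ∈ s, ∀ y ∈ s, ‖ζ x - ζ y‖ ≤ L * ‖x - y‖) :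
    Hb β s (fun x => g (ζ x)) := by
  obtain ⟨K, h0, h1, h2⟩ := hg
  have hL' : ∀ x ∈ s, ∀ y ∈ s, ‖ζ x - ζ y‖ ≤ (|L|+1) * ‖x - y‖ := fun x hx y hy =>
    (hL x hx y hy).trans (by gcongr; linarith [le_abs_self L])
  refine ⟨max K (K * (|L|+1) ^ β), le_max_of_le_left h0, fun x hx => le_max_of_le_left (h1 _ (hm x hx)),
    fun x hx y hy => ?_⟩
  calc _ ≤ K * ‖ζ x - ζ y‖ ^ β := h2 _ (hm x hx) _ (hm y hy)
    _ ≤ K * ((|L|+1) * ‖x - y‖) ^ β := by gcongr; exact hL' x hx y hy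
    _ = K * (|L|+1) ^ β * ‖x - y‖ ^ β := by
        rw [Real.mul_rpow (by positivity) (by positivity)]; ring
    _ ≤ _ := by gcongr; exact le_max_right _ _

lemma C1b.comp {β : ℝ} (hβ : 0 < β) {s : Set E} {t : Set F} {ζ : E → F} {g : F → G} (hg : C1b β t g)
    (hm : ∀ x ∈ s, ζ x ∈ t) {L : ℝ} (hL : ∀ x ∈ s, ∀ y ∈ s, ‖ζ x - ζ y‖ ≤ L * ‖x - y‖)
    (hζ : C1b β s ζ) :
    C1b β s (fun x => g (ζ x)) := by
  obtain ⟨h1, g', h2, h3⟩ := hg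
  obtain ⟨h1', z', h2', h3'⟩ := hζ
  exact ⟨h1.comp hβ hm hL, fun x => (g' (ζ x)).comp (z' x),
    fun x hx => (h2 _ (hm x hx)).comp x (h2' x hx) hm,
    (h3.comp hβ hm hL).bil (ContinuousLinearMap.compL ℝ E F G) h3'⟩

lemma C2b.comp {β : ℝ} (hβ : 0 < β) {s : Set E} {t : Set F} {ζ : E → F} {g : F → G} (hg : C2b β t g)
    (hm : ∀ x ∈ s, ζ x ∈ t) {L : ℝ} (hL : ∀ x ∈ s, ∀ y ∈ s, ‖ζ x - ζ y‖ ≤ L * ‖x - y‖)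
    (hζ : C2b β s ζ) :
    C2b β s (fun x => g (ζ x)) := by
  have hz1 := hζ.toC1
  obtain ⟨h1, g', h2, h3⟩ := hg
  obtain ⟨h1', z', h2', h3'⟩ := hζ
  exact ⟨h1.comp hβ hm hL, fun x => (g' (ζ x)).comp (z' x),
    fun x hx => (h2 _ (hm x hx)).comp x (h2' x hx) hm,
    (h3.comp hβ hm hL hz1).bil (ContinuousLinearMap.compL ℝ E F G) h3'⟩

lemma lip_of_smooth {s O : Set E} (hs : IsCompact s) (hO : IsOpen O) (hsO : s ⊆ O) {f : E → F}
    (hf : ContDiffOn ℝ 1 f O) : ∃ L : ℝ, ∀ x ∈ s, ∀ y ∈ s, ‖f x - f y‖ ≤ L * ‖x - y‖ := by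
  have : LocallyLipschitzOn s f := by
    intro x hx
    obtain ⟨K, t, ht, h⟩ := ((hf x (hsO hx)).contDiffAt (hO.mem_nhds (hsO hx))).exists_lipschitzOnWith
    exact ⟨K, t, mem_nhdsWithin_of_mem_nhds ht, h⟩
  obtain ⟨K, hK⟩ := this.exists_lipschitzOnWith_of_compact hs
  exact ⟨K, fun x hx y hy => by simpa [dist_eq_norm] using hK.dist_le_mul x hx y hy⟩

lemma Hb_of_lip {β : ℝ} (hβ0 : 0 < β) (hβ1 : β < 1) {s : Set E} (hs : IsCompact s) {f : E → F} {L : ℝ}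
    (hL : ∀ x ∈ s, ∀ y ∈ s, ‖f x - f y‖ ≤ L * ‖x - y‖) : Hb β s f := by
  rcases s.eq_empty_or_nonempty with rfl | ⟨x0, hx0⟩
  · exact ⟨0, le_rfl, by simp, by simp⟩
  obtain ⟨R, hR⟩ := hs.isBounded.exists_norm_le
  have hR0 : 0 ≤ R := (norm_nonneg _).trans (hR _ hx0)
  have hd : ∀ x ∈ s, ∀ y ∈ s, ‖x - y‖ ≤ 2 * R := fun x hx y hy =>
    (norm_sub_le _ _).trans (by linarith [hR x hx, hR y hy])
  have hc : ∀ x ∈ s, ∀ y ∈ s, ‖f x - f y‖ ≤ |L| * ((2 * R) ^ (1-β)) * ‖x - y‖^β := by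
    intro x hx y hy
    calc _ ≤ |L| * ‖x - y‖ := (hL x hx y hy).trans (by gcongr; exact le_abs_self L)
      _ = |L| * (‖x - y‖^(1-β) * ‖x-y‖^β) := by
          rw [← Real.rpow_add' (norm_nonneg _) (by norm_num)]; norm_num
      _ ≤ |L| * ((2*R)^(1-β) * ‖x-y‖^β) := by
          have := Real.rpow_le_rpow (norm_nonneg _) (hd x hx y hy) (show 0 ≤ 1-β by linarith)
          gcongr
      _ = _ := by ring
  refine ⟨max (‖f x0‖ + |L| * (2*R)) (|L| * ((2 * R) ^ (1-β))), le_max_of_le_left (by positivity),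
    fun x hx => le_max_of_le_left ?_, fun x hx y hy => (hc x hx y hy).trans (by gcongr; exact le_max_right _ _)⟩
  have h1 : ‖f x - f x0‖ ≤ |L| * (2*R) := (hL x hx x0 hx0).trans (by
    gcongr
    · exact le_abs_self L
    · exact hd x hx x0 hx0)
  calc ‖f x‖ = ‖f x0 + (f x - f x0)‖ := by congr 1; abel
    _ ≤ _ := (norm_add_le _ _).trans (by linarith)

lemma C1b_of_smooth {β : ℝ} (hβ0 : 0 < β) (hβ1 : β < 1) {s O : Set E} (hs : IsCompact s) (hO : IsOpen O)
    (hsO : s ⊆ O) {f : E → F} (hf : ContDiffOn ℝ 2 f O) : C1b β s f := by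
  obtain ⟨L, hL⟩ := lip_of_smooth hs hO hsO (hf.of_le (by norm_num))
  obtain ⟨L', hL'⟩ := lip_of_smooth hs hO hsO (hf.fderiv_of_isOpen hO (m := 1) (by norm_num))
  refine ⟨Hb_of_lip hβ0 hβ1 hs hL, fderiv ℝ f, fun x hx => ?_, Hb_of_lip hβ0 hβ1 hs hL'⟩
  exact ((hf.differentiableOn (by norm_num) x (hsO hx)).differentiableAt
    (hO.mem_nhds (hsO hx))).hasFDerivAt.hasFDerivWithinAt

lemma C2b_of_smooth {β : ℝ} (hβ0 : 0 < β) (hβ1 : β < 1) {s O : Set E} (hs : IsCompact s) (hO : IsOpen O)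
    (hsO : s ⊆ O) {f : E → F} (hf : ContDiffOn ℝ 3 f O) : C2b β s f := by
  obtain ⟨L, hL⟩ := lip_of_smooth hs hO hsO (hf.of_le (by norm_num))
  refine ⟨Hb_of_lip hβ0 hβ1 hs hL, fderiv ℝ f, fun x hx => ?_,
    C1b_of_smooth hβ0 hβ1 hs hO hsO (hf.fderiv_of_isOpen hO (m := 2) (by norm_num))⟩
  exact ((hf.differentiableOn (by norm_num) x (hsO hx)).differentiableAt
    (hO.mem_nhds (hsO hx))).hasFDerivAt.hasFDerivWithinAt

lemma Hb.continuousOn {β : ℝ} (hβ : 0 < β) {s : Set E} {f : E → F} (h : Hb β s f) : ContinuousOn f s := by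
  obtain ⟨K, h0, h1, h2⟩ := h
  intro x hx
  rw [ContinuousWithinAt, tendsto_iff_norm_sub_tendsto_zero]
  have : Tendsto (fun y => K * ‖y - x‖ ^ β) (nhdsWithin x s) (nhds 0) := by
    have : ContinuousWithinAt (fun y => K * ‖y - x‖ ^ β) s x := by
      apply ContinuousWithinAt.mul continuousWithinAt_const
      apply ContinuousWithinAt.rpow_const
      · fun_prop
      · right; exact hβ.le
    simpa [ContinuousWithinAt, hβ.ne'] using this
  refine squeeze_zero' (Eventually.of_forall fun _ => norm_nonneg _) ?_ this
  filter_upwards [self_mem_nhdsWithin] with y hy using h2 y hy x hx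

lemma Hb.holder {β : ℝ} (hβ : 0 < β) {s : Set E} {f : E → F} (h : Hb β s f) :
    ∃ K : ℝ≥0, HolderOnWith K β.toNNReal f s := by
  obtain ⟨K, h0, h1, h2⟩ := h
  refine ⟨NNReal.mk K h0, fun x hx y hy => ?_⟩
  rw [edist_eq_enorm_sub, edist_eq_enorm_sub, ← ofReal_norm, ← ofReal_norm,
    ENNReal.ofReal_rpow_of_nonneg (norm_nonneg _) (by positivity), Real.coe_toNNReal _ hβ.le]
  have : ((NNReal.mk K h0 : ℝ≥0) : ℝ≥0∞) = ENNReal.ofReal K := by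
    rw [ENNReal.ofReal, Real.toNNReal_of_nonneg h0]
  rw [this, ← ENNReal.ofReal_mul h0]
  exact ENNReal.ofReal_le_ofReal (h2 x hx y hy)

lemma C1b.fderivW {β : ℝ} {s : Set E} (hu : UniqueDiffOn ℝ s) {f : E → F} (h : C1b β s f) :
    Hb β s (fderivWithin ℝ f s) := by
  obtain ⟨h1, f', h2, h3⟩ := h
  exact h3.congr fun x hx => (h2 x hx).fderivWithin (hu x hx)

lemma C2b.fderivW {β : ℝ} {s : Set E} (hu : UniqueDiffOn ℝ s) {f : E → F} (h : C2b β s f) :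
    C1b β s (fderivWithin ℝ f s) := by
  obtain ⟨h1, f', h2, h3⟩ := h
  exact h3.congr fun x hx => (h2 x hx).fderivWithin (hu x hx)

lemma C1b.contDiffOn {β : ℝ} (hβ : 0 < β) {s : Set E} (hu : UniqueDiffOn ℝ s) {f : E → F} (h : C1b β s f) :
    ContDiffOn ℝ 1 f s := by
  have h3 := h.fderivW hu
  obtain ⟨h1, f', h2, -⟩ := h
  have : ContDiffOn ℝ (0+1) f s := by
    rw [contDiffOn_succ_iff_fderivWithin hu]
    refine ⟨fun x hx => (h2 x hx).differentiableWithinAt, by simp, ?_⟩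
    exact contDiffOn_zero.2 (h3.continuousOn hβ)
  simpa using this

lemma C2b.contDiffOn {β : ℝ} (hβ : 0 < β) {s : Set E} (hu : UniqueDiffOn ℝ s) {f : E → F} (h : C2b β s f) :
    ContDiffOn ℝ 2 f s := by
  have h3 := h.fderivW hu
  obtain ⟨h1, f', h2, -⟩ := h
  have : ContDiffOn ℝ (1+1) f s := by
    rw [contDiffOn_succ_iff_fderivWithin hu]
    refine ⟨fun x hx => (h2 x hx).differentiableWithinAt, by simp, ?_⟩
    exact h3.contDiffOn hβ hu
  simpa [one_add_one_eq_two] using this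

lemma C1b.iter {β : ℝ} {s : Set E} (hu : UniqueDiffOn ℝ s) {f : E → F} (h : C1b β s f) :
    Hb β s (iteratedFDerivWithin ℝ 1 f s) := by
  rw [iteratedFDerivWithin_succ_eq_comp_left]
  have h0 : C1b β s (iteratedFDerivWithin ℝ 0 f s) :=
    h.clm (((continuousMultilinearCurryFin0 ℝ E F).symm.toContinuousLinearEquiv) : F →L[ℝ] ContinuousMultilinearMap ℝ (fun _ : Fin 0 => E) F)
  have h1 := (h0.fderivW hu).clm (((continuousMultilinearCurryLeftEquiv ℝ (fun _ : Fin (0+1) => E) F).symm.toContinuousLinearEquiv).toContinuousLinearMap)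
  exact h1

lemma C2b.iter1 {β : ℝ} {s : Set E} (hu : UniqueDiffOn ℝ s) {f : E → F} (h : C2b β s f) :
    C1b β s (iteratedFDerivWithin ℝ 1 f s) := by
  rw [iteratedFDerivWithin_succ_eq_comp_left]
  have h0 : C2b β s (iteratedFDerivWithin ℝ 0 f s) :=
    h.clm (((continuousMultilinearCurryFin0 ℝ E F).symm.toContinuousLinearEquiv) : F →L[ℝ] ContinuousMultilinearMap ℝ (fun _ : Fin 0 => E) F)
  have h1 := (h0.fderivW hu).clm (((continuousMultilinearCurryLeftEquiv ℝ (fun _ : Fin (0+1) => E) F).symm.toContinuousLinearEquiv).toContinuousLinearMap)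
  exact h1

lemma C2b.iter {β : ℝ} {s : Set E} (hu : UniqueDiffOn ℝ s) {f : E → F} (h : C2b β s f) :
    Hb β s (iteratedFDerivWithin ℝ 2 f s) := by
  rw [iteratedFDerivWithin_succ_eq_comp_left]
  have h1 := ((h.iter1 hu).fderivW hu).clm (((continuousMultilinearCurryLeftEquiv ℝ (fun _ : Fin (1+1) => E) F).symm.toContinuousLinearEquiv).toContinuousLinearMap)
  exact h1

end classes
end

open MeasureTheory Real Set Filter
open scoped ENNReal NNReal ComplexConjugate
noncomputable section

section lim
variable {E F : Type} [NormedAddCommGroup E] [NormedSpace ℝ E]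
  [NormedAddCommGroup F] [NormedSpace ℝ F]

lemma lim_c1 {s : Set E} (hs : Convex ℝ s) {β K : ℝ} (hβ : 0 < β) (hK : 0 ≤ K) {l : Filter ℕ} [NeBot l]
    {g : ℕ → E → F} {g' : ℕ → E → E →L[ℝ] F} {G : E → F} {G' : E → E →L[ℝ] F}
    (hd : ∀ n, ∀ x ∈ s, HasFDerivWithinAt (g n) (g' n x) s x)
    (hh : ∀ n, ∀ x ∈ s, ∀ y ∈ s, ‖g' n x - g' n y‖ ≤ K * ‖x - y‖ ^ β)
    (hg : ∀ x ∈ s, Tendsto (fun n => g n x) l (nhds (G x)))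
    (hg' : ∀ x ∈ s, Tendsto (fun n => g' n x) l (nhds (G' x))) :
    ∀ x ∈ s, HasFDerivWithinAt G (G' x) s x := by
  intro x hx
  have key : ∀ y ∈ s, ‖G y - G x - G' x (y - x)‖ ≤ K * ‖y - x‖ ^ β * ‖y - x‖ := by
    intro y hy
    have h1 : ∀ n, ‖g n y - g n x - g' n x (y - x)‖ ≤ K * ‖y - x‖ ^ β * ‖y - x‖ := by
      intro n
      have hseg : segment ℝ x y ⊆ s := hs.segment_subset hx hy
      refine Convex.norm_image_sub_le_of_norm_hasFDerivWithin_le' (s := segment ℝ x y) (f' := g' n)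
        (fun z hz => (hd n z (hseg hz)).mono hseg) ?_ (convex_segment x y) (left_mem_segment ℝ x y)
        (right_mem_segment ℝ x y)
      intro z hz
      refine (hh n z (hseg hz) x hx).trans ?_
      have : ‖z - x‖ ≤ ‖y - x‖ := by
        obtain ⟨t, ht, rfl⟩ := (segment_eq_image' ℝ x y) ▸ hz
        simp only [add_sub_cancel_left, norm_smul, Real.norm_eq_abs, abs_of_nonneg ht.1]
        exact mul_le_of_le_one_left (norm_nonneg _) ht.2
      gcongr
    refine le_of_tendsto (x := l) ?_ (Eventually.of_forall h1)
    refine Tendsto.norm (((hg y hy).sub (hg x hx)).sub ?_)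
    exact ((ContinuousLinearMap.apply ℝ F (y - x)).continuous.tendsto _).comp (hg' x hx)
  rw [hasFDerivWithinAt_iff_isLittleO, Asymptotics.isLittleO_iff]
  intro c hc
  have : Tendsto (fun y => K * ‖y - x‖ ^ β) (nhdsWithin x s) (nhds 0) := by
    have : ContinuousWithinAt (fun y => K * ‖y - x‖ ^ β) s x := by
      apply ContinuousWithinAt.mul continuousWithinAt_const
      apply ContinuousWithinAt.rpow_const
      · fun_prop
      · right; exact hβ.le
    simpa [ContinuousWithinAt, hβ.ne'] using this
  filter_upwards [self_mem_nhdsWithin, this.eventually (gt_mem_nhds hc)] with y hy hy2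
  exact (key y hy).trans (by gcongr)
end lim

lemma ultra_lim {g : ℕ → ℂ} {K : ℝ} (h : ∀ n, ‖g n‖ ≤ K) :
    ∃ c : ℂ, Tendsto g (hyperfilter ℕ) (nhds c) := by
  have := (isCompact_closedBall (0:ℂ) K).ultrafilter_le_nhds ((hyperfilter ℕ).map g) (by
    rw [Ultrafilter.coe_map, le_principal_iff, mem_map]
    exact Filter.univ_mem' (fun n => by simpa using h n))
  obtain ⟨c, -, hc⟩ := this
  exact ⟨c, hc⟩

lemma HB_lim {g : ℕ → ℂ → ℂ} {β K : ℝ} (h : ∀ n, HB β K (g n)) :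
    ∃ G : ℂ → ℂ, HB β K G ∧ ∀ z, ‖z‖ ≤ 1 → Tendsto (fun n => g n z) (hyperfilter ℕ) (nhds (G z)) := by
  have : ∀ z, ∃ c, ‖z‖ ≤ 1 → Tendsto (fun n => g n z) (hyperfilter ℕ) (nhds c) := by
    intro z
    by_cases hz : ‖z‖ ≤ 1
    · obtain ⟨c, hc⟩ := ultra_lim (fun n => (h n).1 z hz)
      exact ⟨c, fun _ => hc⟩
    · exact ⟨0, fun h => absurd h hz⟩
  choose G hG using this
  refine ⟨G, ⟨fun z hz => ?_, fun z w hz hw => ?_⟩, hG⟩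
  · exact le_of_tendsto (hG z hz).norm (Eventually.of_forall fun n => (h n).1 z hz)
  · exact le_of_tendsto ((hG z hz).sub (hG w hw)).norm (Eventually.of_forall fun n => (h n).2 z w hz hw)

def Dk : Set ℂ := Metric.closedBall 0 1
lemma mem_Dk {z : ℂ} : z ∈ Dk ↔ ‖z‖ ≤ 1 := by simp [Dk]

lemma HB.toHb {β K : ℝ} {g : ℂ → ℂ} (h : HB β K g) : Hb β Dk g :=
  ⟨K, h.nonneg, fun z hz => h.1 z (mem_Dk.1 hz), fun z hz w hw => h.2 z w (mem_Dk.1 hz) (mem_Dk.1 hw)⟩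

def wL : ℂ × ℂ →L[ℝ] (ℂ →L[ℝ] ℂ) :=
  LinearMap.mkContinuous (σ := RingHom.id ℝ)
    { toFun := fun p => wcl p.1 p.2
      map_add' := fun p q => by ext v; simp [wcl_apply]; ring
      map_smul' := fun c p => by ext v; simp [wcl_apply]; ring }
    2 (fun p => by
      have := wcl_norm p.1 p.2
      have h1 := norm_fst_le p
      have h2 := norm_snd_le p
      show ‖wcl p.1 p.2‖ ≤ _
      linarith)

lemma wL_apply (p q : ℂ) : wL (p, q) = wcl p q := rfl

lemma wcl_sub (p q p' q' : ℂ) : wcl p q - wcl p' q' = wcl (p - p') (q - q') := by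
  ext v; simp [wcl_apply]; ring

lemma Hb_wcl {β : ℝ} {s : Set ℂ} {p q : ℂ → ℂ} (hp : Hb β s p) (hq : Hb β s q) :
    Hb β s (fun z => wcl (p z) (q z)) := by
  have h := ((hp.clm (ContinuousLinearMap.inl ℝ ℂ ℂ)).add (hq.clm (ContinuousLinearMap.inr ℝ ℂ ℂ))).clm wL
  exact h.congr (fun z _ => by simp [← wL_apply])

lemma C1b_wcl {β : ℝ} {s : Set ℂ} {p q : ℂ → ℂ} (hp : C1b β s p) (hq : C1b β s q) :
    C1b β s (fun z => wcl (p z) (q z)) := by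
  have h := ((hp.clm (ContinuousLinearMap.inl ℝ ℂ ℂ)).add (hq.clm (ContinuousLinearMap.inr ℝ ℂ ℂ))).clm wL
  exact h.congr (fun z _ => by simp [← wL_apply])

lemma wcl_tendsto {p q : ℕ → ℂ} {P Q : ℂ} {l : Filter ℕ} (hp : Tendsto p l (nhds P)) (hq : Tendsto q l (nhds Q)) :
    Tendsto (fun n => wcl (p n) (q n)) l (nhds (wcl P Q)) := by
  have h1 : Tendsto (fun n => (p n, q n)) l (nhds (P, Q)) := hp.prodMk_nhds hq
  have h2 := (wL.continuous.tendsto (P, Q)).comp h1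
  simp only [← wL_apply]
  exact h2

lemma Dk_convex : Convex ℝ Dk := convex_closedBall _ _
lemma Dk_compact : IsCompact Dk := isCompact_closedBall _ _

/-- `C¹` limit for polynomials -/
lemma poly_lim {β K : ℝ} (hβ : 0 < β) {P : ℕ → P2} {G G0 G1 : ℂ → ℂ}
    (h0 : ∀ n, HB β K (ev (pd0 (P n)))) (h1 : ∀ n, HB β K (ev (pd1 (P n))))
    (t : ∀ z, ‖z‖ ≤ 1 → Tendsto (fun n => ev (P n) z) (hyperfilter ℕ) (nhds (G z)))
    (t0 : ∀ z, ‖z‖ ≤ 1 → Tendsto (fun n => ev (pd0 (P n)) z) (hyperfilter ℕ) (nhds (G0 z)))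
    (t1 : ∀ z, ‖z‖ ≤ 1 → Tendsto (fun n => ev (pd1 (P n)) z) (hyperfilter ℕ) (nhds (G1 z))) :
    ∀ z ∈ Dk, HasFDerivWithinAt G (wcl (G0 z) (G1 z)) Dk z := by
  have hK := (h0 0).nonneg
  refine lim_c1 Dk_convex (β := β) (K := K + K) hβ (by positivity) (l := hyperfilter ℕ)
    (g := fun n => ev (P n)) (g' := fun n z => wcl (ev (pd0 (P n)) z) (ev (pd1 (P n)) z))
    (fun n z _ => (ev_hasFDerivAt (P n) z).hasFDerivWithinAt) ?_ (fun z hz => t z (mem_Dk.1 hz))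
    (fun z hz => wcl_tendsto (t0 z (mem_Dk.1 hz)) (t1 z (mem_Dk.1 hz)))
  intro n z hz w hw
  rw [wcl_sub, add_mul]
  exact (wcl_norm _ _).trans (add_le_add ((h0 n).2 z w (mem_Dk.1 hz) (mem_Dk.1 hw))
    ((h1 n).2 z w (mem_Dk.1 hz) (mem_Dk.1 hw)))

def Cmp (f u : ℂ → ℝ) : Prop := ∀ ε > 0, ∃ δ > 0, ∀ F U : P2, Idl U →
  pd0 (pd1 U) = MvPolynomial.C (-1/4) * F → (∀ z, ‖z‖ ≤ 1 → |f z - (ev F z).re| ≤ δ) →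
  ∀ z, ‖z‖ ≤ 1 → |u z - (ev U z).re| ≤ ε

lemma cmp_tendsto {u : ℂ → ℝ} {U : ℕ → P2}
    (h : ∀ n z, ‖z‖ ≤ 1 → |u z - (ev (U n) z).re| ≤ 1 / ((n:ℝ) + 1)) (z : ℂ) (hz : ‖z‖ ≤ 1) :
    Tendsto (fun n => (ev (U n) z).re) atTop (nhds (u z)) := by
  rw [tendsto_iff_norm_sub_tendsto_zero]
  refine squeeze_zero (fun _ => norm_nonneg _) (fun n => ?_) tendsto_one_div_add_atTop_nhds_zero_nat
  rw [Real.norm_eq_abs, abs_sub_comm]; exact h n z hz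

lemma re_err {f : ℝ} {w : ℂ} {δ : ℝ} (h : ‖w - (f:ℂ)‖ ≤ δ) : |f - w.re| ≤ δ := by
  have := (Complex.abs_re_le_norm (w - f)).trans h
  rw [abs_sub_comm]; simpa using this

lemma disk1 {f u : ℂ → ℝ} (hf : ContinuousOn f Dk) (hc : Cmp f u) :
    ∃ L : ℝ, ∀ z ∈ Dk, ∀ w ∈ Dk, |u z - u w| ≤ L * ‖z - w‖ := by
  obtain ⟨C, hC, hest⟩ := est1 (β := 1/2) (by norm_num) (by norm_num)
  obtain ⟨B, hB⟩ := Dk_compact.exists_bound_of_continuousOn hf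
  have : ∀ n : ℕ, ∃ U : P2, (∀ z, ‖z‖ ≤ 1 → |u z - (ev U z).re| ≤ 1 / ((n:ℝ) + 1)) ∧
      (∀ z, ‖z‖ ≤ 1 → ‖ev (pd0 U) z‖ ≤ C * (B + 1)) ∧ (∀ z, ‖z‖ ≤ 1 → ‖ev (pd1 U) z‖ ≤ C * (B + 1)) := by
    intro n
    obtain ⟨δ, hδ, h⟩ := hc (1 / ((n:ℝ)+1)) (by positivity)
    obtain ⟨F, hF⟩ := cont_approx (f := f) (ε := min δ 1) hf (by positivity)
    obtain ⟨U, hU, hU2⟩ := solve_poly (MvPolynomial.C (-1/4) * F)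
    have := hest U (B+1) hU (fun z hz => by
      rw [hU2, ev_mul, ev_C, norm_mul]
      have h1 := hF z hz
      have h2 := hB z (mem_Dk.2 hz)
      have h3 : ‖ev F z‖ ≤ B + 1 := by
        calc ‖ev F z‖ = ‖(f z : ℂ) + (ev F z - f z)‖ := by congr 1; ring
          _ ≤ ‖(f z : ℂ)‖ + ‖ev F z - f z‖ := norm_add_le _ _
          _ ≤ B + 1 := add_le_add (by rw [Complex.norm_real]; exact h2) (h1.trans (min_le_right _ _))
      have h4 : ‖(-1/4 : ℂ)‖ ≤ 1 := by norm_num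
      nlinarith [norm_nonneg (ev F z)])
    exact ⟨U, h F U hU hU2 (fun z hz => re_err ((hF z hz).trans (min_le_left _ _))), this.1.1, this.2.1⟩
  choose U hU1 hU2 hU3 using this
  refine ⟨2 * (C * (B+1)), fun z hz w hw => ?_⟩
  have t := ((cmp_tendsto hU1 z (mem_Dk.1 hz)).sub (cmp_tendsto hU1 w (mem_Dk.1 hw))).abs
  refine le_of_tendsto t (Eventually.of_forall fun n => ?_)
  rw [← Complex.sub_re]
  refine (Complex.abs_re_le_norm _).trans ?_
  exact ev_lip (hU2 n) (hU3 n) _ _ (mem_Dk.1 hz) (mem_Dk.1 hw)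

lemma disk2 {f u : ℂ → ℝ} {L : ℝ} (hf : ∀ z ∈ Dk, ∀ w ∈ Dk, |f z - f w| ≤ L * ‖z - w‖) (hc : Cmp f u)
    {β : ℝ} (hβ0 : 0 < β) (hβ1 : β < 1) : C2b β Dk u := by
  obtain ⟨C, hC, hest⟩ := est2 hβ0 hβ1
  have hLip : LipschitzOnWith (Real.toNNReal L) f Dk := by
    apply LipschitzOnWith.of_dist_le_mul
    intro z hz w hw
    rw [Real.dist_eq, dist_eq_norm]
    exact (hf z hz w hw).trans (by gcongr; exact Real.le_coe_toNNReal L)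
  obtain ⟨g, hg, hgf⟩ := hLip.extend_real
  obtain ⟨B, hB⟩ := Dk_compact.exists_bound_of_continuousOn hLip.continuousOn
  set Λ : ℝ := (Real.toNNReal L : ℝ)
  have hΛ : 0 ≤ Λ := NNReal.coe_nonneg _
  have hB0 : 0 ≤ B := (norm_nonneg _).trans (hB 0 (by simp [mem_Dk]))
  set M := B + 1 + Λ
  have : ∀ n : ℕ, ∃ U : P2, (∀ z, ‖z‖ ≤ 1 → |u z - (ev U z).re| ≤ 1 / ((n:ℝ) + 1)) ∧
      HB β (C*M) (ev (pd0 U)) ∧ HB β (C*M) (ev (pd1 U)) ∧ HB β (C*M) (ev (pd0 (pd0 U))) ∧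
      HB β (C*M) (ev (pd0 (pd1 U))) ∧ HB β (C*M) (ev (pd1 (pd0 U))) ∧ HB β (C*M) (ev (pd1 (pd1 U))) := by
    intro n
    obtain ⟨δ, hδ, h⟩ := hc (1 / ((n:ℝ)+1)) (by positivity)
    obtain ⟨F, hF, hF0, hF1⟩ := lip_approx (f := g) (L := Λ) (ε := min δ 1) hΛ
      (fun z w => by have := hg.dist_le_mul z w; rwa [Real.dist_eq, dist_eq_norm] at this) (by positivity)
    obtain ⟨U, hU, hU2⟩ := solve_poly (MvPolynomial.C (-1/4) * F)
    have h4 : ‖(-1/4 : ℂ)‖ ≤ 1 := by norm_num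
    have d : ∀ i, MvPolynomial.pderiv i (MvPolynomial.C (-1/4) * F) = MvPolynomial.C (-1/4) * MvPolynomial.pderiv i F := by
      intro i; rw [MvPolynomial.pderiv_C_mul]
    have := hest U M hU (fun z hz => by
      rw [hU2, ev_mul, ev_C, norm_mul]
      have h1 := hF z hz
      have h2 := hB z (mem_Dk.2 hz)
      have h3 : ‖ev F z‖ ≤ B + 1 := by
        calc ‖ev F z‖ = ‖(g z : ℂ) + (ev F z - g z)‖ := by congr 1; ring
          _ ≤ ‖(g z : ℂ)‖ + ‖ev F z - g z‖ := norm_add_le _ _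
          _ ≤ B + 1 := add_le_add (by rw [Complex.norm_real]; exact (hgf (mem_Dk.2 hz)) ▸ (hB z (mem_Dk.2 hz))) (h1.trans (min_le_right _ _))
      nlinarith [norm_nonneg (ev F z)]) (fun z hz => by
      rw [hU2, pd0, d, ev_mul, ev_C, norm_mul]
      have := hF0 z hz
      nlinarith [norm_nonneg (ev (pd0 F) z)]) (fun z hz => by
      rw [hU2, pd1, d, ev_mul, ev_C, norm_mul]
      have := hF1 z hz
      nlinarith [norm_nonneg (ev (pd1 F) z)])
    refine ⟨U, h F U hU hU2 (fun z hz => ?_), this⟩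
    rw [hgf (mem_Dk.2 hz)]
    exact re_err ((hF z hz).trans (min_le_left _ _))
  choose U hU1 k0 k1 k00 k01 k10 k11 using this
  obtain ⟨G0, H0, T0⟩ := HB_lim k0
  obtain ⟨G1, H1, T1⟩ := HB_lim k1
  obtain ⟨G00, H00, T00⟩ := HB_lim k00
  obtain ⟨G01, H01, T01⟩ := HB_lim k01
  obtain ⟨G10, H10, T10⟩ := HB_lim k10
  obtain ⟨G11, H11, T11⟩ := HB_lim k11
  have c0 : C1b β Dk G0 := ⟨H0.toHb, _, poly_lim hβ0 k00 k10 T0 T00 T10, Hb_wcl H00.toHb H10.toHb⟩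
  have c1 : C1b β Dk G1 := ⟨H1.toHb, _, poly_lim hβ0 k01 k11 T1 T01 T11, Hb_wcl H01.toHb H11.toHb⟩
  have c2 := (C1b_wcl c0 c1).clm (ContinuousLinearMap.compL ℝ ℂ ℂ ℝ Complex.reCLM)
  have du : ∀ z ∈ Dk, HasFDerivWithinAt u (Complex.reCLM.comp (wcl (G0 z) (G1 z))) Dk z := by
    refine lim_c1 Dk_convex (β := β) (K := 2*(C*M)) hβ0 (by positivity) (l := hyperfilter ℕ)
      (g := fun n z => (ev (U n) z).re)
      (g' := fun n z => Complex.reCLM.comp (wcl (ev (pd0 (U n)) z) (ev (pd1 (U n)) z)))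
      (fun n z _ => (Complex.reCLM.hasFDerivAt.comp z (ev_hasFDerivAt (U n) z)).hasFDerivWithinAt) ?_ 
      (fun z hz => (cmp_tendsto hU1 z (mem_Dk.1 hz)).mono_left (Nat.hyperfilter_le_atTop))
      (fun z hz => ((ContinuousLinearMap.compL ℝ ℂ ℂ ℝ Complex.reCLM).continuous.tendsto _).comp 
        (wcl_tendsto (T0 z (mem_Dk.1 hz)) (T1 z (mem_Dk.1 hz))))
    intro n z hz w hw
    rw [← ContinuousLinearMap.comp_sub, wcl_sub]
    refine (ContinuousLinearMap.opNorm_comp_le _ _).trans ?_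
    rw [Complex.reCLM_norm, one_mul, two_mul, add_mul]
    exact (wcl_norm _ _).trans (add_le_add ((k0 n).2 z w (mem_Dk.1 hz) (mem_Dk.1 hw))
      ((k1 n).2 z w (mem_Dk.1 hz) (mem_Dk.1 hw)))
  refine ⟨?_, _, du, c2⟩
  obtain ⟨K, hK0, hK, -⟩ := c2.1
  refine Hb_of_lip hβ0 hβ1 Dk_compact (L := K) (fun x hx y hy => ?_)
  exact Dk_convex.norm_image_sub_le_of_norm_hasFDerivWithin_le du hK hy hx

end

open MeasureTheory Real Set Filter
open scoped ENNReal NNReal ComplexConjugate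
noncomputable section

lemma pd_contDiffOn {O : Set R3} (hO : IsOpen O) {n m : ℕ∞} {f : R3 → ℝ} (hf : ContDiffOn ℝ m f O)
    (hn : n + 1 ≤ m) (i : Fin 3) : ContDiffOn ℝ n (pd f i) O := by
  have h1 : ContDiffOn ℝ n (fderiv ℝ f) O := hf.fderiv_of_isOpen hO (by exact_mod_cast hn)
  exact h1.clm_apply contDiffOn_const

lemma pd_hasDerivAt {h : R3 → ℝ} {x : R3} {i : Fin 3} {t : ℝ}
    (hd : DifferentiableAt ℝ h (x + t • Pi.single i 1)) :
    HasDerivAt (fun t : ℝ => h (x + t • (Pi.single i 1 : R3))) (pd h i (x + t • Pi.single i 1)) t := by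
  have h1 : HasDerivAt (fun t : ℝ => x + t • (Pi.single i 1 : R3)) (Pi.single i 1) t := by
    simpa using ((hasDerivAt_id t).smul_const (Pi.single i 1 : R3)).const_add x
  exact hd.hasFDerivAt.comp_hasDerivAt t h1

lemma pd2_nonpos {O : Set R3} (hO : IsOpen O) {h : R3 → ℝ} {x : R3} (hx : x ∈ O) (hc : ContDiffOn ℝ 2 h O)
    (hm : IsLocalMax h x) (i : Fin 3) : pd (pd h i) i x ≤ 0 := by
  set L : ℝ → R3 := fun t => x + t • (Pi.single i 1 : R3) with hL
  have hLc : Continuous L := by fun_prop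
  have hL0 : L 0 = x := by simp [hL]
  set g : ℝ → ℝ := fun t => h (L t) with hg
  have hnear : ∀ᶠ t in nhds (0:ℝ), L t ∈ O := hLc.continuousAt.eventually (by rw [hL0]; exact hO.mem_nhds hx)
  have hd : ∀ y ∈ O, DifferentiableAt ℝ h y := fun y hy =>
    ((hc.differentiableOn (by norm_num)) y hy).differentiableAt (hO.mem_nhds hy)
  have hpd : ContDiffOn ℝ 1 (pd h i) O := pd_contDiffOn hO (m := 2) (n := 1) hc (by norm_num) i
  have e1 : deriv g =ᶠ[nhds 0] fun t => pd h i (L t) := by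
    filter_upwards [hnear] with t ht
    exact (pd_hasDerivAt (hd _ ht)).deriv
  have e2 : deriv (deriv g) 0 = pd (pd h i) i x := by
    rw [e1.deriv_eq]
    have := pd_hasDerivAt (h := pd h i) (x := x) (i := i) (t := 0) (by
      rw [show x + (0:ℝ) • (Pi.single i 1 : R3) = x by simp]
      exact ((hpd.differentiableOn (by norm_num)) x hx).differentiableAt (hO.mem_nhds hx))
    rw [show x + (0:ℝ) • (Pi.single i 1 : R3) = x by simp] at this
    exact this.deriv
  have hgm : IsLocalMax g 0 := by
    have : Tendsto L (nhds 0) (nhds x) := by rw [← hL0]; exact hLc.continuousAt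
    have := this.eventually hm
    filter_upwards [this] with t ht
    simpa [hg, hL0] using ht
  have hgc : ContinuousAt g 0 := by
    apply ContinuousAt.comp
    · rw [hL0]; exact (hd x hx).continuousAt
    · exact hLc.continuousAt
  by_contra hcon
  push Not at hcon
  rw [← e2] at hcon
  have hmin := isLocalMin_of_deriv_deriv_pos hcon hgm.deriv_eq_zero hgc
  have hconst : g =ᶠ[nhds 0] fun _ => g 0 := by
    filter_upwards [hmin, hgm] with t h1 h2 using le_antisymm h2 h1
  have h1 : deriv g =ᶠ[nhds 0] fun _ => 0 := by
    have := hconst.deriv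
    simpa using this
  have h2 := h1.deriv_eq
  simp at h2
  linarith

lemma lap_sub' {O : Set R3} (hO : IsOpen O) {f g : R3 → ℝ} (hf : ContDiffOn ℝ 2 f O) (hg : ContDiffOn ℝ 2 g O)
    {x : R3} (hx : x ∈ O) : lap (fun y => f y - g y) x = lap f x - lap g x := by
  have hd : ∀ {f : R3 → ℝ}, ContDiffOn ℝ 2 f O → ∀ y ∈ O, DifferentiableAt ℝ f y := fun hc y hy =>
    ((hc.differentiableOn (by norm_num)) y hy).differentiableAt (hO.mem_nhds hy)
  have hd2 : ∀ {f : R3 → ℝ}, ContDiffOn ℝ 2 f O → ∀ i, DifferentiableAt ℝ (pd f i) x := fun hc i =>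
    (((pd_contDiffOn hO (m := 2) (n := 1) hc (by norm_num) i).differentiableOn (by norm_num)) x hx).differentiableAt (hO.mem_nhds hx)
  simp only [lap]
  rw [← Finset.sum_sub_distrib]
  apply Finset.sum_congr rfl
  intro i _
  have e : pd (fun y => f y - g y) i =ᶠ[nhds x] fun y => pd f i y - pd g i y := by
    filter_upwards [hO.mem_nhds hx] with y hy
    simp only [pd]
    rw [fderiv_fun_sub (hd hf y hy) (hd hg y hy)]; rfl
  rw [pd, e.fderiv_eq, fderiv_fun_sub (hd2 hf i) (hd2 hg i)]; rfl

lemma lap_add' {O : Set R3} (hO : IsOpen O) {f g : R3 → ℝ} (hf : ContDiffOn ℝ 2 f O) (hg : ContDiffOn ℝ 2 g O)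
    {x : R3} (hx : x ∈ O) : lap (fun y => f y + g y) x = lap f x + lap g x := by
  have h1 : lap (fun y => (f y + g y) - g y) x = lap (fun y => f y + g y) x - lap g x :=
    lap_sub' hO (hf.add hg) hg hx
  have : (fun y => (f y + g y) - g y) = f := by ext; ring
  rw [this] at h1
  linarith

lemma lap_continuousOn {O : Set R3} (hO : IsOpen O) {f : R3 → ℝ} (hf : ContDiffOn ℝ 2 f O) :
    ContinuousOn (lap f) O := by
  apply continuousOn_finsetSum
  intro i _
  exact (pd_contDiffOn hO (n := 0) (m := 1) (pd_contDiffOn hO (m := 2) (n := 1) hf (by norm_num) i)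
    (by norm_num) i).continuousOn

abbrev Lf : ℝ →L[ℝ] ℝ →L[ℝ] ℝ := (ContinuousLinearMap.lsmul ℝ ℝ).flip

lemma pd_compact {η : R3 → ℝ} (hc : HasCompactSupport η) (i : Fin 3) : HasCompactSupport (pd η i) := by
  have := hc.fderiv (𝕜 := ℝ)
  exact this.comp_left (g := fun L : R3 →L[ℝ] ℝ => L (Pi.single i 1)) rfl

lemma pd_smooth {η : R3 → ℝ} (hη : ContDiff ℝ (⊤ : ℕ∞) η) (i : Fin 3) : ContDiff ℝ (⊤ : ℕ∞) (pd η i) := by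
  exact (hη.fderiv_right (m := (⊤ : ℕ∞)) (by simp)).clm_apply contDiff_const

lemma pd_conv {g η : R3 → ℝ} (hg : LocallyIntegrable g) (hη : ContDiff ℝ (⊤ : ℕ∞) η) (hc : HasCompactSupport η)
    (i : Fin 3) : pd (convolution g η Lf volume) i = convolution g (pd η i) Lf volume := by
  ext x
  have h1 := hc.hasFDerivAt_convolution_right Lf (μ := volume) hg (hη.of_le (by exact_mod_cast le_top)) x
  rw [pd, h1.fderiv]
  exact convolution_precompR_apply (𝕜 := ℝ) Lf hg (hc.fderiv (𝕜 := ℝ)) (hη.continuous_fderiv (by simp)) x _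

lemma lap_conv {g η : R3 → ℝ} (hg : LocallyIntegrable g) (hη : ContDiff ℝ (⊤ : ℕ∞) η) (hc : HasCompactSupport η)
    (x : R3) : lap (convolution g η Lf volume) x = ∫ t, g t * lap η (x - t) := by
  simp only [lap]
  simp_rw [pd_conv hg hη hc, pd_conv hg (pd_smooth hη _) (pd_compact hc _)]
  simp_rw [Finset.mul_sum]
  rw [integral_finsetSum]
  · apply Finset.sum_congr rfl
    intro i _
    rw [convolution_def]
    congr 1; ext t
    simp [mul_comm]
  · intro i _
    have := (pd_compact (pd_compact hc i) i).convolutionExists_right Lf (μ := volume) hg (pd_smooth (pd_smooth hη i) i).continuous x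
    refine this.congr ?_
    apply Eventually.of_forall; intro t
    simp [mul_comm]

lemma pd_refl {η : R3 → ℝ} (hη : ContDiff ℝ (⊤ : ℕ∞) η) (x t : R3) (i : Fin 3) :
    pd (fun y => η (x - y)) i t = - pd η i (x - t) := by
  have h1 : HasFDerivAt (fun y : R3 => x - y) (-(ContinuousLinearMap.id ℝ R3)) t := by
    simpa using (hasFDerivAt_id (𝕜 := ℝ) t).const_sub x
  have h2 := ((hη.differentiable (by simp)) (x - t)).hasFDerivAt.comp t h1
  have h3 : fderiv ℝ (fun y => η (x - y)) t = (fderiv ℝ η (x - t)).comp (-(ContinuousLinearMap.id ℝ R3)) := h2.fderiv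
  rw [pd, h3]; simp [pd]

lemma lap_refl {η : R3 → ℝ} (hη : ContDiff ℝ (⊤ : ℕ∞) η) (x t : R3) :
    lap (fun y => η (x - y)) t = lap η (x - t) := by
  simp only [lap]
  apply Finset.sum_congr rfl
  intro i _
  have : pd (fun y => η (x - y)) i = fun t => - pd η i (x - t) := by ext t; exact pd_refl hη x t i
  rw [this]
  have h := pd_refl (pd_smooth hη i) x t i
  have : fderiv ℝ (fun y => - pd η i (x - y)) t = - fderiv ℝ (fun y => pd η i (x - y)) t := fderiv_fun_neg
  rw [pd, this]
  have h' : (-fderiv ℝ (fun y => pd η i (x - y)) t) (Pi.single i 1) = - pd (fun y => pd η i (x - y)) i t := rfl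
  rw [h', h, neg_neg]

/-- test-function formulation of `-Δ φ = k` on `O` -/
def DistEq (O : Set R3) (φ k : R3 → ℝ) : Prop :=
  ∀ ψ : R3 → ℝ, ContDiff ℝ (⊤ : ℕ∞) ψ → HasCompactSupport ψ → tsupport ψ ⊆ O →
      -∫ x in O, φ x * lap ψ x = ∫ x in O, k x * ψ x

lemma tsupport_lap_sub {ψ : R3 → ℝ} {x : R3} (h : x ∉ tsupport ψ) : lap ψ x = 0 := by
  have h0 : ψ =ᶠ[nhds x] fun _ => 0 := by
    have := notMem_tsupport_iff_eventuallyEq.1 h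
    exact this
  have h1 : ∀ i, pd ψ i =ᶠ[nhds x] fun _ => 0 := by
    intro i
    filter_upwards [h0.fderiv (𝕜 := ℝ)] with y hy
    rw [pd, hy]; simp
  simp only [lap]
  apply Finset.sum_eq_zero
  intro i _
  rw [pd, (h1 i).fderiv_eq]; simp

end

open MeasureTheory Real Set Filter
open scoped ENNReal NNReal ComplexConjugate
noncomputable section

lemma lap_Q (x0 x : R3) (c : ℝ) : lap (fun y => c * ∑ i, (y i - x0 i)^2) x = 6 * c := by
  have h1 : ∀ i, pd (fun y : R3 => c * ∑ i, (y i - x0 i)^2) i = fun y => 2 * c * (y i - x0 i) := by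
    intro i; ext y
    have : HasFDerivAt (fun y : R3 => c * ∑ i, (y i - x0 i)^2)
        (c • ∑ j, (2 * (y j - x0 j)) • (ContinuousLinearMap.proj j : R3 →L[ℝ] ℝ)) y := by
      apply HasFDerivAt.const_mul
      apply HasFDerivAt.fun_sum
      intro j _
      have := (((ContinuousLinearMap.proj j : R3 →L[ℝ] ℝ).hasFDerivAt (x := y)).sub_const (x0 j)).pow 2
      have e : (2 • ((ContinuousLinearMap.proj j : R3 →L[ℝ] ℝ) y - x0 j) ^ (2 - 1)) = 2 * (y j - x0 j) := by simp
      rw [e] at this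
      exact this
    rw [pd, this.fderiv]
    simp [sum_apply, Pi.single_apply]
    ring
  simp only [lap, h1]
  have h2 : ∀ i : Fin 3, pd (fun y : R3 => 2 * c * (y i - x0 i)) i x = 2 * c := by
    intro i
    have : HasFDerivAt (fun y : R3 => 2 * c * (y i - x0 i)) ((2 * c) • (ContinuousLinearMap.proj i : R3 →L[ℝ] ℝ)) x :=
      (((ContinuousLinearMap.proj i : R3 →L[ℝ] ℝ).hasFDerivAt (x := x)).sub_const (x0 i)).const_mul _
    rw [pd, this.fderiv]; simp
  simp [h2]; ring

lemma visc {Ω : Set R3} (hΩ : IsOpen Ω) {φ k W : R3 → ℝ} (hφ : ContinuousOn φ Ω) (hk : ContinuousOn k Ω)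
    (hD : DistEq Ω φ k) {x0 : R3} (hx0 : x0 ∈ Ω) (hW : ContDiffOn ℝ 2 W Ω)
    (hmax : ∀ x ∈ Ω, φ x - W x ≤ φ x0 - W x0) : 0 ≤ k x0 + lap W x0 := by
  by_contra hcon
  push Not at hcon
  set c := -(k x0 + lap W x0) with hc
  have hc0 : 0 < c := by linarith
  set Q : R3 → ℝ := fun y => (c/24) * ∑ i, (y i - x0 i)^2 with hQ
  have hQs : ContDiff ℝ 2 Q := by
    rw [hQ]; fun_prop
  set W' : R3 → ℝ := fun y => W y + Q y with hW'
  have hW's : ContDiffOn ℝ 2 W' Ω := hW.add hQs.contDiffOn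
  have lapW' : ∀ x ∈ Ω, lap W' x = lap W x + c/4 := by
    intro x hx
    rw [hW', lap_add' hΩ hW hQs.contDiffOn hx, hQ, lap_Q]; ring
  -- radius
  have e1 : ∀ᶠ x in nhds x0, x ∈ Ω ∧ k x < k x0 + c/4 ∧ lap W x < lap W x0 + c/4 := by
    have a1 := (hk.continuousAt (hΩ.mem_nhds hx0)).eventually (gt_mem_nhds (show k x0 < k x0 + c/4 by linarith))
    have a2 := ((lap_continuousOn hΩ hW).continuousAt (hΩ.mem_nhds hx0)).eventually (gt_mem_nhds (show lap W x0 < lap W x0 + c/4 by linarith))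
    filter_upwards [hΩ.mem_nhds hx0, a1, a2] with x h1 h2 h3 using ⟨h1, h2, h3⟩
  obtain ⟨r, hr, hball⟩ := Metric.nhds_basis_closedBall.eventually_iff.1 e1
  set m := (c/24) * (r/2)^2 with hm
  have hm0 : 0 < m := by positivity
  have hcomp : IsCompact (Metric.closedBall x0 r) := isCompact_closedBall x0 r
  have hφB : ContinuousOn φ (Metric.closedBall x0 r) := hφ.mono fun x hx => (hball hx).1
  have huc := hcomp.uniformContinuousOn_of_continuous hφB
  rw [Metric.uniformContinuousOn_iff] at huc
  obtain ⟨δ, hδ, huc⟩ := huc (m/4) (by positivity)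
  set ε := min (δ/2) (r/4) with hε
  have hε0 : 0 < ε := by positivity
  have hεr : ε ≤ r/4 := min_le_right _ _
  have hεδ : ε ≤ δ/2 := min_le_left _ _
  let bump : ContDiffBump (0 : R3) := ⟨ε/2, ε, by positivity, by linarith⟩
  set η : R3 → ℝ := bump.normed volume with hη
  have hηs : ContDiff ℝ (⊤ : ℕ∞) η := bump.contDiff_normed
  have hηc : HasCompactSupport η := bump.hasCompactSupport_normed
  set g : R3 → ℝ := (Metric.closedBall x0 r).indicator φ with hg
  have hgint : Integrable g := by
    rw [hg, integrable_indicator_iff Metric.isClosed_closedBall.measurableSet]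
    exact hφB.integrableOn_compact hcomp
  have hgl : LocallyIntegrable g := hgint.locallyIntegrable
  set φe := convolution g η Lf volume with hφe
  have hφes : ContDiff ℝ 2 φe :=
    hηc.contDiff_convolution_right Lf hgl (hηs.of_le (by exact_mod_cast le_top))
  have happ : ∀ x ∈ Metric.closedBall x0 (r/2), |φe x - φ x| ≤ m/4 := by
    intro x hx
    rw [hφe, convolution_flip, ← Real.dist_eq]
    refine dist_convolution_le (R := ε) (by positivity) ?_ bump.nonneg_normed bump.integral_normed
      hgint.aestronglyMeasurable ?_
    · rw [bump.support_normed_eq]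
    · intro y hy
      rw [Metric.mem_ball] at hy
      rw [Metric.mem_closedBall] at hx
      have hy2 : y ∈ Metric.closedBall x0 r := by
        rw [Metric.mem_closedBall]
        linarith [dist_triangle y x x0]
      have hx2 : x ∈ Metric.closedBall x0 r := by
        rw [Metric.mem_closedBall]; linarith
      rw [hg, indicator_of_mem hy2]
      exact (huc y hy2 x hx2 (by linarith)).le
  have hlap : ∀ x ∈ Metric.closedBall x0 (r/2), -(k x0 + c/4) ≤ lap φe x := by
    intro x hx
    rw [Metric.mem_closedBall] at hx
    set ψ : R3 → ℝ := fun y => η (x - y) with hψ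
    have hψs : ContDiff ℝ (⊤ : ℕ∞) ψ := hηs.comp (contDiff_const.sub contDiff_id)
    have hψ0 : ∀ y, y ∉ Metric.closedBall x ε → ψ y = 0 := by
      intro y hy
      have : x - y ∉ Function.support η := by
        rw [hη, bump.support_normed_eq]
        intro h
        apply hy
        simp only [Metric.mem_ball, dist_zero_right] at h
        rw [Metric.mem_closedBall, dist_comm, dist_eq_norm]; exact h.le
      simpa using this
    have hts : tsupport ψ ⊆ Metric.closedBall x ε :=
      closure_minimal (fun y hy => by by_contra h; exact hy (hψ0 y h)) Metric.isClosed_closedBall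
    have hsub : Metric.closedBall x ε ⊆ Metric.closedBall x0 r := by
      intro y hy
      rw [Metric.mem_closedBall] at *
      linarith [dist_triangle y x x0]
    have hsubΩ : Metric.closedBall x ε ⊆ Ω := fun y hy => (hball (hsub hy)).1
    have hψc : HasCompactSupport ψ :=
      HasCompactSupport.of_support_subset_isCompact (isCompact_closedBall x ε)
        ((subset_tsupport _).trans hts)
    have hd := hD ψ hψs hψc (hts.trans hsubΩ)
    have i1 : lap φe x = ∫ t in Ω, φ t * lap ψ t := by
      rw [hφe, lap_conv hgl hηs hηc, ← integral_indicator hΩ.measurableSet]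
      congr 1; ext t
      rw [← lap_refl hηs x t]
      by_cases ht : t ∈ tsupport ψ
      · have h1 := hts ht
        rw [hg, indicator_of_mem (hsub h1), indicator_of_mem (hsubΩ h1)]
      · rw [tsupport_lap_sub ht]
        by_cases h2 : t ∈ Ω
        · rw [indicator_of_mem h2, tsupport_lap_sub ht]; simp
        · rw [indicator_of_notMem h2]; simp
    have i2 : ∫ t in Ω, k t * ψ t ≤ k x0 + c/4 := by
      have hone : ∫ t, ψ t = 1 := by
        rw [hψ, integral_sub_left_eq_self η volume x]; exact bump.integral_normed
      have hψi : Integrable ψ := hψs.continuous.integrable_of_hasCompactSupport hψc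
      have hkψ : IntegrableOn (fun t => k t * ψ t) Ω := by
        have : IntegrableOn (fun t => k t * ψ t) (Metric.closedBall x ε) := by
          exact ((hk.mono hsubΩ).mul hψs.continuous.continuousOn).integrableOn_compact (isCompact_closedBall x ε)
        have h3 : IntegrableOn (fun t => k t * ψ t) Set.univ := by
          rw [integrableOn_iff_integrable_of_support_subset (s := Metric.closedBall x ε)] at this
          · exact this.integrableOn
          · intro y hy
            by_contra h
            exact hy (by simp [hψ0 y h])
        exact h3.mono_set (subset_univ _)
      calc ∫ t in Ω, k t * ψ t ≤ ∫ t in Ω, (k x0 + c/4) * ψ t := by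
            apply setIntegral_mono_on hkψ (hψi.const_mul _).integrableOn hΩ.measurableSet
            intro t _
            by_cases ht : t ∈ Metric.closedBall x ε
            · have := (hball (hsub ht)).2.1
              have h0 : 0 ≤ ψ t := bump.nonneg_normed _
              nlinarith
            · simp [hψ0 t ht]
        _ = k x0 + c/4 := by
            rw [integral_const_mul, setIntegral_eq_integral_of_forall_compl_eq_zero, hone, mul_one]
            intro t ht
            exact hψ0 t (fun h => ht (hsubΩ h))
    rw [i1]; linarith
  -- max of φe - W
  have hsubr : Metric.closedBall x0 (r/2) ⊆ Metric.closedBall x0 r :=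
    Metric.closedBall_subset_closedBall (by linarith)
  have hcont : ContinuousOn (fun x => φe x - W' x) (Metric.closedBall x0 (r/2)) :=
    hφes.continuous.continuousOn.sub (hW's.continuousOn.mono fun x hx => (hball (hsubr hx)).1)
  obtain ⟨x1, hx1, hx1m⟩ := (isCompact_closedBall x0 (r/2)).exists_isMaxOn ⟨x0, by simp; positivity⟩ hcont
  have hQ0 : Q x0 = 0 := by simp [hQ]
  have h0m := hx1m (show x0 ∈ Metric.closedBall x0 (r/2) by simp; positivity)
  have hx1b : x1 ∈ Metric.ball x0 (r/2) := by
    by_contra hnb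
    have hd1 : r/2 ≤ dist x1 x0 := by simpa using hnb
    have hQ1 : m ≤ Q x1 := by
      simp only [hQ, hm]
      gcongr
      obtain ⟨i, hi⟩ : ∃ i, r/2 ≤ |x1 i - x0 i| := by
        by_contra hno
        push Not at hno
        have := (dist_pi_lt_iff (show 0 < r/2 by positivity) (f := x1) (g := x0)).2 (fun i => by rw [Real.dist_eq]; exact hno i)
        linarith
      calc (r/2)^2 ≤ |x1 i - x0 i|^2 := by gcongr
        _ = (x1 i - x0 i)^2 := sq_abs _
        _ ≤ _ := Finset.single_le_sum (f := fun i => (x1 i - x0 i)^2) (fun i _ => sq_nonneg _) (Finset.mem_univ i)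
    have a1 := abs_le.1 (happ x1 hx1)
    have a2 := abs_le.1 (happ x0 (by simp; positivity))
    have a3 := hmax x1 (hball (hsubr hx1)).1
    simp only [hW', hQ0, mem_ofPred_eq] at h0m
    linarith [a1.1, a1.2, a2.1, a2.2]
  have hloc : IsLocalMax (fun x => φe x - W' x) x1 := by
    filter_upwards [Metric.isOpen_ball.mem_nhds hx1b] with x hx
    exact hx1m (Metric.ball_subset_closedBall hx)
  have hx1Ω := (hball (hsubr hx1)).1
  have hle : lap (fun x => φe x - W' x) x1 ≤ 0 := by
    apply Finset.sum_nonpos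
    intro i _
    exact pd2_nonpos hΩ hx1Ω (hφes.contDiffOn.sub hW's) hloc i
  rw [lap_sub' hΩ hφes.contDiffOn hW's hx1Ω, lapW' x1 hx1Ω] at hle
  have := hlap x1 hx1
  have := (hball (hsubr hx1)).2.2
  linarith

end

open MeasureTheory Real Set Filter
open scoped ENNReal NNReal ComplexConjugate
noncomputable section

lemma ev_contDiff (P : P2) : ContDiff ℝ (⊤ : ℕ∞) (ev P) := by
  have : ev P = fun z => ∑ d ∈ P.support, P.coeff d * ∏ i, (![z, conj z] i) ^ d i := by
    ext z; simp only [ev]; rw [MvPolynomial.eval_eq']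
  rw [this]
  apply ContDiff.sum
  intro d _
  apply contDiff_const.mul
  simp only [Fin.prod_univ_two, Matrix.cons_val_zero, Matrix.cons_val_one]
  have hc : ContDiff ℝ (⊤ : ℕ∞) (fun z : ℂ => conj z) := Complex.conjCLE.contDiff
  exact (contDiff_id.pow _).mul (hc.pow _)

lemma continuous_rad : Continuous rad := by unfold rad; fun_prop

def Pos : Set R3 := {x | 0 < rad x}
lemma isOpen_Pos : IsOpen Pos := isOpen_lt continuous_const continuous_rad

lemma rad_sq (x : R3) : rad x ^ 2 = x 0 ^ 2 + x 1 ^ 2 := Real.sq_sqrt (by positivity)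

def drad (x : R3) : R3 →L[ℝ] ℝ :=
  (x 0 / rad x) • (ContinuousLinearMap.proj 0 : R3 →L[ℝ] ℝ) + (x 1 / rad x) • (ContinuousLinearMap.proj 1 : R3 →L[ℝ] ℝ)

lemma rad_contDiffOn {n : WithTop ℕ∞} : ContDiffOn ℝ n rad Pos := by
  intro x hx
  have hx' : 0 < rad x := hx
  have : 0 < x 0 ^ 2 + x 1 ^ 2 := by rw [← rad_sq]; positivity
  apply ContDiffAt.contDiffWithinAt
  have h : ContDiffAt ℝ n (fun y : R3 => y 0 ^ 2 + y 1 ^ 2) x := by fun_prop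
  exact h.sqrt this.ne'

lemma rad_hasFDerivAt {x : R3} (hx : x ∈ Pos) : HasFDerivAt rad (drad x) x := by
  have hx' : 0 < rad x := hx
  have hp : 0 < x 0 ^ 2 + x 1 ^ 2 := by rw [← rad_sq]; positivity
  have h0 := ((ContinuousLinearMap.proj 0 : R3 →L[ℝ] ℝ).hasFDerivAt (x := x)).pow 2
  have h1 := ((ContinuousLinearMap.proj 1 : R3 →L[ℝ] ℝ).hasFDerivAt (x := x)).pow 2
  have h2 := (h0.add h1).sqrt (by simpa using hp.ne')
  have e : drad x = (1 / (2 * √(((ContinuousLinearMap.proj 0 : R3 →L[ℝ] ℝ) x) ^ 2 + ((ContinuousLinearMap.proj 1 : R3 →L[ℝ] ℝ) x) ^ 2))) •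
      ((2 • (ContinuousLinearMap.proj 0 : R3 →L[ℝ] ℝ) x ^ (2 - 1)) • (ContinuousLinearMap.proj 0 : R3 →L[ℝ] ℝ) +
        (2 • (ContinuousLinearMap.proj 1 : R3 →L[ℝ] ℝ) x ^ (2 - 1)) • (ContinuousLinearMap.proj 1 : R3 →L[ℝ] ℝ)) := by
    have : √(x 0 ^ 2 + x 1 ^ 2) = rad x := rfl
    ext v
    simp only [drad, ContinuousLinearMap.proj_apply, this, add_apply,
      smul_apply, smul_eq_mul, nsmul_eq_mul]
    push_cast
    field_simp
  rw [e]
  exact h2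

def zeta (a : ℝ) (x : R3) : ℂ := ⟨rad x - a, x 2⟩

lemma zeta_eq (a : ℝ) (x : R3) : zeta a x = ((rad x - a : ℝ) : ℂ) + ((x 2 : ℝ) : ℂ) * Complex.I := by
  apply Complex.ext <;> simp [zeta]

def dzeta (x : R3) : R3 →L[ℝ] ℂ :=
  Complex.ofRealCLM.comp (drad x) + Complex.I • Complex.ofRealCLM.comp (ContinuousLinearMap.proj 2 : R3 →L[ℝ] ℝ)

lemma zeta_hasFDerivAt (a : ℝ) {x : R3} (hx : x ∈ Pos) : HasFDerivAt (zeta a) (dzeta x) x := by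
  have e : zeta a = fun x => Complex.ofRealCLM (rad x - a) + Complex.I • Complex.ofRealCLM ((ContinuousLinearMap.proj 2 : R3 →L[ℝ] ℝ) x) := by
    ext y; rw [zeta_eq]; simp [mul_comm]
  rw [e]
  apply HasFDerivAt.add
  · exact Complex.ofRealCLM.hasFDerivAt.comp x ((rad_hasFDerivAt hx).sub_const a)
  · refine HasFDerivAt.fun_const_smul ?_ Complex.I
    exact (Complex.ofRealCLM.comp (ContinuousLinearMap.proj 2 : R3 →L[ℝ] ℝ)).hasFDerivAt

lemma zeta_contDiffOn (a : ℝ) {n : WithTop ℕ∞} : ContDiffOn ℝ n (zeta a) Pos := by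
  have e : zeta a = fun x => Complex.ofRealCLM (rad x - a) + Complex.I • Complex.ofRealCLM (x 2) := by
    ext y; rw [zeta_eq]; simp [mul_comm]
  rw [e]
  apply ContDiffOn.add
  · exact Complex.ofRealCLM.contDiff.comp_contDiffOn (rad_contDiffOn.sub contDiffOn_const)
  · apply ContDiffOn.const_smul
    exact Complex.ofRealCLM.contDiff.comp_contDiffOn (by fun_prop)

def EP (a : ℝ) (P : P2) (x : R3) : ℝ := (ev P (zeta a x)).re

def Dr (P : P2) : P2 := pd0 P + pd1 P
def Ds (P : P2) : P2 := MvPolynomial.C Complex.I * (pd0 P - pd1 P)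

lemma EP_hasFDerivAt (a : ℝ) (P : P2) {x : R3} (hx : x ∈ Pos) :
    HasFDerivAt (EP a P) (EP a (Dr P) x • drad x + EP a (Ds P) x • (ContinuousLinearMap.proj 2 : R3 →L[ℝ] ℝ)) x := by
  have h := Complex.reCLM.hasFDerivAt.comp x ((ev_hasFDerivAt P (zeta a x)).comp x (zeta_hasFDerivAt a hx))
  have e : (EP a (Dr P) x • drad x + EP a (Ds P) x • (ContinuousLinearMap.proj 2 : R3 →L[ℝ] ℝ))
      = Complex.reCLM.comp ((wcl (ev (pd0 P) (zeta a x)) (ev (pd1 P) (zeta a x))).comp (dzeta x)) := by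
    ext v
    simp [EP, Dr, Ds, dzeta, ev_add, ev_mul, ev_sub, ev_C]
    ring
  rw [e]
  exact h

lemma EP_contDiffOn (a : ℝ) (P : P2) : ContDiffOn ℝ 2 (EP a P) Pos := by
  have := (show ContDiff ℝ 2 (ev P) by exact_mod_cast contDiff_infty.1 (ev_contDiff P) 2).comp_contDiffOn (zeta_contDiffOn a (n := 2))
  exact Complex.reCLM.contDiff.comp_contDiffOn this

def qq (x : R3) : ℝ := (√(rad x))⁻¹

lemma qq_contDiffOn {n : WithTop ℕ∞} : ContDiffOn ℝ n qq Pos := by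
  intro x hx
  have hx' : 0 < rad x := hx
  have h1 : ContDiffAt ℝ n rad x := (rad_contDiffOn x hx).contDiffAt (isOpen_Pos.mem_nhds hx)
  exact ((h1.sqrt hx'.ne').inv (by positivity)).contDiffWithinAt

lemma qq_hasFDerivAt {x : R3} (hx : x ∈ Pos) : HasFDerivAt qq ((-(1/2) * qq x / rad x) • drad x) x := by
  have hx' : 0 < rad x := hx
  have hs : 0 < √(rad x) := by positivity
  have hss : √(rad x) * √(rad x) = rad x := Real.mul_self_sqrt hx'.le
  have h1 := (hasDerivAt_inv hs.ne').comp_hasFDerivAt x ((rad_hasFDerivAt hx).sqrt hx'.ne')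
  have h1' : HasFDerivAt qq _ x := h1
  refine h1'.congr_fderiv ?_
  rw [smul_smul]
  congr 1
  simp only [qq]
  have h2 : √(rad x) ^ 2 = rad x := by rw [sq, hss]
  rw [h2]
  field_simp

lemma rinv_hasFDerivAt {x : R3} (hx : x ∈ Pos) : HasFDerivAt (fun y => (rad y)⁻¹) ((-(rad x ^ 2)⁻¹) • drad x) x := by
  have hx' : 0 < rad x := hx
  exact (hasDerivAt_inv hx'.ne').comp_hasFDerivAt x (rad_hasFDerivAt hx)

def wU (a : ℝ) (U : P2) (x : R3) : ℝ := qq x * EP a U x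

lemma wU_contDiffOn (a : ℝ) (U : P2) : ContDiffOn ℝ 2 (wU a U) Pos := qq_contDiffOn.mul (EP_contDiffOn a U)

def TT (a : ℝ) (U : P2) (x : R3) : ℝ := qq x * (EP a (Dr U) x * (rad x)⁻¹ - 1/2 * (EP a U x * ((rad x)⁻¹ * (rad x)⁻¹)))

lemma drad_single (x : R3) (i : Fin 3) : drad x (Pi.single i 1) = ![x 0 / rad x, x 1 / rad x, 0] i := by
  fin_cases i <;> simp [drad, Pi.single_apply]

lemma pd_wU (a : ℝ) (U : P2) {x : R3} (hx : x ∈ Pos) (i : Fin 3) :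
    pd (wU a U) i x = ![x 0 * TT a U x, x 1 * TT a U x, qq x * EP a (Ds U) x] i := by
  have hx' : 0 < rad x := hx
  have h := (qq_hasFDerivAt hx).mul (EP_hasFDerivAt a U hx)
  have h2 : fderiv ℝ (wU a U) x = _ := h.fderiv
  rw [pd, h2]
  simp only [add_apply, smul_apply, smul_eq_mul, drad_single,
    ContinuousLinearMap.proj_apply, TT]
  fin_cases i <;> simp <;> field_simp <;> ring

lemma TT_hasFDerivAt (a : ℝ) (U : P2) {x : R3} (hx : x ∈ Pos) : ∃ c : ℝ,
    HasFDerivAt (TT a U) ((qq x * (EP a (Dr (Dr U)) x / rad x - 2 * EP a (Dr U) x / rad x ^ 2 + 5/4 * EP a U x / rad x ^ 3)) • drad x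
       + c • (ContinuousLinearMap.proj 2 : R3 →L[ℝ] ℝ)) x := by
  have hx' : 0 < rad x := hx
  have h := (qq_hasFDerivAt hx).mul (((EP_hasFDerivAt a (Dr U) hx).mul (rinv_hasFDerivAt hx)).sub
    (((EP_hasFDerivAt a U hx).mul ((rinv_hasFDerivAt hx).mul (rinv_hasFDerivAt hx))).const_mul (1/2)))
  refine ⟨qq x * (EP a (Ds (Dr U)) x * (rad x)⁻¹ - 1/2 * (EP a (Ds U) x * ((rad x)⁻¹ * (rad x)⁻¹))), ?_⟩
  have h3 : HasFDerivAt (TT a U) _ x := h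
  refine h3.congr_fderiv ?_
  ext v
  simp only [add_apply, sub_apply, smul_apply, smul_eq_mul,
    ContinuousLinearMap.proj_apply, Pi.mul_apply, Pi.sub_apply]
  field_simp
  ring

lemma DrDs (a : ℝ) (U F : P2) (h : pd0 (pd1 U) = MvPolynomial.C (-1/4) * F) (x : R3) :
    EP a (Dr (Dr U)) x + EP a (Ds (Ds U)) x = - EP a F x := by
  have hc := pd_comm U
  have e : Dr (Dr U) + Ds (Ds U) = 4 * pd0 (pd1 U) := by
    have hI : (MvPolynomial.C Complex.I : P2) * MvPolynomial.C Complex.I = -1 := by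
      rw [← MvPolynomial.C_mul]; simp
    have h1 : Dr (Dr U) = pd0 (pd0 U) + 2 * pd0 (pd1 U) + pd1 (pd1 U) := by
      simp only [Dr, map_add, hc]; ring
    have h2 : Ds (Ds U) = (MvPolynomial.C Complex.I * MvPolynomial.C Complex.I) * (pd0 (pd0 U) - 2 * pd0 (pd1 U) + pd1 (pd1 U)) := by
      have hC : ∀ (Q : P2), pd0 (MvPolynomial.C Complex.I * Q) = MvPolynomial.C Complex.I * pd0 Q ∧
          pd1 (MvPolynomial.C Complex.I * Q) = MvPolynomial.C Complex.I * pd1 Q := by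
        intro Q
        constructor <;> exact MvPolynomial.pderiv_C_mul
      simp only [Ds, (hC _).1, (hC _).2, map_sub, hc]; ring
    rw [h1, h2, hI]; ring
  have e2 : ev (Dr (Dr U) + Ds (Ds U)) (zeta a x) = - ev F (zeta a x) := by
    rw [e, h, ← mul_assoc]
    have : (4 : P2) * MvPolynomial.C (-1/4) = -1 := by
      have : (4 : P2) = MvPolynomial.C 4 := (map_ofNat MvPolynomial.C 4).symm
      rw [this, ← MvPolynomial.C_mul]; norm_num
    rw [this]; simp
  simp only [EP]
  rw [← Complex.add_re, ← ev_add, e2]; simp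

lemma lap_wU (a : ℝ) (U F : P2) (h : pd0 (pd1 U) = MvPolynomial.C (-1/4) * F) {x : R3} (hx : x ∈ Pos) :
    lap (wU a U) x = qq x * (- EP a F x + EP a U x / (4 * rad x ^ 2)) := by
  have hx' : 0 < rad x := hx
  obtain ⟨c, hT⟩ := TT_hasFDerivAt a U hx
  have e : ∀ i, pd (wU a U) i =ᶠ[nhds x] fun x => ![x 0 * TT a U x, x 1 * TT a U x, qq x * EP a (Ds U) x] i := by
    intro i
    filter_upwards [isOpen_Pos.mem_nhds hx] with y hy using pd_wU a U hy i
  have h0 : pd (pd (wU a U) 0) 0 x = TT a U x + x 0 * (qq x * (EP a (Dr (Dr U)) x / rad x - 2 * EP a (Dr U) x / rad x ^ 2 + 5/4 * EP a U x / rad x ^ 3) * (x 0 / rad x)) := by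
    rw [pd, (e 0).fderiv_eq]
    have h1 := ((ContinuousLinearMap.proj 0 : R3 →L[ℝ] ℝ).hasFDerivAt (x := x)).mul hT
    have h2 : fderiv ℝ (fun x : R3 => ![x 0 * TT a U x, x 1 * TT a U x, qq x * EP a (Ds U) x] 0) x = _ := h1.fderiv
    rw [h2]
    simp [drad_single]; ring
  have h1 : pd (pd (wU a U) 1) 1 x = TT a U x + x 1 * (qq x * (EP a (Dr (Dr U)) x / rad x - 2 * EP a (Dr U) x / rad x ^ 2 + 5/4 * EP a U x / rad x ^ 3) * (x 1 / rad x)) := by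
    rw [pd, (e 1).fderiv_eq]
    have h1 := ((ContinuousLinearMap.proj 1 : R3 →L[ℝ] ℝ).hasFDerivAt (x := x)).mul hT
    have h2 : fderiv ℝ (fun x : R3 => ![x 0 * TT a U x, x 1 * TT a U x, qq x * EP a (Ds U) x] 1) x = _ := h1.fderiv
    rw [h2]
    simp [drad_single]; ring
  have h2 : pd (pd (wU a U) 2) 2 x = qq x * EP a (Ds (Ds U)) x := by
    rw [pd, (e 2).fderiv_eq]
    have h1 := (qq_hasFDerivAt hx).mul (EP_hasFDerivAt a (Ds U) hx)
    have h2 : fderiv ℝ (fun x : R3 => ![x 0 * TT a U x, x 1 * TT a U x, qq x * EP a (Ds U) x] 2) x = _ := h1.fderiv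
    rw [h2]
    simp [drad_single]
  have hs := rad_sq x
  have hD := DrDs a U F h x
  have hF : EP a F x = -(EP a (Dr (Dr U)) x + EP a (Ds (Ds U)) x) := by rw [hD]; ring
  simp only [lap, Fin.sum_univ_three, h0, h1, h2]
  rw [hF]
  have hs' : x 1 ^ 2 = rad x ^ 2 - x 0 ^ 2 := by linarith
  simp only [TT]
  field_simp
  rw [hs']
  ring

end

open MeasureTheory Real Set Filter
open scoped ENNReal NNReal ComplexConjugate
noncomputable section

lemma torus_eq (a : ℝ) : torus a = {x | (a - rad x) ^ 2 + (x 2) ^ 2 < 1} := rfl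

lemma torus_open (a : ℝ) : IsOpen (torus a) := by
  rw [torus_eq]
  have := continuous_rad
  exact isOpen_lt (by fun_prop) continuous_const

lemma cl_le {a : ℝ} {x : R3} (hx : x ∈ closure (torus a)) : (a - rad x) ^ 2 + (x 2) ^ 2 ≤ 1 := by
  have h : closure (torus a) ⊆ {x | (a - rad x) ^ 2 + (x 2) ^ 2 ≤ 1} := by
    apply closure_minimal
    · intro y hy
      have h : (a - rad y) ^ 2 + (y 2) ^ 2 < 1 := hy
      exact h.le
    · have := continuous_rad
      exact isClosed_le (by fun_prop) continuous_const
  exact h hx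

lemma cl_rad {a : ℝ} {x : R3} (hx : x ∈ closure (torus a)) : a - 1 ≤ rad x ∧ rad x ≤ a + 1 := by
  have h := cl_le hx
  constructor <;> nlinarith [sq_nonneg (x 2)]

lemma cl_Pos {a : ℝ} (ha : 1 < a) : closure (torus a) ⊆ Pos := by
  intro x hx
  have := (cl_rad hx).1
  show 0 < rad x
  linarith

lemma rad_nonneg (x : R3) : 0 ≤ rad x := Real.sqrt_nonneg _

lemma cl_compact (a : ℝ) : IsCompact (closure (torus a)) := by
  apply Metric.isCompact_of_isClosed_isBounded isClosed_closure
  rw [Metric.isBounded_iff_subset_closedBall (0 : R3)]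
  refine ⟨|a| + 1, ?_⟩
  intro x hx
  rw [mem_closedBall_zero_iff, pi_norm_le_iff_of_nonneg (by positivity)]
  have h1 := cl_rad hx
  have h2 := cl_le hx
  have h3 := rad_sq x
  have h4 := le_abs_self a
  have h5 := rad_nonneg x
  intro i
  rw [Real.norm_eq_abs]
  fin_cases i
  · exact abs_le_of_sq_le_sq (by simp; nlinarith [sq_nonneg (x 1)]) (by positivity)
  · exact abs_le_of_sq_le_sq (by simp; nlinarith [sq_nonneg (x 0)]) (by positivity)
  · exact abs_le_of_sq_le_sq (by simp; nlinarith [sq_nonneg (a - rad x), abs_nonneg a]) (by positivity)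

lemma cl_front {a : ℝ} {x : R3} (hx : x ∈ closure (torus a)) : x ∈ torus a ∨ x ∈ frontier (torus a) := by
  by_cases h : x ∈ torus a
  · exact Or.inl h
  · right
    rw [(torus_open a).frontier_eq]
    exact ⟨hx, h⟩

lemma norm_sq_zeta (a : ℝ) (x : R3) : ‖zeta a x‖ ^ 2 = (a - rad x) ^ 2 + (x 2) ^ 2 := by
  rw [Complex.sq_norm, Complex.normSq_apply]; simp only [zeta]; ring

lemma front_zeta {a : ℝ} {x : R3} (hx : x ∈ frontier (torus a)) : ‖zeta a x‖ = 1 := by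
  rw [(torus_open a).frontier_eq] at hx
  have h1 := cl_le hx.1
  have h2 : ¬ ((a - rad x) ^ 2 + (x 2) ^ 2 < 1) := hx.2
  have h3 := norm_sq_zeta a x
  have h4 : ‖zeta a x‖ ^ 2 = 1 := by rw [h3]; linarith [not_lt.1 h2]
  nlinarith [norm_nonneg (zeta a x)]

lemma cl_zeta {a : ℝ} {x : R3} (hx : x ∈ closure (torus a)) : ‖zeta a x‖ ≤ 1 := by
  have h1 := cl_le hx
  have h3 := norm_sq_zeta a x
  nlinarith [norm_nonneg (zeta a x)]

/-- the open ball tangent to the torus -/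
def tball (c : R3) : Set R3 := {y | (y 0 - c 0) ^ 2 + (y 1 - c 1) ^ 2 + (y 2 - c 2) ^ 2 < 1}

lemma tball_open (c : R3) : IsOpen (tball c) := isOpen_lt (by fun_prop) continuous_const

lemma tball_convex (c : R3) : Convex ℝ (tball c) := by
  intro y hy z hz s t hs ht hst
  have hy' : (y 0 - c 0) ^ 2 + (y 1 - c 1) ^ 2 + (y 2 - c 2) ^ 2 < 1 := hy
  have hz' : (z 0 - c 0) ^ 2 + (z 1 - c 1) ^ 2 + (z 2 - c 2) ^ 2 < 1 := hz
  have key : ∀ i, ((s • y + t • z) i - c i) ^ 2 ≤ s * (y i - c i) ^ 2 + t * (z i - c i) ^ 2 := by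
    intro i
    simp only [Pi.add_apply, Pi.smul_apply, smul_eq_mul]
    have : t = 1 - s := by linarith
    subst this
    nlinarith [mul_nonneg (mul_nonneg hs ht) (sq_nonneg (y i - z i))]
  show ((s • y + t • z) 0 - c 0) ^ 2 + ((s • y + t • z) 1 - c 1) ^ 2 + ((s • y + t • z) 2 - c 2) ^ 2 < 1
  have h0 := key 0
  have h1 := key 1
  have h2 := key 2
  have h3 : s * ((y 0 - c 0) ^ 2 + (y 1 - c 1) ^ 2 + (y 2 - c 2) ^ 2) + t * ((z 0 - c 0) ^ 2 + (z 1 - c 1) ^ 2 + (z 2 - c 2) ^ 2) < 1 := by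
    rcases hs.eq_or_lt with h | h
    · have : t = 1 := by linarith
      rw [← h, this]; linarith
    · nlinarith
  linarith

lemma tball_sub {a : ℝ} (ha : 0 < a) {c : R3} (hc : rad c = a) (hc2 : c 2 = 0) : tball c ⊆ torus a := by
  intro y hy
  have hy' : (y 0 - c 0) ^ 2 + (y 1 - c 1) ^ 2 + (y 2 - c 2) ^ 2 < 1 := hy
  show (a - rad y) ^ 2 + (y 2) ^ 2 < 1
  have h1 := rad_sq y
  have h2 := rad_sq c
  rw [hc] at h2
  have h3 : y 0 * c 0 + y 1 * c 1 ≤ rad y * a := by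
    apply le_of_sq_le_sq _ (mul_nonneg (rad_nonneg y) ha.le)
    rw [mul_pow, h1, h2]
    nlinarith [sq_nonneg (y 0 * c 1 - y 1 * c 0)]
  rw [hc2] at hy'
  nlinarith

lemma tball_cl {a : ℝ} {x : R3} (hx : 0 < rad x) (ha : 0 < a) (h : (a - rad x) ^ 2 + (x 2) ^ 2 ≤ 1) :
    ∃ c, tball c ⊆ torus a ∧ x ∈ closure (tball c) ∧ c ∈ tball c := by
  set c : R3 := ![a * x 0 / rad x, a * x 1 / rad x, 0] with hc
  have hs := rad_sq x
  have hrc : rad c = a := by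
    have : rad c = √((a * x 0 / rad x) ^ 2 + (a * x 1 / rad x) ^ 2) := by simp [rad, hc]
    rw [this]
    have : (a * x 0 / rad x) ^ 2 + (a * x 1 / rad x) ^ 2 = a ^ 2 := by
      field_simp; rw [← hs]
    rw [this, Real.sqrt_sq ha.le]
  refine ⟨c, tball_sub ha hrc (by simp [hc]), ?_, by simp [tball]⟩
  have hcont : Continuous (fun t : ℝ => c + t • (x - c)) := by fun_prop
  have ht : Tendsto (fun t : ℝ => c + t • (x - c)) (nhdsWithin 1 (Iio 1)) (nhds x) := by
    have := (hcont.tendsto 1).mono_left (nhdsWithin_le_nhds (s := Iio 1))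
    simpa using this
  refine mem_closure_of_tendsto ht ?_
  have h0 : ∀ᶠ t : ℝ in nhdsWithin 1 (Iio 1), 0 < t := nhdsWithin_le_nhds (lt_mem_nhds one_pos)
  filter_upwards [h0, self_mem_nhdsWithin] with t ht0 ht1
  have ht1' : t < 1 := ht1
  have e : (x 0 - c 0) ^ 2 + (x 1 - c 1) ^ 2 + (x 2 - c 2) ^ 2 = (a - rad x) ^ 2 + (x 2) ^ 2 := by
    simp only [hc, Matrix.cons_val_zero, Matrix.cons_val_one, Matrix.cons_val]
    field_simp
    have : x 1 ^ 2 = rad x ^ 2 - x 0 ^ 2 := by linarith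
    ring_nf
    rw [this]; ring
  show ((c + t • (x - c)) 0 - c 0) ^ 2 + ((c + t • (x - c)) 1 - c 1) ^ 2 + ((c + t • (x - c)) 2 - c 2) ^ 2 < 1
  have e2 : ((c + t • (x - c)) 0 - c 0) ^ 2 + ((c + t • (x - c)) 1 - c 1) ^ 2 + ((c + t • (x - c)) 2 - c 2) ^ 2
      = t ^ 2 * ((x 0 - c 0) ^ 2 + (x 1 - c 1) ^ 2 + (x 2 - c 2) ^ 2) := by
    simp only [Pi.add_apply, Pi.smul_apply, smul_eq_mul, Pi.sub_apply]; ring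
  rw [e2, e]
  have : t ^ 2 < 1 := by nlinarith
  nlinarith [sq_nonneg t]

lemma mem_cl {a : ℝ} {x : R3} (hx : 0 < rad x) (ha : 0 < a) (h : (a - rad x) ^ 2 + (x 2) ^ 2 ≤ 1) :
    x ∈ closure (torus a) := by
  obtain ⟨c, h1, h2, -⟩ := tball_cl hx ha h
  exact closure_mono h1 h2

lemma cl_uniqueDiff {a : ℝ} (ha : 1 < a) : UniqueDiffOn ℝ (closure (torus a)) := by
  intro x hx
  obtain ⟨c, h1, h2, h3⟩ := tball_cl (cl_Pos ha hx) (by linarith) (cl_le hx)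
  exact (uniqueDiffWithinAt_convex (tball_convex c) ⟨c, by rw [(tball_open c).interior_eq]; exact h3⟩ h2).mono
    (h1.trans subset_closure)

lemma rot_rep (x : R3) : ∃ β, x = rotZ β ![rad x, 0, x 2] := by
  have hn : ‖(⟨x 0, x 1⟩ : ℂ)‖ = rad x := by
    rw [Complex.norm_def, Complex.normSq_apply, rad]; simp only [sq]
  refine ⟨Complex.arg ⟨x 0, x 1⟩, ?_⟩
  have h1 := Complex.norm_mul_cos_arg ⟨x 0, x 1⟩
  have h2 := Complex.norm_mul_sin_arg ⟨x 0, x 1⟩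
  rw [hn] at h1 h2
  simp only at h1 h2
  ext i
  fin_cases i <;> simp [rotZ]
  · rw [mul_comm, h1]
  · rw [mul_comm, h2]

lemma torSym_rep {f : R3 → ℝ} (hf : torSym f) (x : R3) : f x = f ![rad x, 0, x 2] := by
  obtain ⟨β, hβ⟩ := rot_rep x
  conv_lhs => rw [hβ]
  exact hf β _

lemma qq_pos {x : R3} (hx : x ∈ Pos) : 0 < qq x := by
  have hx' : 0 < rad x := hx
  unfold qq; positivity

lemma wU_front {a : ℝ} {U : P2} (hU : Idl U) {x : R3} (hx : x ∈ frontier (torus a)) : wU a U x = 0 := by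
  simp [wU, EP, Idl_bd hU (front_zeta hx)]

lemma upper {a : ℝ} (ha : 1 < a) {φ k : R3 → ℝ} (hφ : ContinuousOn φ (closure (torus a)))
    (hk : ContinuousOn k (closure (torus a))) (hD : DistEq (torus a) φ k)
    (hb : ∀ x ∈ frontier (torus a), φ x = 0) {U F : P2} (hU : Idl U)
    (hUF : pd0 (pd1 U) = MvPolynomial.C (-1/4) * F) {δ : ℝ} (hδ : 0 ≤ δ)
    (hle : ∀ x ∈ torus a, k x + φ x / (4 * rad x ^ 2) ≤ qq x * (EP a F x + δ)) :
    ∀ x ∈ closure (torus a), φ x - wU a U x ≤ 4 * (a + 1) ^ 2 / √(a - 1) * δ := by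
  have hC : 0 ≤ 4 * (a + 1) ^ 2 / √(a - 1) * δ := by positivity
  rcases (closure (torus a)).eq_empty_or_nonempty with he | hne
  · intro x hx; rw [he] at hx; exact absurd hx (notMem_empty x)
  have hwc : ContinuousOn (wU a U) (closure (torus a)) :=
    (wU_contDiffOn a U).continuousOn.mono (cl_Pos ha)
  obtain ⟨x0, hx0, hmax⟩ := (cl_compact a).exists_isMaxOn hne (hφ.sub hwc)
  intro x hx
  refine le_trans (hmax hx) ?_
  simp only [Pi.sub_apply]
  rcases cl_front hx0 with h | h
  · have hP := cl_Pos ha hx0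
    have hr : 0 < rad x0 := hP
    have hq := qq_pos hP
    have hv := visc (torus_open a) (hφ.mono subset_closure) (hk.mono subset_closure) hD h
      ((wU_contDiffOn a U).mono (subset_closure.trans (cl_Pos ha))) (fun y hy => hmax (subset_closure hy))
    rw [lap_wU a U F hUF hP] at hv
    have h1 := hle x0 h
    have h2 : (φ x0 - wU a U x0) / (4 * rad x0 ^ 2) ≤ qq x0 * δ := by
      have : wU a U x0 / (4 * rad x0 ^ 2) = qq x0 * (EP a U x0 / (4 * rad x0 ^ 2)) := by
        simp only [wU]; ring
      rw [sub_div, this]; linarith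
    rw [div_le_iff₀ (by positivity)] at h2
    refine h2.trans ?_
    have h3 := cl_rad hx0
    have h4 : qq x0 ≤ 1 / √(a - 1) := by
      unfold qq
      rw [one_div]
      apply inv_anti₀ (Real.sqrt_pos.2 (by linarith))
      exact Real.sqrt_le_sqrt h3.1
    have h5 : rad x0 ^ 2 ≤ (a + 1) ^ 2 := by nlinarith
    calc qq x0 * δ * (4 * rad x0 ^ 2) ≤ 1 / √(a - 1) * δ * (4 * (a + 1) ^ 2) := by gcongr
      _ = _ := by ring
  · rw [hb x0 h, wU_front hU h]; simpa using hC

end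

open MeasureTheory Real Set Filter
open scoped ENNReal NNReal ComplexConjugate
noncomputable section

section
variable {E F G : Type} [NormedAddCommGroup E] [NormedSpace ℝ E] [NormedAddCommGroup F] [NormedSpace ℝ F]
  [NormedAddCommGroup G] [NormedSpace ℝ G]

def Lp1 (s : Set E) (f : E → F) : Prop := ∃ L : ℝ, ∀ x ∈ s, ∀ y ∈ s, ‖f x - f y‖ ≤ L * ‖x - y‖

lemma Lp1.nn {s : Set E} {f : E → F} (h : Lp1 s f) : ∃ L : ℝ, 0 ≤ L ∧ ∀ x ∈ s, ∀ y ∈ s, ‖f x - f y‖ ≤ L * ‖x - y‖ := by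
  obtain ⟨L, hL⟩ := h
  refine ⟨|L|, abs_nonneg L, fun x hx y hy => (hL x hx y hy).trans ?_⟩
  gcongr; exact le_abs_self L

lemma Lp1.congr {s : Set E} {f g : E → F} (h : Lp1 s f) (e : ∀ x ∈ s, g x = f x) : Lp1 s g := by
  obtain ⟨L, hL⟩ := h
  exact ⟨L, fun x hx y hy => by rw [e x hx, e y hy]; exact hL x hx y hy⟩

lemma Lp1.continuousOn {s : Set E} {f : E → F} (h : Lp1 s f) : ContinuousOn f s := by
  obtain ⟨L, hL0, hL⟩ := h.nn
  have : LipschitzOnWith (Real.toNNReal L) f s := by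
    apply LipschitzOnWith.of_dist_le_mul
    intro x hx y hy
    rw [dist_eq_norm, dist_eq_norm, Real.coe_toNNReal _ hL0]
    exact hL x hx y hy
  exact this.continuousOn

lemma Lp1.add {s : Set E} {f g : E → F} (hf : Lp1 s f) (hg : Lp1 s g) : Lp1 s (fun x => f x + g x) := by
  obtain ⟨L, hL⟩ := hf
  obtain ⟨M, hM⟩ := hg
  refine ⟨L + M, fun x hx y hy => ?_⟩
  calc ‖f x + g x - (f y + g y)‖ = ‖(f x - f y) + (g x - g y)‖ := by congr 1; abel
    _ ≤ ‖f x - f y‖ + ‖g x - g y‖ := norm_add_le _ _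
    _ ≤ L * ‖x - y‖ + M * ‖x - y‖ := add_le_add (hL x hx y hy) (hM x hx y hy)
    _ = _ := by ring

lemma Lp1.neg {s : Set E} {f : E → F} (hf : Lp1 s f) : Lp1 s (fun x => - f x) := by
  obtain ⟨L, hL⟩ := hf
  refine ⟨L, fun x hx y hy => ?_⟩
  rw [← neg_add', norm_neg, ← sub_eq_add_neg]; exact hL x hx y hy

lemma Lp1.mul {s : Set E} (hs : IsCompact s) {f g : E → ℝ} (hf : Lp1 s f) (hg : Lp1 s g) : Lp1 s (fun x => f x * g x) := by
  obtain ⟨A, hA⟩ := hs.exists_bound_of_continuousOn hf.continuousOn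
  obtain ⟨B, hB⟩ := hs.exists_bound_of_continuousOn hg.continuousOn
  obtain ⟨L, hL0, hL⟩ := hf.nn
  obtain ⟨M, hM0, hM⟩ := hg.nn
  refine ⟨L * B + A * M, fun x hx y hy => ?_⟩
  have hB0 := (norm_nonneg _).trans (hB x hx)
  have hA0 := (norm_nonneg _).trans (hA x hx)
  calc ‖f x * g x - f y * g y‖ = ‖(f x - f y) * g x + f y * (g x - g y)‖ := by congr 1; ring
    _ ≤ ‖f x - f y‖ * ‖g x‖ + ‖f y‖ * ‖g x - g y‖ := by
      rw [← norm_mul, ← norm_mul]; exact norm_add_le _ _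
    _ ≤ (L * ‖x - y‖) * B + A * (M * ‖x - y‖) := by
      gcongr
      · exact hL x hx y hy
      · exact hB x hx
      · exact hA y hy
      · exact hM x hx y hy
    _ = _ := by ring

lemma Lp1.comp {s : Set E} {t : Set F} {z : E → F} {g : F → G} (hg : Lp1 t g) (hz : Lp1 s z) (hm : ∀ x ∈ s, z x ∈ t) :
    Lp1 s (fun x => g (z x)) := by
  obtain ⟨L, hL0, hL⟩ := hg.nn
  obtain ⟨M, hM⟩ := hz
  refine ⟨L * M, fun x hx y hy => (hL _ (hm x hx) _ (hm y hy)).trans ?_⟩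
  rw [mul_assoc]; gcongr; exact hM x hx y hy

lemma Lp1.prod {s : Set E} {f : E → F} {g : E → G} (hf : Lp1 s f) (hg : Lp1 s g) : Lp1 s (fun x => (f x, g x)) := by
  obtain ⟨L, hL0, hL⟩ := hf.nn
  obtain ⟨M, hM0, hM⟩ := hg.nn
  refine ⟨L + M, fun x hx y hy => ?_⟩
  rw [Prod.mk_sub_mk, Prod.norm_mk, max_le_iff]
  have := norm_nonneg (x - y)
  exact ⟨(hL x hx y hy).trans (by gcongr; linarith), (hM x hx y hy).trans (by gcongr; linarith)⟩
end

lemma qq_Lp1 {a : ℝ} (ha : 1 < a) : Lp1 (closure (torus a)) qq :=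
  lip_of_smooth (cl_compact a) isOpen_Pos (cl_Pos ha) qq_contDiffOn

lemma zeta_Lp1 {a : ℝ} (ha : 1 < a) : Lp1 (closure (torus a)) (zeta a) :=
  lip_of_smooth (cl_compact a) isOpen_Pos (cl_Pos ha) (zeta_contDiffOn a)

/-- lift of the disk to a cross section of the torus -/
def lft (a : ℝ) (z : ℂ) : R3 := ![a + z.re, 0, z.im]

lemma lft_pos {a : ℝ} (ha : 1 < a) {z : ℂ} (hz : z ∈ Dk) : a - 1 ≤ a + z.re := by
  have h1 := Complex.abs_re_le_norm z
  have h2 := mem_Dk.1 hz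
  have := neg_abs_le z.re
  linarith

lemma lft_rad {a : ℝ} (ha : 1 < a) {z : ℂ} (hz : z ∈ Dk) : rad (lft a z) = a + z.re := by
  have h := lft_pos ha hz
  simp only [rad, lft, Matrix.cons_val_zero, Matrix.cons_val_one]
  rw [zero_pow two_ne_zero, add_zero, Real.sqrt_sq (by linarith)]

lemma lft_mem {a : ℝ} (ha : 1 < a) {z : ℂ} (hz : z ∈ Dk) : lft a z ∈ closure (torus a) := by
  have h := lft_pos ha hz
  apply mem_cl
  · rw [lft_rad ha hz]; linarith
  · linarith
  · rw [lft_rad ha hz]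
    have h2 := mem_Dk.1 hz
    have h3 : ‖z‖ ^ 2 = z.re * z.re + z.im * z.im := by rw [Complex.sq_norm, Complex.normSq_apply]
    simp only [lft, Matrix.cons_val]
    nlinarith [norm_nonneg z]

lemma lft_zeta {a : ℝ} (ha : 1 < a) {z : ℂ} (hz : z ∈ Dk) : zeta a (lft a z) = z := by
  apply Complex.ext
  · simp only [zeta]; rw [lft_rad ha hz]; ring
  · simp [zeta, lft]

lemma zeta_lft (a : ℝ) (x : R3) : lft a (zeta a x) = ![rad x, 0, x 2] := by
  simp [lft, zeta]

lemma lft_Lp1 (a : ℝ) : Lp1 Dk (lft a) := by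
  refine ⟨1, fun z _ w _ => ?_⟩
  rw [one_mul, pi_norm_le_iff_of_nonneg (norm_nonneg _)]
  intro i
  have e : z - w = z - w := rfl
  fin_cases i
  · simpa [lft] using Complex.abs_re_le_norm (z - w)
  · simp [lft]
  · simpa [lft] using Complex.abs_im_le_norm (z - w)

/-- the profile on the disk -/
def uu (a : ℝ) (φ : R3 → ℝ) (z : ℂ) : ℝ := √(a + z.re) * φ (lft a z)
def ff (a : ℝ) (φ k : R3 → ℝ) (z : ℂ) : ℝ := √(a + z.re) * k (lft a z) + ((4 * (a + z.re) ^ 2)⁻¹ * uu a φ z)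

lemma sqrt_Lp1 {a : ℝ} (ha : 1 < a) : Lp1 Dk (fun z : ℂ => √(a + z.re)) := by
  refine lip_of_smooth (O := {z : ℂ | 0 < a + z.re}) Dk_compact (isOpen_lt continuous_const (by fun_prop))
    (fun z hz => lt_of_lt_of_le (by linarith) (lft_pos ha hz)) ?_
  intro z hz
  have hz' : 0 < a + z.re := hz
  have h : ContDiffAt ℝ 1 (fun z : ℂ => a + z.re) z := contDiffAt_const.add Complex.reCLM.contDiff.contDiffAt
  exact (h.sqrt hz'.ne').contDiffWithinAt

lemma cinv_Lp1 {a : ℝ} (ha : 1 < a) : Lp1 Dk (fun z : ℂ => (4 * (a + z.re) ^ 2)⁻¹) := by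
  refine lip_of_smooth (O := {z : ℂ | 0 < a + z.re}) Dk_compact (isOpen_lt continuous_const (by fun_prop))
    (fun z hz => lt_of_lt_of_le (by linarith) (lft_pos ha hz)) ?_
  intro z hz
  have hz' : 0 < a + z.re := hz
  have h : ContDiffAt ℝ 1 (fun z : ℂ => a + z.re) z := contDiffAt_const.add Complex.reCLM.contDiff.contDiffAt
  exact ((contDiffAt_const.mul (h.pow 2)).inv (by positivity)).contDiffWithinAt

lemma uu_rep {a : ℝ} (ha : 1 < a) {φ : R3 → ℝ} (hs : torSym φ) {x : R3} (hx : x ∈ closure (torus a)) :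
    φ x = qq x * uu a φ (zeta a x) := by
  have hr : 0 < rad x := cl_Pos ha hx
  rw [torSym_rep hs x, ← zeta_lft a x, uu]
  have : a + (zeta a x).re = rad x := by simp [zeta]
  rw [this, qq]
  have : √(rad x) ≠ 0 := by positivity
  field_simp

lemma ff_rep {a : ℝ} (ha : 1 < a) {φ k : R3 → ℝ} (hs : torSym φ) (hk : torSym k) {x : R3} (hx : x ∈ closure (torus a)) :
    k x + φ x / (4 * rad x ^ 2) = qq x * ff a φ k (zeta a x) := by
  have hr : 0 < rad x := cl_Pos ha hx
  have h1 := uu_rep ha hs hx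
  have h2 := uu_rep ha hk hx
  have : a + (zeta a x).re = rad x := by simp [zeta]
  rw [h1, h2, ff, uu, this]
  ring

lemma cmp_main {a : ℝ} (ha : 1 < a) {φ k : R3 → ℝ} (hφ : ContinuousOn φ (closure (torus a)))
    (hk : ContinuousOn k (closure (torus a))) (hD : DistEq (torus a) φ k)
    (hb : ∀ x ∈ frontier (torus a), φ x = 0) (hs : torSym φ) (hks : torSym k) :
    Cmp (ff a φ k) (uu a φ) := by
  have hDn : DistEq (torus a) (fun x => - φ x) (fun x => - k x) := by
    intro ψ h1 h2 h3
    have := hD ψ h1 h2 h3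
    simp only [neg_mul, integral_neg]
    linarith
  set C := 4 * (a + 1) ^ 2 / √(a - 1) with hC
  have hsq : 0 < √(a - 1) := Real.sqrt_pos.2 (by linarith)
  have hsq2 : 0 < √(a + 1) := Real.sqrt_pos.2 (by linarith)
  have hCp : 0 < C := by positivity
  intro ε hε
  refine ⟨ε / (√(a + 1) * C), by positivity, ?_⟩
  set δ := ε / (√(a + 1) * C) with hδ
  have hδ0 : 0 < δ := by positivity
  intro F U hU hUF hF z hz
  have h1 := upper ha hφ hk hD hb hU hUF hδ0.le (by
    intro x hx
    have hx' := subset_closure hx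
    rw [ff_rep ha hs hks hx']
    apply mul_le_mul_of_nonneg_left _ (qq_pos (cl_Pos ha hx')).le
    have := (abs_le.1 (hF _ (cl_zeta hx'))).2
    simp only [EP]; linarith) (lft a z) (lft_mem ha (mem_Dk.2 hz))
  have h2 := upper ha hφ.neg hk.neg hDn (by intro x hx; simp [hb x hx]) (U := -U) (F := -F)
    (by obtain ⟨Q, hQ⟩ := hU; exact ⟨-Q, by rw [hQ]; ring⟩)
    (by
      simp only [map_neg]
      exact (congrArg Neg.neg hUF).trans (by ring)) hδ0.le (by
    intro x hx
    have hx' := subset_closure hx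
    have e := ff_rep ha hs hks hx'
    have : - k x + - φ x / (4 * rad x ^ 2) = qq x * (- ff a φ k (zeta a x)) := by
      rw [mul_neg, ← e]; ring
    simp only [Pi.neg_apply]
    rw [this]
    apply mul_le_mul_of_nonneg_left _ (qq_pos (cl_Pos ha hx')).le
    have := (abs_le.1 (hF _ (cl_zeta hx'))).1
    simp only [EP, ev_neg, Complex.neg_re]; linarith) (lft a z) (lft_mem ha (mem_Dk.2 hz))
  rw [← hC] at h1 h2
  have hp := lft_pos ha (mem_Dk.2 hz)
  have hp0 : 0 < a + z.re := by linarith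
  have hsp : 0 < √(a + z.re) := by positivity
  have e1 : √(a + z.re) * wU a U (lft a z) = (ev U z).re := by
    simp only [wU, EP, qq]
    rw [lft_rad ha (mem_Dk.2 hz), lft_zeta ha (mem_Dk.2 hz)]
    field_simp
  have e2 : wU a (-U) (lft a z) = - wU a U (lft a z) := by
    simp [wU, EP]
  rw [e2] at h2
  have h3 : |φ (lft a z) - wU a U (lft a z)| ≤ C * δ := by
    rw [abs_le]; constructor
    · simp only [Pi.neg_apply] at h2; linarith
    · linarith
  have h4 : √(a + z.re) ≤ √(a + 1) := Real.sqrt_le_sqrt (by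
    have h1 := Complex.abs_re_le_norm z
    have := le_abs_self z.re
    linarith)
  rw [← e1, uu, ← mul_sub, abs_mul, abs_of_pos hsp]
  calc √(a + z.re) * |φ (lft a z) - wU a U (lft a z)| ≤ √(a + 1) * (C * δ) := by gcongr
    _ = ε := by rw [hδ]; field_simp

lemma gen1 {a : ℝ} (ha : 1 < a) {φ k : R3 → ℝ} (hφ : ContinuousOn φ (closure (torus a)))
    (hk : ContinuousOn k (closure (torus a))) (hD : DistEq (torus a) φ k)
    (hb : ∀ x ∈ frontier (torus a), φ x = 0) (hs : torSym φ) (hks : torSym k) :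
    Lp1 (closure (torus a)) φ := by
  have hl : ∀ {f : R3 → ℝ}, ContinuousOn f (closure (torus a)) → ContinuousOn (fun z => f (lft a z)) Dk :=
    fun h => h.comp (lft_Lp1 a).continuousOn (fun z hz => lft_mem ha hz)
  have hu : ContinuousOn (uu a φ) Dk := (sqrt_Lp1 ha).continuousOn.mul (hl hφ)
  have hf : ContinuousOn (ff a φ k) Dk :=
    ((sqrt_Lp1 ha).continuousOn.mul (hl hk)).add ((cinv_Lp1 ha).continuousOn.mul hu)
  have h1 : Lp1 Dk (uu a φ) := disk1 hf (cmp_main ha hφ hk hD hb hs hks)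
  have h2 : Lp1 (closure (torus a)) (fun x => uu a φ (zeta a x)) :=
    h1.comp (zeta_Lp1 ha) (fun x hx => mem_Dk.2 (cl_zeta hx))
  exact ((qq_Lp1 ha).mul (cl_compact a) h2).congr (fun x hx => uu_rep ha hs hx)

lemma gen2 {a : ℝ} (ha : 1 < a) {φ k : R3 → ℝ} (hφ : ContinuousOn φ (closure (torus a)))
    (hk : Lp1 (closure (torus a)) k) (hD : DistEq (torus a) φ k)
    (hb : ∀ x ∈ frontier (torus a), φ x = 0) (hs : torSym φ) (hks : torSym k) {β : ℝ} (hβ0 : 0 < β) (hβ1 : β < 1) :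
    C2b β (closure (torus a)) φ := by
  have hφL := gen1 ha hφ hk.continuousOn hD hb hs hks
  have hl : ∀ {f : R3 → ℝ}, Lp1 (closure (torus a)) f → Lp1 Dk (fun z => f (lft a z)) :=
    fun h => h.comp (lft_Lp1 a) (fun z hz => lft_mem ha hz)
  have hu : Lp1 Dk (uu a φ) := (sqrt_Lp1 ha).mul Dk_compact (hl hφL)
  have hf : Lp1 Dk (ff a φ k) :=
    ((sqrt_Lp1 ha).mul Dk_compact (hl hk)).add ((cinv_Lp1 ha).mul Dk_compact hu)
  obtain ⟨L, hL⟩ := hf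
  have h1 : C2b β Dk (uu a φ) := disk2 hL (cmp_main ha hφ hk.continuousOn hD hb hs hks) hβ0 hβ1
  obtain ⟨M, hM⟩ := zeta_Lp1 ha
  have h2 : C2b β (closure (torus a)) (fun x => uu a φ (zeta a x)) :=
    h1.comp hβ0 (fun x hx => mem_Dk.2 (cl_zeta hx)) hM
      (C2b_of_smooth hβ0 hβ1 (cl_compact a) isOpen_Pos (cl_Pos ha) (zeta_contDiffOn a))
  have h3 : C2b β (closure (torus a)) qq :=
    C2b_of_smooth hβ0 hβ1 (cl_compact a) isOpen_Pos (cl_Pos ha) qq_contDiffOn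
  exact (h3.bil (ContinuousLinearMap.mul ℝ ℝ) h2).congr (fun x hx => by
    rw [uu_rep ha hs hx]; rfl)

end

open MeasureTheory Real Set Filter
open scoped ENNReal NNReal ComplexConjugate
noncomputable section

lemma polar_sq (H : ℝ → ℝ≥0∞) (hH : Measurable H) :
    ∫⁻ q : ℝ × ℝ, H (q.1 ^ 2 + q.2 ^ 2) = ENNReal.ofReal π * ∫⁻ s in Ioi (0 : ℝ), H s := by
  rw [← lintegral_comp_polarCoord_symm]
  have e1 : ∀ p : ℝ × ℝ, ENNReal.ofReal p.1 • H ((polarCoord.symm p).1 ^ 2 + (polarCoord.symm p).2 ^ 2)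
      = ENNReal.ofReal p.1 * H (p.1 ^ 2) := by
    intro p
    have : (polarCoord.symm p).1 ^ 2 + (polarCoord.symm p).2 ^ 2 = p.1 ^ 2 := by
      simp only [polarCoord_symm_apply]
      linear_combination p.1 ^ 2 * Real.cos_sq_add_sin_sq p.2
    rw [this, smul_eq_mul]
  simp_rw [e1]
  rw [polarCoord_target, Measure.volume_eq_prod, ← Measure.prod_restrict, lintegral_prod _ (by fun_prop)]
  simp only [lintegral_const, Measure.restrict_apply MeasurableSet.univ, univ_inter, Real.volume_Ioo]
  rw [lintegral_mul_const _ (by fun_prop)]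
  have himg : Set.image (fun r : ℝ => r ^ 2) (Ioi 0) = Ioi 0 := by
    ext s
    constructor
    · rintro ⟨r, hr, rfl⟩
      have : 0 < r := hr
      show 0 < r ^ 2
      positivity
    · intro hs
      have : 0 < s := hs
      exact ⟨√s, Real.sqrt_pos.2 this, Real.sq_sqrt this.le⟩
  have h2 := lintegral_image_eq_lintegral_abs_deriv_mul (s := Ioi (0 : ℝ)) (f := fun r => r ^ 2) (f' := fun r => 2 * r)
    measurableSet_Ioi (fun x _ => by simpa using (hasDerivAt_pow 2 x).hasDerivWithinAt) (by
      intro x hx y hy h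
      have hx' : 0 < x := hx
      have hy' : 0 < y := hy
      exact (sq_eq_sq₀ hx'.le hy'.le).1 h) H
  rw [himg] at h2
  have h3 : ∫⁻ r in Ioi (0 : ℝ), ENNReal.ofReal |2 * r| * H (r ^ 2) = 2 * ∫⁻ r in Ioi (0 : ℝ), ENNReal.ofReal r * H (r ^ 2) := by
    rw [← lintegral_const_mul _ (by fun_prop)]
    apply setLIntegral_congr_fun measurableSet_Ioi
    intro r hr
    have hr' : 0 < r := hr
    simp only
    rw [abs_of_pos (by positivity), ENNReal.ofReal_mul (by norm_num), mul_assoc]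
    simp
  rw [h2, h3, show π - -π = 2 * π by ring, ENNReal.ofReal_mul (by norm_num)]
  simp only [ENNReal.ofReal_ofNat]
  ring

def SS : Set (ℝ × ℝ) := {p | p.2 ^ 2 < p.1}
lemma SS_meas : MeasurableSet SS := (isOpen_lt (by fun_prop) (by fun_prop)).measurableSet

lemma lint_T (G : ℝ × ℝ → ℝ≥0∞) (hG : Measurable G) :
    ∫⁻ v : R3, G (nsq v, v 1) = ENNReal.ofReal π * ∫⁻ p in SS, G p := by
  have h1 := (volume_preserving_piFinSuccAbove (fun _ : Fin 3 => ℝ) 1).lintegral_comp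
    (f := fun q : ℝ × (Fin 2 → ℝ) => G (q.1 ^ 2 + (q.2 0 ^ 2 + q.2 1 ^ 2), q.1)) (by fun_prop)
  have e : ∀ v : R3, G (nsq v, v 1) = (fun q : ℝ × (Fin 2 → ℝ) => G (q.1 ^ 2 + (q.2 0 ^ 2 + q.2 1 ^ 2), q.1))
      ((MeasurableEquiv.piFinSuccAbove (fun _ : Fin 3 => ℝ) 1) v) := by
    intro v
    have : nsq v = v 1 ^ 2 + (v 0 ^ 2 + v 2 ^ 2) := by simp only [nsq, Fin.sum_univ_three]; ring
    rw [this]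
    rfl
  simp_rw [e]
  rw [h1, Measure.volume_eq_prod, lintegral_prod _ (by fun_prop)]
  have h2 : ∀ u : ℝ, ∫⁻ y : Fin 2 → ℝ, G (u ^ 2 + (y 0 ^ 2 + y 1 ^ 2), u)
      = ENNReal.ofReal π * ∫⁻ t, SS.indicator G (t, u) := by
    intro u
    have h3 := (volume_preserving_finTwoArrow ℝ).lintegral_comp
      (f := fun q : ℝ × ℝ => G (u ^ 2 + (q.1 ^ 2 + q.2 ^ 2), u)) (by fun_prop)
    have h4 : ∫⁻ y : Fin 2 → ℝ, G (u ^ 2 + (y 0 ^ 2 + y 1 ^ 2), u) = ∫⁻ q : ℝ × ℝ, G (u ^ 2 + (q.1 ^ 2 + q.2 ^ 2), u) := h3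
    rw [h4, polar_sq (fun s => G (u ^ 2 + s, u)) (by fun_prop)]
    congr 1
    rw [← lintegral_add_left_eq_self (fun t => SS.indicator G (t, u)) (u ^ 2), ← lintegral_indicator measurableSet_Ioi]
    congr 1
    ext s
    by_cases hs : 0 < s
    · rw [indicator_of_mem (show s ∈ Ioi 0 from hs), indicator_of_mem]
      show u ^ 2 < u ^ 2 + s
      linarith
    · rw [indicator_of_notMem (show s ∉ Ioi 0 from hs), indicator_of_notMem]
      show ¬ (u ^ 2 < u ^ 2 + s)
      linarith
  simp only [h2]
  have hm : Measurable (SS.indicator G) := hG.indicator SS_meas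
  rw [lintegral_const_mul _ (by fun_prop), ← lintegral_indicator SS_meas, Measure.volume_eq_prod, lintegral_prod_symm _ hm.aemeasurable]

def TM (v : R3) : ℝ × ℝ := (nsq v, v 1)
lemma TM_cont : Continuous TM := by unfold TM nsq; fun_prop

lemma map_T : Measure.map TM volume = ENNReal.ofReal π • (volume : Measure (ℝ × ℝ)).restrict SS := by
  apply Measure.ext_of_lintegral
  intro G hG
  rw [lintegral_map hG TM_cont.measurable, lintegral_smul_measure]
  exact lint_T G hG

lemma int_T {F : ℝ × ℝ → ℝ} (hF : Continuous F) : ∫ v : R3, F (nsq v, v 1) = π * ∫ p in SS, F p := by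
  have := integral_map (μ := (volume : Measure R3)) TM_cont.measurable.aemeasurable (f := F) hF.aestronglyMeasurable
  rw [map_T, integral_smul_measure] at this
  rw [ENNReal.toReal_ofReal pi_pos.le] at this
  exact this.symm

lemma integrable_T {F : ℝ × ℝ → ℝ} (hF : Continuous F) (hi : Integrable (fun v : R3 => F (nsq v, v 1))) : IntegrableOn F SS := by
  have := (integrable_map_measure (μ := (volume : Measure R3)) (g := F) hF.aestronglyMeasurable TM_cont.measurable.aemeasurable).2 hi
  rw [map_T] at this
  have h2 := this.smul_measure (c := (ENNReal.ofReal π)⁻¹) (by simp [pi_pos])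
  rw [smul_smul, ENNReal.inv_mul_cancel (by simp [pi_pos]) (by simp), one_smul] at h2
  exact h2

end

open MeasureTheory Real Set Filter
open scoped ENNReal NNReal ComplexConjugate
noncomputable section

lemma uIoc_bd {a b c x : ℝ} (ha : |a| ≤ c) (hb : |b| ≤ c) (hx : x ∈ Set.uIoc a b) : |x| ≤ c := by
  have h := Set.uIoc_subset_uIcc hx
  have h1 := Set.uIcc_subset_Icc (abs_le.1 ha) (abs_le.1 hb) h
  exact abs_le.2 h1

lemma H_bd {q : ℝ → ℝ} {Q T R α β ρ : ℝ} (hR : |ρ| ≤ R) (hα : |α| ≤ T) (hβ : |β| ≤ T) (hQ0 : 0 ≤ Q)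
    (hQ : ∀ w, |w| ≤ R * T → |q w| ≤ Q) : |∫ w in (ρ * α)..(ρ * β), q w| ≤ Q * (2 * R * T) := by
  have hR0 := (abs_nonneg _).trans hR
  have hT0 := (abs_nonneg _).trans hα
  have h1 : |ρ * α| ≤ R * T := by rw [abs_mul]; gcongr
  have h2 : |ρ * β| ≤ R * T := by rw [abs_mul]; gcongr
  have := intervalIntegral.norm_integral_le_of_norm_le_const (a := ρ * α) (b := ρ * β) (f := q) (C := Q)
    (fun x hx => hQ x (uIoc_bd h1 h2 hx))
  refine this.trans ?_
  gcongr
  calc |ρ * β - ρ * α| ≤ |ρ * β| + |ρ * α| := abs_sub _ _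
    _ ≤ _ := by linarith

lemma H_diff {q : ℝ → ℝ} (hq : Continuous q) {Q T R α β ρ ρ' : ℝ} (hR : |ρ| ≤ R) (hR' : |ρ'| ≤ R) (hα : |α| ≤ T)
    (hβ : |β| ≤ T) (hQ0 : 0 ≤ Q) (hQ : ∀ w, |w| ≤ R * T → |q w| ≤ Q) :
    |(∫ w in (ρ * α)..(ρ * β), q w) - ∫ w in (ρ' * α)..(ρ' * β), q w| ≤ 2 * T * Q * |ρ - ρ'| := by
  have hR0 := (abs_nonneg _).trans hR
  have hT0 := (abs_nonneg _).trans hα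
  have hk : ∀ {s c : ℝ}, |s| ≤ R → |c| ≤ T → |s * c| ≤ R * T := by
    intro s c h1 h2; rw [abs_mul]; gcongr
  rw [intervalIntegral.integral_interval_sub_interval_comm (hq.intervalIntegrable _ _) (hq.intervalIntegrable _ _)
    (hq.intervalIntegrable _ _)]
  have h1 := intervalIntegral.norm_integral_le_of_norm_le_const (a := ρ * α) (b := ρ' * α) (f := q) (C := Q)
    (fun x hx => hQ x (uIoc_bd (hk hR hα) (hk hR' hα) hx))
  have h2 := intervalIntegral.norm_integral_le_of_norm_le_const (a := ρ * β) (b := ρ' * β) (f := q) (C := Q)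
    (fun x hx => hQ x (uIoc_bd (hk hR hβ) (hk hR' hβ) hx))
  rw [Real.norm_eq_abs] at h1 h2
  have h3 : |ρ' * α - ρ * α| ≤ T * |ρ - ρ'| := by
    rw [← sub_mul, abs_mul, abs_sub_comm, mul_comm]; gcongr
  have h4 : |ρ' * β - ρ * β| ≤ T * |ρ - ρ'| := by
    rw [← sub_mul, abs_mul, abs_sub_comm, mul_comm]; gcongr
  have h5 := mul_le_mul_of_nonneg_left h3 hQ0
  have h6 := mul_le_mul_of_nonneg_left h4 hQ0
  refine (abs_sub _ _).trans ?_
  linarith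

lemma prod_diff {x y x' y' X dX Y dY : ℝ} (h1 : |x - x'| ≤ dX) (h2 : |y| ≤ Y) (h3 : |x'| ≤ X) (h4 : |y - y'| ≤ dY) :
    |x * y - x' * y'| ≤ dX * Y + X * dY := by
  have : x * y - x' * y' = (x - x') * y + x' * (y - y') := by ring
  rw [this]
  refine (abs_add_le _ _).trans ?_
  rw [abs_mul, abs_mul]
  have := (abs_nonneg _).trans h1
  have := (abs_nonneg _).trans h3
  gcongr

def NN (A B : ℝ) (g : ℝ → ℝ) (d t ρ : ℝ) : ℝ :=
  ∫ u in (-√t)..√t, (A + B * u / √(1 + |t|)) * g (ρ * (u + d))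

lemma NN_eq {A B : ℝ} {g : ℝ → ℝ} (hg : Continuous g) {d t ρ : ℝ} (hρ : 0 < ρ) :
    NN A B g d t ρ = (A - B / √(1 + |t|) * d) * (ρ⁻¹ * ∫ w in (ρ * (d - √t))..(ρ * (d + √t)), g w)
      + (B / √(1 + |t|)) * ((ρ⁻¹ * ρ⁻¹) * ∫ w in (ρ * (d - √t))..(ρ * (d + √t)), w * g w) := by
  have h := intervalIntegral.integral_comp_mul_add (a := -√t) (b := √t)
    (fun w => (A + B / √(1 + |t|) * (w / ρ - d)) * g w) hρ.ne' (ρ * d)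
  have e : ∀ u : ℝ, (A + B / √(1 + |t|) * ((ρ * u + ρ * d) / ρ - d)) * g (ρ * u + ρ * d)
      = (A + B * u / √(1 + |t|)) * g (ρ * (u + d)) := by
    intro u
    rw [← mul_add]; field_simp; ring_nf
  simp only [e] at h
  rw [NN, h]
  have e1 : ρ * -√t + ρ * d = ρ * (d - √t) := by ring
  have e2 : ρ * √t + ρ * d = ρ * (d + √t) := by ring
  rw [e1, e2, smul_eq_mul]
  have e3 : ∀ w : ℝ, (A + B / √(1 + |t|) * (w / ρ - d)) * g w =
      (A - B / √(1 + |t|) * d) * g w + (B / √(1 + |t|) * ρ⁻¹) * (w * g w) := by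
    intro w; field_simp; ring
  simp only [e3]
  rw [intervalIntegral.integral_add (Continuous.intervalIntegrable (by fun_prop) _ _) (Continuous.intervalIntegrable (by fun_prop) _ _),
    intervalIntegral.integral_const_mul, intervalIntegral.integral_const_mul]
  ring

set_option maxHeartbeats 1000000 in
lemma NN_lip {r0 R M : ℝ} (hr0 : 0 < r0) (hR : r0 ≤ R) (hM : 0 ≤ M) (A B : ℝ) : ∃ K : ℝ, 0 ≤ K ∧
    ∀ (g : ℝ → ℝ) (S d t ρ ρ' : ℝ), Continuous g → 0 ≤ S → (∀ w, |g w| ≤ S) → |d| ≤ M → 0 ≤ t →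
      r0 ≤ ρ → ρ ≤ R → r0 ≤ ρ' → ρ' ≤ R →
      |NN A B g d t ρ - NN A B g d t ρ'| ≤ K * S * √(1 + |t|) * |ρ - ρ'| := by
  have hR0 : 0 < R := by linarith
  refine ⟨(1 + M) * ((|A| + |B| * M) * (2 * R / r0 ^ 2 + 2 / r0) + |B| * (1 + M) * (4 * R ^ 3 / r0 ^ 4 + 2 * R / r0 ^ 2)),
    by positivity, ?_⟩
  intro g S d t ρ ρ' hg hS hgS hd ht hρ1 hρ2 hρ'1 hρ'2
  have hρ : 0 < ρ := by linarith
  have hρ' : 0 < ρ' := by linarith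
  have hq1 : 1 ≤ √(1 + |t|) := Real.one_le_sqrt.2 (by linarith [abs_nonneg t])
  have hqt : √t ≤ √(1 + |t|) := Real.sqrt_le_sqrt (by linarith [le_abs_self t])
  have ht0 := Real.sqrt_nonneg t
  set Q := √(1 + |t|) with hQ
  set T := √t + M with hT
  have hT0 : 0 ≤ T := by positivity
  have hTQ : T ≤ (1 + M) * Q := by rw [hT]; nlinarith
  have hdd := abs_le.1 hd
  have hα : |d - √t| ≤ T := by rw [abs_le, hT]; constructor <;> linarith
  have hβ : |d + √t| ≤ T := by rw [abs_le, hT]; constructor <;> linarith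
  have ha : |ρ| ≤ R := by rw [abs_of_pos hρ]; exact hρ2
  have ha' : |ρ'| ≤ R := by rw [abs_of_pos hρ']; exact hρ'2
  rw [NN_eq hg hρ, NN_eq hg hρ']
  rw [← hQ]
  have hinv : ∀ {s : ℝ}, 0 < s → r0 ≤ s → |s⁻¹| ≤ r0⁻¹ := by
    intro s h1 h2; rw [abs_of_pos (by positivity)]; exact inv_anti₀ hr0 h2
  have i1 : |ρ⁻¹ - ρ'⁻¹| ≤ |ρ - ρ'| / r0 ^ 2 := by
    have : ρ⁻¹ - ρ'⁻¹ = (ρ' - ρ) * (ρ⁻¹ * ρ'⁻¹) := by field_simp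
    rw [this, abs_mul, abs_mul, abs_sub_comm]
    have h1 := hinv hρ hρ1
    have h2 := hinv hρ' hρ'1
    calc |ρ - ρ'| * (|ρ⁻¹| * |ρ'⁻¹|) ≤ |ρ - ρ'| * (r0⁻¹ * r0⁻¹) := by gcongr
      _ = _ := by field_simp
  have i2 : |ρ⁻¹ * ρ⁻¹ - ρ'⁻¹ * ρ'⁻¹| ≤ (|ρ - ρ'| / r0 ^ 2) * r0⁻¹ + r0⁻¹ * (|ρ - ρ'| / r0 ^ 2) :=
    prod_diff i1 (hinv hρ hρ1) (hinv hρ' hρ'1) i1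
  have i3 : |ρ'⁻¹ * ρ'⁻¹| ≤ r0⁻¹ * r0⁻¹ := by
    rw [abs_mul]; have := hinv hρ' hρ'1; gcongr
  have hg1 : ∀ w, |w| ≤ R * T → |w * g w| ≤ R * T * S := by
    intro w hw; rw [abs_mul]; have := hgS w; gcongr
  have b0 := H_bd ha hα hβ hS (fun w _ => hgS w)
  have b1 := H_bd ha hα hβ (by positivity) hg1
  have d0 := H_diff hg ha ha' hα hβ hS (fun w _ => hgS w)
  have d1 := H_diff (q := fun w => w * g w) (by fun_prop) ha ha' hα hβ (by positivity) hg1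
  have p0 := prod_diff i1 b0 (hinv hρ' hρ'1) d0
  have p1 := prod_diff i2 b1 i3 d1
  set D := |ρ - ρ'| with hD
  have hD0 : 0 ≤ D := abs_nonneg _
  have hBQ : |B / Q| ≤ |B| := by
    rw [abs_div, abs_of_pos (show 0 < Q by linarith)]; exact div_le_self (abs_nonneg _) hq1
  have hBT : |B / Q| * T ≤ |B| * (1 + M) := by
    rw [abs_div, abs_of_pos (show 0 < Q by linarith), div_mul_eq_mul_div, div_le_iff₀ (by linarith), mul_assoc]
    gcongr
  have hA : |A - B / Q * d| ≤ |A| + |B| * M := by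
    refine (abs_sub _ _).trans ?_
    rw [abs_mul]; gcongr
  rw [add_sub_add_comm, ← mul_sub, ← mul_sub]
  refine (abs_add_le _ _).trans ?_
  rw [abs_mul, abs_mul]
  have s0 := mul_le_mul hA p0 (abs_nonneg _) (by positivity)
  have s1 := mul_le_mul_of_nonneg_left p1 (abs_nonneg (B / Q))
  have r1 : |B / Q| * ((D / r0 ^ 2 * r0⁻¹ + r0⁻¹ * (D / r0 ^ 2)) * (R * T * S * (2 * R * T)) + r0⁻¹ * r0⁻¹ * (2 * T * (R * T * S) * D))
      = (|B / Q| * T) * (T * S * D * (4 * R ^ 2 / r0 ^ 3 + 2 * R / r0 ^ 2)) := by field_simp; ring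
  rw [r1] at s1
  have s2 := mul_le_mul_of_nonneg_right hBT (show 0 ≤ T * S * D * (4 * R ^ 2 / r0 ^ 3 + 2 * R / r0 ^ 2) by positivity)
  have hRr : 4 * R ^ 2 / r0 ^ 3 ≤ 4 * R ^ 3 / r0 ^ 4 := by
    rw [div_le_div_iff₀ (by positivity) (by positivity)]
    have h7 := mul_le_mul_of_nonneg_left hR (show 0 ≤ 4 * R ^ 2 * r0 ^ 3 by positivity)
    calc 4 * R ^ 2 * r0 ^ 4 = 4 * R ^ 2 * r0 ^ 3 * r0 := by ring
      _ ≤ 4 * R ^ 2 * r0 ^ 3 * R := h7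
      _ = _ := by ring
  calc _ ≤ (|A| + |B| * M) * (D / r0 ^ 2 * (S * (2 * R * T)) + r0⁻¹ * (2 * T * S * D)) +
        |B| * (1 + M) * (T * S * D * (4 * R ^ 2 / r0 ^ 3 + 2 * R / r0 ^ 2)) := add_le_add s0 (s1.trans s2)
    _ ≤ (|A| + |B| * M) * (D / r0 ^ 2 * (S * (2 * R * T)) + r0⁻¹ * (2 * T * S * D)) +
        |B| * (1 + M) * (T * S * D * (4 * R ^ 3 / r0 ^ 4 + 2 * R / r0 ^ 2)) := by gcongr
    _ = T * (((|A| + |B| * M) * (2 * R / r0 ^ 2 + 2 / r0) + |B| * (1 + M) * (4 * R ^ 3 / r0 ^ 4 + 2 * R / r0 ^ 2)) * S * D) := by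
      field_simp
    _ ≤ ((1 + M) * Q) * (((|A| + |B| * M) * (2 * R / r0 ^ 2 + 2 / r0) + |B| * (1 + M) * (4 * R ^ 3 / r0 ^ 4 + 2 * R / r0 ^ 2)) * S * D) := by
      gcongr
    _ = _ := by ring

end

open MeasureTheory Real Set Filter
open scoped ENNReal NNReal ComplexConjugate
noncomputable section

lemma slice_eq (F : ℝ × ℝ → ℝ) (t : ℝ) : ∫ u, SS.indicator F (t, u) = ∫ u in (-√t)..√t, F (t, u) := by
  have h0 := Real.sqrt_nonneg t
  rw [intervalIntegral.integral_of_le (by linarith), integral_Ioc_eq_integral_Ioo, ← integral_indicator measurableSet_Ioo]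
  congr 1
  ext u
  by_cases h : u ∈ Ioo (-√t) √t
  · rw [indicator_of_mem h, indicator_of_mem]
    show u ^ 2 < t
    have h1 : |u| < √t := abs_lt.2 h
    have h2 := (Real.lt_sqrt (abs_nonneg u)).1 h1
    rwa [sq_abs] at h2
  · rw [indicator_of_notMem h, indicator_of_notMem]
    intro h'
    apply h
    have h1 : u ^ 2 < t := h'
    exact abs_lt.1 ((Real.lt_sqrt (abs_nonneg u)).2 (by rwa [sq_abs]))

lemma int_slices {F : ℝ × ℝ → ℝ} (hi : IntegrableOn F SS) :
    Integrable (fun t => ∫ u in (-√t)..√t, F (t, u)) ∧ ∫ p in SS, F p = ∫ t, ∫ u in (-√t)..√t, F (t, u) := by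
  rw [← integrable_indicator_iff SS_meas, Measure.volume_eq_prod] at hi
  have h1 := hi.integral_prod_left
  simp only [slice_eq] at h1
  refine ⟨h1, ?_⟩
  rw [← integral_indicator SS_meas, Measure.volume_eq_prod, integral_prod _ hi]
  simp only [slice_eq]

lemma one_add_rpow {x γ : ℝ} (hx : 0 ≤ x) (hγ : 0 ≤ γ) : (1 + x) ^ γ ≤ 2 ^ γ * (1 + x ^ γ) := by
  have hxg : 0 ≤ x ^ γ := Real.rpow_nonneg hx γ
  have h2 : (0:ℝ) < 2 ^ γ := by positivity
  rcases le_total x 1 with h | h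
  · calc (1 + x) ^ γ ≤ 2 ^ γ := Real.rpow_le_rpow (by linarith) (by linarith) hγ
      _ ≤ _ := by nlinarith
  · calc (1 + x) ^ γ ≤ (2 * x) ^ γ := Real.rpow_le_rpow (by linarith) (by linarith) hγ
      _ = 2 ^ γ * x ^ γ := Real.mul_rpow (by norm_num) hx
      _ ≤ _ := by nlinarith

lemma one_le_q (t : ℝ) : 1 ≤ √(1 + |t|) := Real.one_le_sqrt.2 (by linarith [abs_nonneg t])

lemma dec_bd {Cμ γ M q c : ℝ} (hC : 0 ≤ Cμ) (hγ : 0 ≤ γ) (hM : 0 ≤ M) (hq : 1 ≤ q) (hc : |c| ≤ M) :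
    Cμ / (1 + |q + c| ^ γ) ≤ (Cμ * (2 * (1 + M)) ^ γ) * q ^ (-γ) := by
  have hq0 : 0 < q := by linarith
  have hx := abs_nonneg (q + c)
  have h1 : q ≤ (1 + M) * (1 + |q + c|) := by
    have := le_abs_self (q + c)
    have := neg_abs_le c
    nlinarith
  have h2 : q ^ γ ≤ (2 * (1 + M)) ^ γ * (1 + |q + c| ^ γ) := by
    calc q ^ γ ≤ ((1 + M) * (1 + |q + c|)) ^ γ := Real.rpow_le_rpow hq0.le h1 hγ
      _ = (1 + M) ^ γ * (1 + |q + c|) ^ γ := Real.mul_rpow (by linarith) (by linarith)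
      _ ≤ (1 + M) ^ γ * (2 ^ γ * (1 + |q + c| ^ γ)) := by
        gcongr; exact one_add_rpow hx hγ
      _ = _ := by rw [Real.mul_rpow (by norm_num) (by linarith)]; ring
  have h3 : 0 < q ^ γ := by positivity
  have h4 : 0 < 1 + |q + c| ^ γ := by positivity
  rw [Real.rpow_neg hq0.le, ← div_eq_mul_inv, div_le_div_iff₀ h4 h3, mul_assoc]
  gcongr

def Fw (A B : ℝ) (m : ℝ × ℝ → ℝ) (ρ c d : ℝ) (p : ℝ × ℝ) : ℝ :=
  (A + B * p.2 / √(1 + |p.1|)) * m (√(1 + |p.1|) + c, ρ * (p.2 + d))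

lemma Fw_cont {A B : ℝ} {m : ℝ × ℝ → ℝ} (hm : Continuous m) (ρ c d : ℝ) : Continuous (Fw A B m ρ c d) := by
  have h : ∀ p : ℝ × ℝ, √(1 + |p.1|) ≠ 0 := fun p => by linarith [one_le_q p.1]
  unfold Fw
  apply Continuous.mul
  · exact continuous_const.add (Continuous.div (by fun_prop) (by fun_prop) h)
  · fun_prop

lemma nsq_nonneg (v : R3) : 0 ≤ nsq v := Finset.sum_nonneg (fun i _ => sq_nonneg _)
lemma sq_le_nsq (v : R3) (i : Fin 3) : v i ^ 2 ≤ nsq v :=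
  Finset.single_le_sum (f := fun i => v i ^ 2) (fun i _ => sq_nonneg _) (Finset.mem_univ i)

lemma wt_bd (A B : ℝ) {t u : ℝ} (h : u ^ 2 ≤ t) : |A + B * u / √(1 + |t|)| ≤ |A| + |B| := by
  have hq := one_le_q t
  have h1 : |u| ≤ √(1 + |t|) := by
    apply Real.abs_le_sqrt; linarith [le_abs_self t]
  refine (abs_add_le _ _).trans ?_
  refine add_le_add le_rfl ?_
  rw [abs_div, abs_mul, abs_of_pos (show 0 < √(1 + |t|) by linarith), div_le_iff₀ (by linarith)]
  gcongr

def DD (γ : ℝ) (t : ℝ) : ℝ := √(1 + |t|) ^ (-γ)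

lemma DD_int {γ : ℝ} (hγ : 3 < γ) : Integrable (fun v : R3 => DD γ (nsq v)) := by
  have h := integrable_one_add_norm (E := R3) (μ := volume) (r := γ) (by simpa using hγ)
  refine (h.const_mul (2 ^ γ)).mono' ?_ (ae_of_all _ fun v => ?_)
  · apply Continuous.aestronglyMeasurable
    unfold DD nsq
    apply Continuous.rpow_const (by fun_prop)
    intro v; left
    have := one_le_q (∑ i, v i ^ 2)
    linarith
  · have hq := one_le_q (nsq v)
    have h0 : 0 ≤ DD γ (nsq v) := by unfold DD; positivity
    rw [Real.norm_of_nonneg h0, DD]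
    have h1 : ‖v‖ ≤ √(1 + |nsq v|) := by
      rw [pi_norm_le_iff_of_nonneg (by positivity)]
      intro i
      rw [Real.norm_eq_abs]
      apply Real.abs_le_sqrt
      have := sq_le_nsq v i
      linarith [le_abs_self (nsq v)]
    have h2 : (1 + ‖v‖) ≤ 2 * √(1 + |nsq v|) := by linarith
    have h3 : (1 + ‖v‖) ^ γ ≤ 2 ^ γ * √(1 + |nsq v|) ^ γ := by
      rw [← Real.mul_rpow (by norm_num) (by positivity)]
      exact Real.rpow_le_rpow (by positivity) h2 (by linarith)
    rw [Real.rpow_neg (by positivity), Real.rpow_neg (by positivity), ← div_eq_mul_inv, ← one_div,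
      div_le_div_iff₀ (by positivity) (by positivity)]
    linarith

lemma DD1_int {γ : ℝ} (hγ : 3 < γ) : Integrable (fun t : ℝ => DD γ t * √(1 + |t|)) := by
  have h := integrable_one_add_norm (E := ℝ) (μ := volume) (r := (γ - 1) / 2) (by simp; linarith)
  refine h.congr (ae_of_all _ fun t => ?_)
  have h0 : 0 < 1 + |t| := by positivity
  simp only [DD, Real.norm_eq_abs]
  rw [Real.sqrt_eq_rpow, ← Real.rpow_mul h0.le, ← Real.rpow_add h0]
  congr 1; ring

structure Dec (m : ℝ × ℝ → ℝ) (Cμ γ : ℝ) : Prop where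
  smooth : ContDiff ℝ 1 m
  bd : ∀ e p : ℝ, |m (e, p)| + |d1 m (e, p)| + |d2 m (e, p)| ≤ Cμ / (1 + |e| ^ γ)

lemma Dec.nn {m : ℝ × ℝ → ℝ} {Cμ γ : ℝ} (h : Dec m Cμ γ) (hγ : 3 < γ) : 0 ≤ Cμ := by
  have := h.bd 0 0
  rw [abs_zero, Real.zero_rpow (by linarith)] at this
  have h1 := abs_nonneg (m (0,0))
  have h2 := abs_nonneg (d1 m (0,0))
  have h3 := abs_nonneg (d2 m (0,0))
  simp at this
  linarith

lemma Dec.abs_le {m : ℝ × ℝ → ℝ} {Cμ γ M : ℝ} (h : Dec m Cμ γ) (hγ : 3 < γ) (hM : 0 ≤ M) {c : ℝ} (hc : |c| ≤ M) (t p : ℝ) :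
    |m (√(1 + |t|) + c, p)| ≤ (Cμ * (2 * (1 + M)) ^ γ) * DD γ t := by
  have h1 := h.bd (√(1 + |t|) + c) p
  have h2 := dec_bd (h.nn hγ) (by linarith : 0 ≤ γ) hM (one_le_q t) hc
  have h3 := abs_nonneg (d1 m (√(1 + |t|) + c, p))
  have h4 := abs_nonneg (d2 m (√(1 + |t|) + c, p))
  unfold DD; linarith

lemma Dec.lip {m : ℝ × ℝ → ℝ} {Cμ γ M : ℝ} (h : Dec m Cμ γ) (hγ : 3 < γ) (hM : 0 ≤ M) {c c' : ℝ} (hc : |c| ≤ M)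
    (hc' : |c'| ≤ M) (t p p' : ℝ) :
    |m (√(1 + |t|) + c, p) - m (√(1 + |t|) + c', p')| ≤ (Cμ * (2 * (1 + M)) ^ γ) * DD γ t * (|c - c'| + |p - p'|) := by
  set s : Set (ℝ × ℝ) := (Metric.closedBall (√(1 + |t|)) M) ×ˢ (univ : Set ℝ) with hs
  have hconv : Convex ℝ s := (convex_closedBall _ _).prod convex_univ
  have hmem : ∀ {c : ℝ}, |c| ≤ M → ∀ p, ((√(1 + |t|) + c, p) : ℝ × ℝ) ∈ s := by
    intro c hc p
    refine ⟨?_, mem_univ _⟩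
    simpa [Real.dist_eq] using hc
  have hC := h.nn hγ
  have hK : 0 ≤ (Cμ * (2 * (1 + M)) ^ γ) * DD γ t := by unfold DD; positivity
  have hb : ∀ x ∈ s, ‖fderiv ℝ m x‖ ≤ (Cμ * (2 * (1 + M)) ^ γ) * DD γ t := by
    rintro ⟨e, p⟩ hx
    have he : |e - √(1 + |t|)| ≤ M := by
      have := hx.1
      rwa [Metric.mem_closedBall, Real.dist_eq] at this
    have h2 := dec_bd hC (by linarith : 0 ≤ γ) hM (one_le_q t) he
    rw [add_sub_cancel] at h2
    have h1 := h.bd e p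
    refine ContinuousLinearMap.opNorm_le_bound _ hK ?_
    rintro ⟨y, z⟩
    have e1 : fderiv ℝ m (e, p) (y, z) = y * d1 m (e, p) + z * d2 m (e, p) := by
      have : ((y, z) : ℝ × ℝ) = y • ((1, 0) : ℝ × ℝ) + z • ((0, 1) : ℝ × ℝ) := by simp
      rw [this, map_add, map_smul, map_smul]; rfl
    rw [e1]
    have hy : |y| ≤ ‖((y, z) : ℝ × ℝ)‖ := norm_fst_le (y, z)
    have hz : |z| ≤ ‖((y, z) : ℝ × ℝ)‖ := norm_snd_le (y, z)
    have h5 := norm_nonneg ((y, z) : ℝ × ℝ)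
    have h6 := abs_nonneg (m (e, p))
    calc ‖y * d1 m (e, p) + z * d2 m (e, p)‖ ≤ |y| * |d1 m (e, p)| + |z| * |d2 m (e, p)| := by
          rw [← abs_mul, ← abs_mul]; exact abs_add_le _ _
      _ ≤ ‖((y, z) : ℝ × ℝ)‖ * |d1 m (e, p)| + ‖((y, z) : ℝ × ℝ)‖ * |d2 m (e, p)| := by gcongr
      _ = (|d1 m (e, p)| + |d2 m (e, p)|) * ‖((y, z) : ℝ × ℝ)‖ := by ring
      _ ≤ _ := by
        apply mul_le_mul_of_nonneg_right _ h5
        unfold DD; linarith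
  have hmain := hconv.norm_image_sub_le_of_norm_fderiv_le (𝕜 := ℝ) (f := m)
    (fun x _ => (h.smooth.differentiable (by norm_num)).differentiableAt) hb (hmem hc' p') (hmem hc p)
  refine hmain.trans ?_
  gcongr
  rw [Prod.mk_sub_mk, Prod.norm_mk]
  apply max_le
  · rw [add_sub_add_left_eq_sub, Real.norm_eq_abs]; linarith [abs_nonneg (p - p')]
  · rw [Real.norm_eq_abs]; linarith [abs_nonneg (c - c')]

def JJ (A B : ℝ) (m : ℝ × ℝ → ℝ) (ρ c d : ℝ) : ℝ := ∫ v : R3, Fw A B m ρ c d (nsq v, v 1)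

lemma nsq_cont : Continuous nsq := by unfold nsq; fun_prop

lemma Fw_int {A B : ℝ} {m : ℝ × ℝ → ℝ} {Cμ γ : ℝ} (h : Dec m Cμ γ) (hγ : 3 < γ) (ρ c d : ℝ) :
    Integrable (fun v : R3 => Fw A B m ρ c d (nsq v, v 1)) := by
  refine ((DD_int hγ).const_mul ((|A| + |B|) * (Cμ * (2 * (1 + |c|)) ^ γ))).mono' ?_ (ae_of_all _ fun v => ?_)
  · exact ((Fw_cont h.smooth.continuous ρ c d).comp TM_cont).aestronglyMeasurable
  · rw [Fw, norm_mul, mul_assoc]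
    exact mul_le_mul (wt_bd A B (sq_le_nsq v 1)) (h.abs_le hγ (abs_nonneg c) le_rfl _ _) (norm_nonneg _) (by positivity)

lemma JJ_cd {A B : ℝ} {m : ℝ × ℝ → ℝ} {Cμ γ M R : ℝ} (h : Dec m Cμ γ) (hγ : 3 < γ) (hM : 0 ≤ M) : ∃ L : ℝ, 0 ≤ L ∧
    ∀ ρ c c' d d', |ρ| ≤ R → |c| ≤ M → |c'| ≤ M →
      |JJ A B m ρ c d - JJ A B m ρ c' d'| ≤ L * (|c - c'| + R * |d - d'|) := by
  set K := (|A| + |B|) * (Cμ * (2 * (1 + M)) ^ γ) with hK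
  have hC := h.nn hγ
  refine ⟨∫ v : R3, K * DD γ (nsq v), integral_nonneg (fun v => by simp only [DD]; positivity), ?_⟩
  intro ρ c c' d d' hρ hc hc'
  rw [JJ, JJ, ← integral_sub (Fw_int h hγ _ _ _) (Fw_int h hγ _ _ _), ← integral_mul_const, ← Real.norm_eq_abs]
  apply norm_integral_le_of_norm_le (((DD_int hγ).const_mul K).mul_const _)
  refine ae_of_all _ fun v => ?_
  rw [Fw, Fw, ← mul_sub, norm_mul]
  have h1 := wt_bd A B (sq_le_nsq v 1)
  have h2 := h.lip hγ hM hc hc' (nsq v) (ρ * (v 1 + d)) (ρ * (v 1 + d'))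
  have h3 : |ρ * (v 1 + d) - ρ * (v 1 + d')| ≤ R * |d - d'| := by
    rw [← mul_sub, abs_mul, add_sub_add_left_eq_sub]; gcongr
  have h4 : 0 ≤ Cμ * (2 * (1 + M)) ^ γ * DD γ (nsq v) := by simp only [DD]; positivity
  have h5 := h2.trans (mul_le_mul_of_nonneg_left (add_le_add_right h3 |c - c'|) h4)
  have h6 := mul_le_mul h1 h5 (abs_nonneg _) (by positivity)
  refine h6.trans (le_of_eq ?_)
  rw [hK]; ring

lemma JJ_rho {A B : ℝ} {m : ℝ × ℝ → ℝ} {Cμ γ M R r0 : ℝ} (h : Dec m Cμ γ) (hγ : 3 < γ) (hM : 0 ≤ M) (hr0 : 0 < r0) (hR : r0 ≤ R) :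
    ∃ L : ℝ, 0 ≤ L ∧ ∀ ρ ρ' c d, r0 ≤ ρ → ρ ≤ R → r0 ≤ ρ' → ρ' ≤ R → |c| ≤ M → |d| ≤ M →
      |JJ A B m ρ c d - JJ A B m ρ' c d| ≤ L * |ρ - ρ'| := by
  obtain ⟨K, hK0, hK⟩ := NN_lip hr0 hR hM A B
  have hC := h.nn hγ
  set K1 := Cμ * (2 * (1 + M)) ^ γ with hK1
  have hK10 : 0 ≤ K1 := by positivity
  refine ⟨π * ∫ t : ℝ, (K * K1) * (DD γ t * √(1 + |t|)), mul_nonneg pi_pos.le (integral_nonneg fun t => by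
    simp only [DD]; positivity), ?_⟩
  intro ρ ρ' c d h1 h2 h3 h4 hc hd
  have hF : ∀ ρ, Continuous (Fw A B m ρ c d) := fun ρ => Fw_cont h.smooth.continuous ρ c d
  have hS := fun ρ => int_slices (integrable_T (hF ρ) (Fw_int h hγ ρ c d))
  rw [JJ, JJ, int_T (hF ρ), int_T (hF ρ'), ← mul_sub, abs_mul, abs_of_pos pi_pos, mul_assoc]
  gcongr
  rw [(hS ρ).2, (hS ρ').2, ← integral_sub (hS ρ).1 (hS ρ').1, ← integral_mul_const, ← Real.norm_eq_abs]
  apply norm_integral_le_of_norm_le (((DD1_int hγ).const_mul _).mul_const _)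
  refine ae_of_all _ fun t => ?_
  rcases le_or_gt 0 t with ht | ht
  · have := hK (fun w => m (√(1 + |t|) + c, w)) (K1 * DD γ t) d t ρ ρ'
      (by have := h.smooth.continuous; fun_prop) (by simp only [DD]; positivity)
      (fun w => h.abs_le hγ hM hc t w) hd ht h1 h2 h3 h4
    refine this.trans (le_of_eq ?_)
    ring
  · rw [Real.sqrt_eq_zero_of_nonpos ht.le]
    simp only [neg_zero, intervalIntegral.integral_same, sub_zero, norm_zero, DD]
    positivity

lemma JJ_lip {A B : ℝ} {m : ℝ × ℝ → ℝ} {Cμ γ M R r0 : ℝ} (h : Dec m Cμ γ) (hγ : 3 < γ) (hM : 0 ≤ M) (hr0 : 0 < r0) (hR : r0 ≤ R) :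
    ∃ L : ℝ, 0 ≤ L ∧ ∀ ρ ρ' c c' d d', r0 ≤ ρ → ρ ≤ R → r0 ≤ ρ' → ρ' ≤ R → |c| ≤ M → |c'| ≤ M → |d| ≤ M →
      |JJ A B m ρ c d - JJ A B m ρ' c' d'| ≤ L * (|ρ - ρ'| + |c - c'| + |d - d'|) := by
  obtain ⟨L1, hL1, H1⟩ := JJ_cd (A := A) (B := B) (R := R) h hγ hM
  obtain ⟨L2, hL2, H2⟩ := JJ_rho (A := A) (B := B) h hγ hM hr0 hR
  have hR0 : 0 ≤ R := by linarith
  refine ⟨L2 + L1 + L1 * R, by positivity, ?_⟩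
  intro ρ ρ' c c' d d' h1 h2 h3 h4 hc hc' hd
  have a1 := H2 ρ ρ' c d h1 h2 h3 h4 hc hd
  have a2 := H1 ρ' c c' d d' (by rw [abs_of_nonneg (by linarith)]; exact h4) hc hc'
  have b1 := abs_nonneg (ρ - ρ')
  have b2 := abs_nonneg (c - c')
  have b3 := abs_nonneg (d - d')
  calc |JJ A B m ρ c d - JJ A B m ρ' c' d'| ≤ |JJ A B m ρ c d - JJ A B m ρ' c d| + |JJ A B m ρ' c d - JJ A B m ρ' c' d'| :=
        abs_sub_le _ _ _
    _ ≤ L2 * |ρ - ρ'| + L1 * (|c - c'| + R * |d - d'|) := add_le_add a1 a2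
    _ ≤ _ := by
      have : 0 ≤ L1 * R := by positivity
      nlinarith [mul_nonneg hL1 b1, mul_nonneg hL1 b3, mul_nonneg hL2 b2, mul_nonneg hL2 b3, mul_nonneg this b1, mul_nonneg this b2]

end

open MeasureTheory Real Set Filter
open scoped ENNReal NNReal ComplexConjugate
noncomputable section

lemma rotZ_mp (β : ℝ) : MeasurePreserving (rotZ β) (volume : Measure R3) volume := by
  set Mx : Matrix (Fin 3) (Fin 3) ℝ := !![Real.cos β, -Real.sin β, 0; Real.sin β, Real.cos β, 0; 0, 0, 1] with hMx
  have hdet : Mx.det = 1 := by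
    rw [hMx, Matrix.det_fin_three]
    simp
    nlinarith [Real.cos_sq_add_sin_sq β]
  have he : rotZ β = Matrix.toLin' Mx := by
    ext v i
    fin_cases i <;> simp [rotZ, hMx, Matrix.toLin'_apply, Matrix.mulVec, dotProduct, Fin.sum_univ_three] <;> ring
  have h := Real.map_matrix_volume_pi_eq_smul_volume_pi (M := Mx) (by rw [hdet]; norm_num)
  rw [hdet] at h
  refine ⟨?_, ?_⟩
  · have : Continuous (rotZ β) := by
      rw [he]; exact LinearMap.continuous_of_finiteDimensional _
    exact this.measurable
  · rw [he, h]; simp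

lemma rotZ_inv (β : ℝ) (x : R3) : rotZ β (rotZ (-β) x) = x := by
  have h := Real.cos_sq_add_sin_sq β
  ext i
  fin_cases i <;> simp [rotZ]
  · linear_combination x 0 * h
  · linear_combination x 1 * h

lemma rad_rotZ (β : ℝ) (x : R3) : rad (rotZ β x) = rad x := by
  unfold rad rotZ
  congr 1
  simp
  linear_combination (x 0 ^ 2 + x 1 ^ 2) * Real.cos_sq_add_sin_sq β

lemma nsq_rotZ (β : ℝ) (x : R3) : nsq (rotZ β x) = nsq x := by
  simp only [nsq, Fin.sum_univ_three, rotZ]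
  simp
  linear_combination (x 0 ^ 2 + x 1 ^ 2) * Real.cos_sq_add_sin_sq β

lemma rotZ_equiv_int (β : ℝ) (g : R3 → ℝ) : ∫ v, g (rotZ β v) = ∫ v, g v := by
  have hc : Continuous (rotZ β) := by
    unfold rotZ
    refine continuous_pi fun i => ?_
    fin_cases i <;> simp <;> fun_prop
  have hc' : Continuous (rotZ (-β)) := by
    unfold rotZ
    refine continuous_pi fun i => ?_
    fin_cases i <;> simp <;> fun_prop
  let e : R3 ≃ᵐ R3 :=
    { toFun := rotZ β, invFun := rotZ (-β)
      left_inv := fun x => by have := rotZ_inv (-β) x; rwa [neg_neg] at this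
      right_inv := rotZ_inv β
      measurable_toFun := hc.measurable
      measurable_invFun := hc'.measurable }
  exact (rotZ_mp β).integral_comp e.measurableEmbedding g

lemma vb_eq (v : R3) : √(1 + |nsq v|) = vb v := by rw [abs_of_nonneg (nsq_nonneg v), vb]

lemma rot_dot {x : R3} (hx : 0 < rad x) : ∃ β, ∀ v, dot (rotZ β v) (ephi x) = v 1 := by
  obtain ⟨β, hβ⟩ := rot_rep x
  refine ⟨β, fun v => ?_⟩
  have h0 : x 0 = Real.cos β * rad x := by
    have := congrFun hβ 0
    simpa [rotZ] using this
  have h1 : x 1 = Real.sin β * rad x := by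
    have := congrFun hβ 1
    simpa [rotZ] using this
  simp only [dot, ephi, Fin.sum_univ_three, rotZ]
  simp only [Matrix.cons_val_zero, Matrix.cons_val_one, Matrix.cons_val]
  rw [h0, h1]
  field_simp
  linear_combination v 1 * Real.cos_sq_add_sin_sq β

/-- The source as a function of radius and the potentials. -/
def HH (A B : ℝ) (μ : Bool → ℝ × ℝ → ℝ) (ρ c d : ℝ) : ℝ := JJ A B (μ true) ρ c d - JJ A B (μ false) ρ (-c) (-d)

lemma src_HH {A B : ℝ} {μ : Bool → ℝ × ℝ → ℝ} {Cμ γ : ℝ} (h : ∀ b, Dec (μ b) Cμ γ) (hγ : 3 < γ) (φ0 Aφ0 : R3 → ℝ)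
    {x : R3} (hx : 0 < rad x) :
    ∫ v : R3, (A + B * (dot v (ephi x) / vb v)) * (μ true (epm 1 φ0 x v, ppm 1 Aφ0 x v)
          - μ false (epm (-1) φ0 x v, ppm (-1) Aφ0 x v)) = HH A B μ (rad x) (φ0 x) (Aφ0 x) := by
  obtain ⟨β, hβ⟩ := rot_dot hx
  rw [← rotZ_equiv_int β, HH, JJ, JJ, ← integral_sub (Fw_int (h true) hγ _ _ _) (Fw_int (h false) hγ _ _ _)]
  congr 1
  ext v
  simp only [epm, ppm, hβ, Fw, vb_eq]
  have e : vb (rotZ β v) = vb v := by simp only [vb, nsq_rotZ]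
  rw [e]
  simp only [one_mul, neg_mul]
  ring

lemma HH_Lp1 {A B : ℝ} {μ : Bool → ℝ × ℝ → ℝ} {Cμ γ : ℝ} (h : ∀ b, Dec (μ b) Cμ γ) (hγ : 3 < γ) {a : ℝ} (ha : 1 < a)
    {φ0 Aφ0 : R3 → ℝ} (h1 : ContinuousOn φ0 (closure (torus a))) (h2 : ContinuousOn Aφ0 (closure (torus a))) :
    ∃ L : ℝ, ∀ x ∈ closure (torus a), ∀ y ∈ closure (torus a),
      |HH A B μ (rad x) (φ0 x) (Aφ0 x) - HH A B μ (rad y) (φ0 y) (Aφ0 y)| ≤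
        L * (|rad x - rad y| + |φ0 x - φ0 y| + |Aφ0 x - Aφ0 y|) := by
  obtain ⟨M1, hM1⟩ := (cl_compact a).exists_bound_of_continuousOn h1
  obtain ⟨M2, hM2⟩ := (cl_compact a).exists_bound_of_continuousOn h2
  set M := max 0 (max M1 M2) with hM
  have m1 : ∀ x ∈ closure (torus a), |φ0 x| ≤ M := fun x hx => (hM1 x hx).trans ((le_max_left _ _).trans (le_max_right _ _))
  have m2 : ∀ x ∈ closure (torus a), |Aφ0 x| ≤ M := fun x hx => (hM2 x hx).trans ((le_max_right _ _).trans (le_max_right _ _))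
  have hM0 : 0 ≤ M := le_max_left _ _
  obtain ⟨L1, hL1, H1⟩ := JJ_lip (A := A) (B := B) (h true) hγ hM0 (show 0 < a - 1 by linarith) (show a - 1 ≤ a + 1 by linarith)
  obtain ⟨L2, hL2, H2⟩ := JJ_lip (A := A) (B := B) (h false) hγ hM0 (show 0 < a - 1 by linarith) (show a - 1 ≤ a + 1 by linarith)
  refine ⟨L1 + L2, fun x hx y hy => ?_⟩
  have a1 := H1 (rad x) (rad y) (φ0 x) (φ0 y) (Aφ0 x) (Aφ0 y) (cl_rad hx).1 (cl_rad hx).2 (cl_rad hy).1 (cl_rad hy).2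
    (m1 x hx) (m1 y hy) (m2 x hx)
  have a2 := H2 (rad x) (rad y) (-φ0 x) (-φ0 y) (-Aφ0 x) (-Aφ0 y) (cl_rad hx).1 (cl_rad hx).2 (cl_rad hy).1 (cl_rad hy).2
    (by rw [abs_neg]; exact m1 x hx) (by rw [abs_neg]; exact m1 y hy) (by rw [abs_neg]; exact m2 x hx)
  have n1 : |(-φ0 x) - (-φ0 y)| = |φ0 x - φ0 y| := by rw [← abs_neg]; congr 1; ring
  have n2 : |(-Aφ0 x) - (-Aφ0 y)| = |Aφ0 x - Aφ0 y| := by rw [← abs_neg]; congr 1; ring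
  rw [n1, n2] at a2
  rw [HH, HH, sub_sub_sub_comm]
  refine (abs_sub _ _).trans ?_
  rw [add_mul]
  exact add_le_add a1 a2

lemma rad_Lp1 {a : ℝ} (ha : 1 < a) : Lp1 (closure (torus a)) rad :=
  lip_of_smooth (cl_compact a) isOpen_Pos (cl_Pos ha) rad_contDiffOn

/-- continuity and Lipschitz continuity of the source -/
lemma HH_cont {A B : ℝ} {μ : Bool → ℝ × ℝ → ℝ} {Cμ γ : ℝ} (h : ∀ b, Dec (μ b) Cμ γ) (hγ : 3 < γ) {a : ℝ} (ha : 1 < a)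
    {φ0 Aφ0 : R3 → ℝ} (h1 : ContinuousOn φ0 (closure (torus a))) (h2 : ContinuousOn Aφ0 (closure (torus a))) :
    ContinuousOn (fun x => HH A B μ (rad x) (φ0 x) (Aφ0 x)) (closure (torus a)) := by
  obtain ⟨L, hL⟩ := HH_Lp1 (A := A) (B := B) h hγ ha h1 h2
  intro x hx
  rw [ContinuousWithinAt, tendsto_iff_norm_sub_tendsto_zero]
  have hb : ContinuousWithinAt (fun y => L * (|rad y - rad x| + |φ0 y - φ0 x| + |Aφ0 y - Aφ0 x|)) (closure (torus a)) x := by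
    have c1 := h1 x hx
    have c2 := h2 x hx
    have c3 : ContinuousWithinAt rad (closure (torus a)) x := continuous_rad.continuousWithinAt
    exact continuousWithinAt_const.mul (((c3.sub continuousWithinAt_const).abs.add (c1.sub continuousWithinAt_const).abs).add
      (c2.sub continuousWithinAt_const).abs)
  have hb' : Tendsto (fun y => L * (|rad y - rad x| + |φ0 y - φ0 x| + |Aφ0 y - Aφ0 x|)) (nhdsWithin x (closure (torus a))) (nhds 0) := by
    have := hb.tendsto
    simpa using this
  refine squeeze_zero' (Eventually.of_forall fun y => norm_nonneg _) ?_ hb'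
  filter_upwards [self_mem_nhdsWithin] with y hy using hL y hy x hx

lemma HH_lip {A B : ℝ} {μ : Bool → ℝ × ℝ → ℝ} {Cμ γ : ℝ} (h : ∀ b, Dec (μ b) Cμ γ) (hγ : 3 < γ) {a : ℝ} (ha : 1 < a)
    {φ0 Aφ0 : R3 → ℝ} (h1 : Lp1 (closure (torus a)) φ0) (h2 : Lp1 (closure (torus a)) Aφ0) :
    Lp1 (closure (torus a)) (fun x => HH A B μ (rad x) (φ0 x) (Aφ0 x)) := by
  obtain ⟨L, hL⟩ := HH_Lp1 (A := A) (B := B) h hγ ha h1.continuousOn h2.continuousOn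
  obtain ⟨K1, hK1⟩ := h1
  obtain ⟨K2, hK2⟩ := h2
  obtain ⟨K3, hK3⟩ := rad_Lp1 ha
  refine ⟨|L| * (K3 + K1 + K2), fun x hx y hy => (hL x hx y hy).trans ?_⟩
  have e1 : |φ0 x - φ0 y| ≤ K1 * ‖x - y‖ := hK1 x hx y hy
  have e2 : |Aφ0 x - Aφ0 y| ≤ K2 * ‖x - y‖ := hK2 x hx y hy
  have e3 : |rad x - rad y| ≤ K3 * ‖x - y‖ := hK3 x hx y hy
  calc L * (|rad x - rad y| + |φ0 x - φ0 y| + |Aφ0 x - Aφ0 y|) ≤ |L| * (|rad x - rad y| + |φ0 x - φ0 y| + |Aφ0 x - Aφ0 y|) := by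
        gcongr; exact le_abs_self L
    _ ≤ |L| * (K3 * ‖x - y‖ + K1 * ‖x - y‖ + K2 * ‖x - y‖) := by gcongr
    _ = _ := by ring

end

open MeasureTheory Real Set Filter
open scoped ENNReal NNReal ComplexConjugate
noncomputable section

lemma cl_radpos {a : ℝ} (ha : 1 < a) {x : R3} (hx : x ∈ closure (torus a)) : 0 < rad x := by
  have := (cl_rad hx).1
  linarith

lemma inv_rad_smooth {n : WithTop ℕ∞} (h : ∀ x ∈ Pos, 0 < rad x) : ContDiffOn ℝ n (fun x => (rad x)⁻¹) Pos :=
  rad_contDiffOn.inv fun x hx => (h x hx).ne'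

lemma invsq_Lp1 {a : ℝ} (ha : 1 < a) (h : ∀ x ∈ Pos, 0 < rad x) : Lp1 (closure (torus a)) (fun x => ((rad x)^2)⁻¹) := by
  refine lip_of_smooth (cl_compact a) isOpen_Pos (cl_Pos ha) ?_
  exact (rad_contDiffOn.pow 2).inv fun x hx => (pow_pos (h x hx) 2).ne'

lemma holder_pair {X Y Z : Type*} [PseudoEMetricSpace X] [PseudoEMetricSpace Y] [PseudoEMetricSpace Z] {s : Set X} {r : ℝ≥0}
    {f : X → Y} {g : X → Z} (hf : ∃ K : ℝ≥0, HolderOnWith K r f s) (hg : ∃ K : ℝ≥0, HolderOnWith K r g s) :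
    ∃ K : ℝ≥0, HolderOnWith K r f s ∧ HolderOnWith K r g s := by
  obtain ⟨K, hK⟩ := hf
  obtain ⟨M, hM⟩ := hg
  refine ⟨max K M, fun x hx y hy => (hK x hx y hy).trans ?_, fun x hx y hy => (hM x hx y hy).trans ?_⟩
  · gcongr; exact le_max_left _ _
  · gcongr; exact le_max_right _ _

lemma C1b_gradW {β : ℝ} {s : Set R3} (hu : UniqueDiffOn ℝ s) {f : R3 → ℝ} (h : C2b β s f) :
    C1b β s (fun x => fun i => -(gradW s f x i)) := by
  have h1 := (h.fderivW hu).clm (ContinuousLinearMap.pi (fun i : Fin 3 =>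
    -(ContinuousLinearMap.apply ℝ ℝ (Pi.single i 1 : R3))))
  refine h1.congr fun x hx => ?_
  ext i
  simp [gradW, pdW]

lemma C1b_pdW {β : ℝ} {s : Set R3} (hu : UniqueDiffOn ℝ s) {f : R3 → ℝ} (h : C2b β s f) (i : Fin 3) :
    C1b β s (pdW s f i) :=
  (h.fderivW hu).clm (ContinuousLinearMap.apply ℝ ℝ (Pi.single i 1 : R3))

lemma C1b_sub {β : ℝ} {s : Set R3} {f g : R3 → ℝ} (hf : C1b β s f) (hg : C1b β s g) : C1b β s (fun x => f x - g x) :=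
  (hf.add (hg.clm (-(ContinuousLinearMap.id ℝ ℝ)))).congr fun x hx => by simp [sub_eq_add_neg]

lemma C1b_vec {β : ℝ} {s : Set R3} {f g h : R3 → ℝ} (hf : C1b β s f) (hg : C1b β s g) (hh : C1b β s h) :
    C1b β s (fun x => (![f x, g x, h x] : R3)) := by
  have e := ((hf.clm (ContinuousLinearMap.single ℝ (fun _ : Fin 3 => ℝ) 0)).add
    (hg.clm (ContinuousLinearMap.single ℝ (fun _ : Fin 3 => ℝ) 1))).add
    (hh.clm (ContinuousLinearMap.single ℝ (fun _ : Fin 3 => ℝ) 2))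
  refine e.congr fun x hx => ?_
  ext i
  fin_cases i <;> simp [Pi.single_apply]

lemma C1b_curlW {β : ℝ} {s : Set R3} (hu : UniqueDiffOn ℝ s) {F : R3 → R3} (h : ∀ i, C2b β s (fun x => F x i)) :
    C1b β s (curlW s F) :=
  C1b_vec (C1b_sub (C1b_pdW hu (h 2) 1) (C1b_pdW hu (h 1) 2)) (C1b_sub (C1b_pdW hu (h 0) 2) (C1b_pdW hu (h 2) 0))
    (C1b_sub (C1b_pdW hu (h 1) 0) (C1b_pdW hu (h 0) 1))

lemma C2b_ephi {a : ℝ} (ha : 1 < a) (hp : ∀ x ∈ Pos, 0 < rad x) {β : ℝ} (hβ0 : 0 < β) (hβ1 : β < 1) (i : Fin 3) :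
    C2b β (closure (torus a)) (fun x => ephi x i) := by
  refine C2b_of_smooth hβ0 hβ1 (cl_compact a) isOpen_Pos (cl_Pos ha) ?_
  have hr := inv_rad_smooth (n := 3) hp
  have hc : ∀ j : Fin 3, ContDiffOn ℝ 3 (fun x : R3 => x j) Pos := fun j => (contDiff_apply ℝ ℝ j).contDiffOn
  fin_cases i
  · exact ((hc 1).neg.mul hr).congr fun x hx => by simp [ephi, div_eq_mul_inv]
  · exact ((hc 0).mul hr).congr fun x hx => by simp [ephi, div_eq_mul_inv]
  · exact (contDiffOn_const (c := (0:ℝ))).congr fun x hx => by simp [ephi]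


end

/-- Lemma C.1, regularity of equilibria. If continuous toroidally
symmetric potentials `φ⁰, A_φ⁰` vanishing on `∂Ω` solve the equilibrium Maxwell
equations distributionally, then they are `C²` on `Ω̄` with `α`-Hölder second
derivatives for every `α ∈ (0,1)`, and consequently `E⁰ = −∇φ⁰`, `B⁰ = ∇×(A_φ⁰ e_φ)`
are `C¹` on `Ω̄` with `α`-Hölder first derivatives for every `α ∈ (0,1)`. -/
theorem stmt14 (a : ℝ) (ha : 1 < a)
    (μ : Bool → ℝ × ℝ → ℝ) (hμ1 : ∀ b, ContDiff ℝ 1 (μ b)) (hμ0 : ∀ b q, 0 ≤ μ b q)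
    (Cμ γ : ℝ) (hγ : 3 < γ)
    (hdecay : ∀ b, ∀ e p : ℝ,
      |μ b (e, p)| + |d1 (μ b) (e, p)| + |d2 (μ b) (e, p)| ≤ Cμ / (1 + |e| ^ γ))
    (φ0 Aφ0 : R3 → ℝ)
    (hφc : ContinuousOn φ0 (closure (torus a)))
    (hAc : ContinuousOn Aφ0 (closure (torus a)))
    (hφs : torSym φ0) (hAs : torSym Aφ0)
    (hφb : ∀ x ∈ frontier (torus a), φ0 x = 0)
    (hAb : ∀ x ∈ frontier (torus a), Aφ0 x = 0)
    (hdist1 : ∀ ψ : R3 → ℝ, ContDiff ℝ (⊤ : ℕ∞) ψ → HasCompactSupport ψ → tsupport ψ ⊆ torus a →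
      -∫ x in torus a, φ0 x * lap ψ x =
        ∫ x in torus a, (∫ v : R3, (μ true (epm 1 φ0 x v, ppm 1 Aφ0 x v)
          - μ false (epm (-1) φ0 x v, ppm (-1) Aφ0 x v))) * ψ x)
    (hdist2 : ∀ ψ : R3 → ℝ, ContDiff ℝ (⊤ : ℕ∞) ψ → HasCompactSupport ψ → tsupport ψ ⊆ torus a →
      (-∫ x in torus a, Aφ0 x * lap ψ x)
          + ∫ x in torus a, (Aφ0 x / (rad x) ^ 2) * ψ x =
        ∫ x in torus a, (∫ v : R3, (dot v (ephi x) / vb v)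
          * (μ true (epm 1 φ0 x v, ppm 1 Aφ0 x v)
            - μ false (epm (-1) φ0 x v, ppm (-1) Aφ0 x v))) * ψ x) :
    ContDiffOn ℝ 2 φ0 (closure (torus a)) ∧
    ContDiffOn ℝ 2 Aφ0 (closure (torus a)) ∧
    (∀ α : ℝ, 0 < α → α < 1 → ∃ Cα : ℝ≥0,
      HolderOnWith Cα α.toNNReal
        (iteratedFDerivWithin ℝ 2 φ0 (closure (torus a))) (closure (torus a)) ∧
      HolderOnWith Cα α.toNNReal
        (iteratedFDerivWithin ℝ 2 Aφ0 (closure (torus a))) (closure (torus a))) ∧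
    ContDiffOn ℝ 1 (fun x => fun i => -(gradW (closure (torus a)) φ0 x i))
      (closure (torus a)) ∧
    ContDiffOn ℝ 1
      (curlW (closure (torus a)) (fun y => fun i => Aφ0 y * ephi y i))
      (closure (torus a)) ∧
    (∀ α : ℝ, 0 < α → α < 1 → ∃ Cα : ℝ≥0,
      HolderOnWith Cα α.toNNReal
        (iteratedFDerivWithin ℝ 1 (fun x => fun i => -(gradW (closure (torus a)) φ0 x i))
          (closure (torus a))) (closure (torus a)) ∧
      HolderOnWith Cα α.toNNReal
        (iteratedFDerivWithin ℝ 1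
          (curlW (closure (torus a)) (fun y => fun i => Aφ0 y * ephi y i))
          (closure (torus a))) (closure (torus a))) := by
  have hp : ∀ x ∈ Pos, 0 < rad x := fun x hx => hx
  have hu := cl_uniqueDiff ha
  have hK := cl_compact a
  have hD : ∀ b, Dec (μ b) Cμ γ := fun b => ⟨hμ1 b, hdecay b⟩
  have hT : MeasurableSet (torus a) := (torus_open a).measurableSet
  -- distributional equations
  have hE1 : DistEq (torus a) φ0 (fun x => HH 1 0 μ (rad x) (φ0 x) (Aφ0 x)) := by
    intro ψ h1 h2 h3
    rw [hdist1 ψ h1 h2 h3]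
    refine setIntegral_congr_fun hT fun x hx => ?_
    have := src_HH (A := 1) (B := 0) hD hγ φ0 Aφ0 (cl_radpos ha (subset_closure hx))
    simp only [zero_mul, add_zero, one_mul] at this
    simp only [this]
  have hiL := invsq_Lp1 ha hp
  have hc0 := HH_cont (A := 0) (B := 1) hD hγ ha hφc hAc
  have hc1 := hAc.mul hiL.continuousOn
  have hE2 : DistEq (torus a) Aφ0
      (fun x => HH 0 1 μ (rad x) (φ0 x) (Aφ0 x) + -(Aφ0 x * ((rad x)^2)⁻¹)) := by
    intro ψ h1 h2 h3
    have e1 := hdist2 ψ h1 h2 h3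
    have e2 : ∫ x in torus a, (∫ v : R3, (dot v (ephi x) / vb v)
          * (μ true (epm 1 φ0 x v, ppm 1 Aφ0 x v)
            - μ false (epm (-1) φ0 x v, ppm (-1) Aφ0 x v))) * ψ x
        = ∫ x in torus a, HH 0 1 μ (rad x) (φ0 x) (Aφ0 x) * ψ x := by
      refine setIntegral_congr_fun hT fun x hx => ?_
      have := src_HH (A := 0) (B := 1) hD hγ φ0 Aφ0 (cl_radpos ha (subset_closure hx))
      simp only [zero_add, one_mul] at this
      simp only [this]
    have i1 : IntegrableOn (fun x => HH 0 1 μ (rad x) (φ0 x) (Aφ0 x) * ψ x) (torus a) :=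
      ((hc0.mul h1.continuous.continuousOn).integrableOn_compact hK).mono_set subset_closure
    have i2 : IntegrableOn (fun x => Aφ0 x / (rad x)^2 * ψ x) (torus a) := by
      simp only [div_eq_mul_inv]
      exact ((hc1.mul h1.continuous.continuousOn).integrableOn_compact hK).mono_set subset_closure
    rw [e2] at e1
    rw [eq_sub_of_add_eq e1, ← integral_sub i1 i2]
    congr 1
    ext x
    ring
  have hs1 : torSym (fun x => HH 1 0 μ (rad x) (φ0 x) (Aφ0 x)) := fun β x => by
    simp only [rad_rotZ, hφs β x, hAs β x]
  have hs2 : torSym (fun x => HH 0 1 μ (rad x) (φ0 x) (Aφ0 x) + -(Aφ0 x * ((rad x)^2)⁻¹)) := fun β x => by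
    simp only [rad_rotZ, hφs β x, hAs β x]
  have l1 := gen1 ha hφc (HH_cont hD hγ ha hφc hAc) hE1 hφb hφs hs1
  have l2 := gen1 ha hAc (hc0.add hc1.neg) hE2 hAb hAs hs2
  have k1 := HH_lip (A := 1) (B := 0) hD hγ ha l1 l2
  have k2 := (HH_lip (A := 0) (B := 1) hD hγ ha l1 l2).add (l2.mul hK hiL).neg
  have r1 : ∀ β : ℝ, 0 < β → β < 1 → C2b β (closure (torus a)) φ0 := fun β h0 h1 =>
    gen2 ha hφc k1 hE1 hφb hφs hs1 h0 h1
  have r2 : ∀ β : ℝ, 0 < β → β < 1 → C2b β (closure (torus a)) Aφ0 := fun β h0 h1 =>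
    gen2 ha hAc k2 hE2 hAb hAs hs2 h0 h1
  have rE : ∀ β : ℝ, 0 < β → β < 1 → C1b β (closure (torus a))
      (fun x => fun i => -(gradW (closure (torus a)) φ0 x i)) := fun β h0 h1 =>
    C1b_gradW hu (r1 β h0 h1)
  have rB : ∀ β : ℝ, 0 < β → β < 1 → C1b β (closure (torus a))
      (curlW (closure (torus a)) (fun y => fun i => Aφ0 y * ephi y i)) := fun β h0 h1 =>
    C1b_curlW hu fun i => (r2 β h0 h1).bil (ContinuousLinearMap.mul ℝ ℝ) (C2b_ephi ha hp h0 h1 i)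
  have p0 : (0:ℝ) < 1/2 := by norm_num
  have p1 : (1/2:ℝ) < 1 := by norm_num
  refine ⟨(r1 _ p0 p1).contDiffOn p0 hu, (r2 _ p0 p1).contDiffOn p0 hu, fun α h0 h1 => ?_,
    (rE _ p0 p1).contDiffOn p0 hu, (rB _ p0 p1).contDiffOn p0 hu, fun α h0 h1 => ?_⟩
  · exact holder_pair (((r1 α h0 h1).iter hu).holder h0) (((r2 α h0 h1).iter hu).holder h0)
  · exact holder_pair (((rE α h0 h1).iter hu).holder h0) (((rB α h0 h1).iter hu).holder h0)

end
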